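/- There exists a function Γ(m,n,d), independent of N and of K, with the following property: for every algebraically closed field K and every N, let G = R^m over R = K[x_1,…,x_N], let M and Q be submodules of G, and let I be an ideal of R, all three having generating sets bounded by (n,d). Then each of the following has a generating set bounded by (Γ(m,n,d), Γ(m,n,d)): the ideal M :_R Q = {r ∈ R : rQ ⊆ M} of R; the submodule M :_G I = {u ∈ G : Iu ⊆ M} of G; and the saturation M :_G I^∞ = {u ∈ G : I^k u ⊆ M for some k ≥ 0} of M with respect to I in G. -/

import Mathlib

universe u

namespace SmallSubalgebra

open Polynomial

/-- An `ℕ`-grading of a `K`-algebra `S` whose degree zero part is `K`, presented by the algebra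
map `γ` sending `∑ s_k` to `∑ s_k X ^ k`. -/
structure PolyGrading (K S : Type*) [Field K] [CommRing S] [Algebra K S] where
  γ : S →ₐ[K] S[X]
  eval_one : ∀ s, (γ s).eval 1 = s
  coact : ∀ s k, γ ((γ s).coeff k) = monomial k ((γ s).coeff k)
  coeff_zero : ∀ s, ∃ c : K, (γ s).coeff 0 = algebraMap K S c

/-- The polynomials all of whose coefficients lie in the subalgebra `A`. -/
def coeffsIn {K S : Type*} [Field K] [CommRing S] [Algebra K S] (A : Subalgebra K S) :
    Subalgebra K S[X] where
  carrier := {p | ∀ k, p.coeff k ∈ A}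
  mul_mem' := by
    intro p q hp hq k
    rw [coeff_mul]
    exact sum_mem fun x _ => mul_mem (hp _) (hq _)
  add_mem' := by
    intro p q hp hq k
    rw [coeff_add]
    exact add_mem (hp _) (hq _)
  algebraMap_mem' := by
    intro c k
    rw [Polynomial.algebraMap_apply, coeff_C]
    split_ifs
    · exact A.algebraMap_mem c
    · exact A.zero_mem

section

variable {K S : Type*} [Field K] [CommRing S] [Algebra K S]

theorem C_mem_coeffsIn {A : Subalgebra K S} {a : S} (ha : a ∈ A) : C a ∈ coeffsIn A := by
  intro k
  rw [coeff_C]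
  split_ifs
  · exact ha
  · exact A.zero_mem

theorem X_mem_coeffsIn {A : Subalgebra K S} : (X : S[X]) ∈ coeffsIn A := by
  intro k
  rw [coeff_X]
  split_ifs
  · exact A.one_mem
  · exact A.zero_mem

theorem monomial_mem_coeffsIn {A : Subalgebra K S} {a : S} (ha : a ∈ A) (n : ℕ) :
    monomial n a ∈ coeffsIn A := by
  rw [← C_mul_X_pow_eq_monomial]
  exact mul_mem (C_mem_coeffsIn ha) (pow_mem X_mem_coeffsIn n)

theorem comp_mem_coeffsIn {A : Subalgebra K S} {p q : S[X]} (hp : p ∈ coeffsIn A)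
    (hq : q ∈ coeffsIn A) : p.comp q ∈ coeffsIn A := by
  rw [comp_eq_sum_left, Polynomial.sum]
  exact sum_mem fun i _ => mul_mem (C_mem_coeffsIn (hp i)) (pow_mem hq i)

theorem taylor_mem_coeffsIn {A : Subalgebra K S} {p : S[X]} (hp : p ∈ coeffsIn A) {a : S}
    (ha : a ∈ A) : taylor a p ∈ coeffsIn A := by
  rw [taylor_apply]
  exact comp_mem_coeffsIn hp (add_mem X_mem_coeffsIn (C_mem_coeffsIn ha))

namespace PolyGrading

variable (G : PolyGrading K S)

/-- The degree of an element with respect to a grading. -/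
noncomputable def deg (s : S) : ℕ := (G.γ s).natDegree

/-- The elements homogeneous of degree `n`. -/
def IsHom (n : ℕ) (s : S) : Prop := G.γ s = monomial n s

theorem sum_coeff (s : S) : ∑ k ∈ Finset.range (G.deg s + 1), (G.γ s).coeff k = s := by
  have h := G.eval_one s
  rw [eval_eq_sum_range] at h
  simpa [deg] using h

theorem isHom_coeff (s : S) (k : ℕ) : G.IsHom k ((G.γ s).coeff k) := G.coact s k

variable {G}

theorem IsHom.deg_le {n : ℕ} {s : S} (h : G.IsHom n s) : G.deg s ≤ n := by
  unfold deg
  rw [h]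
  exact natDegree_monomial_le s

theorem IsHom.coeff {n : ℕ} {s : S} (h : G.IsHom n s) (k : ℕ) :
    (G.γ s).coeff k = if n = k then s else 0 := by
  rw [h, coeff_monomial]

variable (G)

theorem deg_eq_zero {s : S} (h : G.deg s = 0) : ∃ c : K, s = algebraMap K S c := by
  obtain ⟨c, hc⟩ := G.coeff_zero s
  refine ⟨c, ?_⟩
  have := G.sum_coeff s
  rw [h] at this
  simpa [hc] using this.symm

theorem eq_algebraMap_of_isHom_zero {s : S} (h : G.IsHom 0 s) : ∃ c : K, s = algebraMap K S c :=
  G.deg_eq_zero (Nat.le_zero.1 h.deg_le)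

theorem γ_algebraMap (c : K) : G.γ (algebraMap K S c) = C (algebraMap K S c) := by
  rw [AlgHom.commutes, Polynomial.algebraMap_apply]

theorem deg_algebraMap (c : K) : G.deg (algebraMap K S c) = 0 := by
  unfold deg
  rw [γ_algebraMap, natDegree_C]

/-- A subalgebra containing, with each element, its homogeneous components. -/
def Homog (A : Subalgebra K S) : Prop := ∀ a ∈ A, ∀ k, (G.γ a).coeff k ∈ A

theorem homog_adjoin {T : Set S} (hT : ∀ x ∈ T, ∃ n, G.IsHom n x) :
    G.Homog (Algebra.adjoin K T) := by
  have : Algebra.adjoin K T ≤ (coeffsIn (Algebra.adjoin K T)).comap G.γ := by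
    rw [Algebra.adjoin_le_iff]
    intro x hx
    obtain ⟨n, hn⟩ := hT x hx
    change G.γ x ∈ coeffsIn _
    rw [hn]
    exact monomial_mem_coeffsIn (Algebra.subset_adjoin hx) n
  exact fun a ha k => this ha k

/-- The homogeneous component of top degree of the value of a polynomial with constant
coefficients at a homogeneous element. -/
theorem coeff_γ_eval {n : ℕ} (hn : 0 < n) {x : S} (hx : G.IsHom n x) (h : S[X])
    (hh : ∀ k, ∃ c : K, h.coeff k = algebraMap K S c) (q : ℕ) :
    (G.γ (h.eval x)).coeff (q * n) = h.coeff q * x ^ q := by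
  rw [eval_eq_sum_range' (n := max (h.natDegree + 1) (q + 1)) (by omega), map_sum, finsetSum_coeff,
    Finset.sum_eq_single q]
  · obtain ⟨c, hc⟩ := hh q
    rw [map_mul, map_pow, hx, hc, γ_algebraMap, monomial_pow, C_mul_monomial, coeff_monomial,
      if_pos (Nat.mul_comm _ _)]
  · intro k _ hk
    obtain ⟨c, hc⟩ := hh k
    rw [map_mul, map_pow, hx, hc, γ_algebraMap, monomial_pow, C_mul_monomial, coeff_monomial,
      if_neg]
    intro h
    exact hk (Nat.eq_of_mul_eq_mul_right hn (by linarith))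
  · intro h
    exact absurd (Finset.mem_range.2 (by omega)) h

end PolyGrading

end

end SmallSubalgebra

namespace SmallSubalgebra

open Polynomial

/-- Families of degree-lowering endomorphisms and derivations which detect constants and
`p`-th powers. -/
structure Motions {K S : Type*} [Field K] [CommRing S] [Algebra K S] (G : PolyGrading K S)
    (p : ℕ) where
  T : Set (S →ₐ[K] S)
  D : Set (Derivation K S S)
  T_lower : ∀ τ ∈ T, ∀ s, τ s = s ∨ G.deg (τ s - s) < G.deg s
  D_lower : ∀ δ ∈ D, ∀ s, δ s = 0 ∨ G.deg (δ s) < G.deg s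
  inv : ∀ s, (∀ τ ∈ T, τ s = s) → ∃ c : K, s = algebraMap K S c
  pth : ∀ s, (∀ δ ∈ D, δ s = 0) → ∃ w, w ^ p = s

namespace Motions

/-- A homogeneous subalgebra stable under the motions and under extraction of `p`-th roots,
containing everything of degree less than `n`. -/
structure Closed {K S : Type*} [Field K] [CommRing S] [Algebra K S] {G : PolyGrading K S}
    {p : ℕ} (𝓜 : Motions G p) (A : Subalgebra K S) (n : ℕ) : Prop where
  low : ∀ s, G.deg s < n → s ∈ A
  T_mem : ∀ τ ∈ 𝓜.T, ∀ a ∈ A, τ a ∈ A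
  D_mem : ∀ δ ∈ 𝓜.D, ∀ a ∈ A, δ a ∈ A
  homog : G.Homog A
  root : ∀ u, u ^ p ∈ A → u ∈ A

variable {K S : Type*} [Field K] [CommRing S] [Algebra K S] {G : PolyGrading K S}
    {p : ℕ} {𝓜 : Motions G p} {A : Subalgebra K S} {n : ℕ} {x : S}

theorem sub_mem_low (hA : 𝓜.Closed A n) (hx : G.deg x ≤ n) {τ : S →ₐ[K] S} (hτ : τ ∈ 𝓜.T) :
    τ x - x ∈ A := by
  rcases 𝓜.T_lower τ hτ x with h | h
  · rw [h, sub_self]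
    exact A.zero_mem
  · exact hA.low _ (by omega)

theorem D_mem_low (hA : 𝓜.Closed A n) (hx : G.deg x ≤ n) {δ : Derivation K S S}
    (hδ : δ ∈ 𝓜.D) : δ x ∈ A := by
  rcases 𝓜.D_lower δ hδ x with h | h
  · rw [h]
    exact A.zero_mem
  · exact hA.low _ (by omega)

theorem Closed.root_pow (hA : 𝓜.Closed A n) (v : ℕ) {u : S} (hu : u ^ p ^ v ∈ A) : u ∈ A := by
  induction v with
  | zero => simpa using hu
  | succ v ih =>
    apply ih
    apply hA.root
    rwa [← pow_mul, ← pow_succ]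

/-- A polynomial over `A` of minimal degree, with leading coefficient of minimal degree, vanishing
at `x`. -/
theorem exists_minimal (G : PolyGrading K S) (A : Subalgebra K S) (x : S)
    (h : ∃ f ∈ coeffsIn A, f.eval x = 0 ∧ f ≠ 0) :
    ∃ f ∈ coeffsIn A, f.eval x = 0 ∧ f ≠ 0 ∧
      ∀ g ∈ coeffsIn A, g.eval x = 0 → g.natDegree ≤ f.natDegree →
        (g.natDegree = f.natDegree → G.deg g.leadingCoeff < G.deg f.leadingCoeff) → g = 0 := by
  let m : S[X] → ℕ ×ₗ ℕ := fun f => toLex (f.natDegree, G.deg f.leadingCoeff)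
  obtain ⟨f, ⟨hf, hx, h0⟩, hmin⟩ := (InvImage.wf m wellFounded_lt).has_min
    {f | f ∈ coeffsIn A ∧ f.eval x = 0 ∧ f ≠ 0} (by
      obtain ⟨f, h1, h2, h3⟩ := h
      exact ⟨f, h1, h2, h3⟩)
  refine ⟨f, hf, hx, h0, fun g hg hgx hd hl => ?_⟩
  by_contra hg0
  refine hmin g ⟨hg, hgx, hg0⟩ ?_
  change toLex _ < toLex _
  rw [Prod.Lex.toLex_lt_toLex]
  rcases hd.lt_or_eq with h | h
  · exact Or.inl h
  · exact Or.inr ⟨h, hl h⟩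

theorem coeff_taylor_of_natDegree_le {R : Type*} [CommRing R] (f : R[X]) (r : R) {e : ℕ}
    (h : f.natDegree ≤ e) : (taylor r f).coeff e = f.coeff e := by
  rcases h.lt_or_eq with h | rfl
  · rw [coeff_eq_zero_of_natDegree_lt h, coeff_eq_zero_of_natDegree_lt]
    rwa [natDegree_taylor]
  · exact coeff_taylor_natDegree ..

theorem taylor_map_eq_of_minimal (hA : 𝓜.Closed A n) (hx : G.deg x ≤ n) {f : S[X]}
    (hf : f ∈ coeffsIn A) (hfx : f.eval x = 0)
    (hmin : ∀ g ∈ coeffsIn A, g.eval x = 0 → g.natDegree ≤ f.natDegree →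
        (g.natDegree = f.natDegree → G.deg g.leadingCoeff < G.deg f.leadingCoeff) → g = 0)
    {τ : S →ₐ[K] S} (hτ : τ ∈ 𝓜.T) :
    taylor (τ x - x) (f.map (τ : S →+* S)) = f := by
  have hdeg : (taylor (τ x - x) (f.map (τ : S →+* S))).natDegree ≤ f.natDegree := by
    rw [natDegree_taylor]
    exact natDegree_map_le
  have hmap : f.map (τ : S →+* S) ∈ coeffsIn A := by
    intro k
    rw [coeff_map]
    exact hA.T_mem τ hτ _ (hf k)
  rw [← sub_eq_zero]
  by_contra hne
  refine hne <| hmin _ (sub_mem (taylor_mem_coeffsIn hmap (sub_mem_low hA hx hτ)) hf) ?_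
    ((natDegree_sub_le _ _).trans (max_le hdeg le_rfl)) ?_
  · rw [eval_sub, taylor_eval, hfx, sub_zero, add_sub_cancel]
    have : τ x = (τ : S →+* S) x := rfl
    rw [this, eval_map_apply, hfx, map_zero]
  · intro he
    have hl : (taylor (τ x - x) (f.map (τ : S →+* S)) - f).leadingCoeff
        = τ f.leadingCoeff - f.leadingCoeff := by
      rw [leadingCoeff, he, coeff_sub, coeff_taylor_of_natDegree_le _ _ natDegree_map_le, coeff_map]
      rfl
    rw [hl]
    rcases 𝓜.T_lower τ hτ f.leadingCoeff with h | h
    · rw [h, sub_self, leadingCoeff_eq_zero] at hl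
      exact absurd hl hne
    · exact h

theorem choose_ne_zero_of_expChar {K : Type*} [Field K] {p : ℕ} [ExpChar K p] (v e : ℕ)
    (he : (e : K) ≠ 0) : (((p ^ v * e).choose (p ^ v * e - p ^ v) : ℕ) : K) ≠ 0 := by
  have he0 : e ≠ 0 := by
    rintro rfl
    simp at he
  have hp : 0 < p ^ v := pow_pos (expChar_pos K p) v
  rw [Nat.choose_symm (Nat.le_mul_of_pos_right _ (Nat.pos_of_ne_zero he0))]
  have h : (X + 1 : K[X]) ^ (p ^ v * e) = expand K (p ^ v) ((X + 1) ^ e) := by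
    rw [pow_mul, add_pow_expChar_pow, one_pow, map_pow, map_add, expand_X, map_one]
  have h2 := congrArg (fun f => f.coeff (p ^ v)) h
  simp only [coeff_X_add_one_pow] at h2
  rw [h2]
  have := coeff_expand_mul hp ((X + 1 : K[X]) ^ e) 1
  rw [one_mul] at this
  rw [this, coeff_X_add_one_pow, Nat.choose_one_right]
  exact he

theorem exists_eq_pow_expChar_mul (K : Type*) [Field K] (p : ℕ) [hp : ExpChar K p] {e : ℕ}
    (he : e ≠ 0) : ∃ v e', e = p ^ v * e' ∧ (e' : K) ≠ 0 := by
  rcases hp with _ | hprime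
  · exact ⟨0, e, by simp, by exact_mod_cast he⟩
  · obtain ⟨v, e', h1, h2⟩ := Nat.exists_eq_pow_mul_and_not_dvd he p hprime.ne_one
    exact ⟨v, e', h2, fun h => h1 ((CharP.cast_eq_zero_iff K p e').1 h)⟩

theorem Closed.pos_of_notMem (hx : G.IsHom n x) (hxA : x ∉ A) : 0 < n := by
  rcases Nat.eq_zero_or_pos n with rfl | h
  · obtain ⟨c, rfl⟩ := G.eq_algebraMap_of_isHom_zero hx
    exact absurd (A.algebraMap_mem c) hxA
  · exact h

/-- A homogeneous element outside a closed subalgebra is transcendental over it. -/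
theorem Closed.transcendental [IsDomain S] [ExpChar K p] (hA : 𝓜.Closed A n) (hx : G.IsHom n x)
    (hxA : x ∉ A) : ∀ f ∈ coeffsIn A, f.eval x = 0 → f = 0 := by
  by_contra! hcon
  have hn := Closed.pos_of_notMem hx hxA
  obtain ⟨f, hf, hfx, hf0, hmin⟩ := exists_minimal G A x hcon
  set r := taylor x f with hr
  have hfr : f = taylor (-x) r := by rw [hr, taylor_taylor]; simp
  have hinv : ∀ k, ∃ c : K, r.coeff k = algebraMap K S c := by
    intro k
    apply 𝓜.inv
    intro τ hτ
    have h1 := taylor_map_eq_of_minimal hA hx.deg_le hf hfx hmin hτ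
    have h2 : r.map (τ : S →+* S) = r := by
      conv_rhs => rw [hr, ← h1, taylor_taylor]
      rw [hr, map_taylor]
      congr 1
      simp
    conv_rhs => rw [← h2, coeff_map]
    rfl
  have hr0 : r ≠ 0 := by
    intro h
    rw [h, map_zero] at hfr
    exact hf0 hfr
  have hrc0 : r.coeff 0 = 0 := by rw [hr, taylor_coeff_zero, hfx]
  set e := r.natDegree with he
  have he0 : e ≠ 0 := by
    intro h
    apply hr0
    rw [eq_C_of_natDegree_eq_zero (p := r) (he ▸ h), hrc0, C_0]
  obtain ⟨v, e', hev, he'⟩ := exists_eq_pow_expChar_mul K p he0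
  have hb := choose_ne_zero_of_expChar (p := p) v e' he'
  rw [← hev] at hb
  set q := p ^ v with hq
  have hqe : q ≤ e := by
    rw [hev]
    exact Nat.le_mul_of_pos_right _ (Nat.pos_of_ne_zero (by rintro rfl; simp at he'))
  have hc : f.coeff (e - q) = (hasseDeriv (e - q) r).eval (-x) := by
    conv_lhs => rw [hfr]
    rw [taylor_coeff]
  have hhc : ∀ k, ∃ c : K, (hasseDeriv (e - q) r).coeff k = algebraMap K S c := by
    intro k
    obtain ⟨c, hc⟩ := hinv (k + (e - q))
    refine ⟨((k + (e - q)).choose (e - q) : ℕ) * c, ?_⟩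
    rw [hasseDeriv_coeff, hc, map_mul, map_natCast]
  have hnx : G.IsHom n (-x) := by
    unfold PolyGrading.IsHom at *
    rw [map_neg, hx, monomial_neg]
  have h3 := G.coeff_γ_eval hn hnx _ hhc q
  rw [← hc, hasseDeriv_coeff, Nat.add_sub_cancel' hqe] at h3
  have h4 := hA.homog _ (hf (e - q)) (q * n)
  rw [h3] at h4
  obtain ⟨c, hc⟩ := hinv e
  have hc0 : c ≠ 0 := by
    rintro rfl
    rw [map_zero] at hc
    exact hr0 (leadingCoeff_eq_zero.1 hc)
  rw [hc, ← map_natCast (algebraMap K S), ← map_mul, neg_pow, mul_left_comm] at h4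
  apply hxA
  apply hA.root_pow v
  rw [← hq]
  have h5 := A.mul_mem (A.mul_mem (A.algebraMap_mem (((e.choose (e - q) : ℕ) : K) * c)⁻¹)
    (A.pow_mem (A.neg_mem A.one_mem) q)) h4
  convert h5 using 1
  have h6 : algebraMap K S (((e.choose (e - q) : ℕ) : K) * c)⁻¹ *
      algebraMap K S (((e.choose (e - q) : ℕ) : K) * c) = 1 := by
    rw [← map_mul, inv_mul_cancel₀ (mul_ne_zero hb hc0), map_one]
  have h7 : ((-1 : S) ^ q) * (-1) ^ q = 1 := by rw [← mul_pow]; simp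
  linear_combination -(x ^ q) * h6 - x ^ q * algebraMap K S (((e.choose (e - q) : ℕ) : K) * c)⁻¹ *
      algebraMap K S (((e.choose (e - q) : ℕ) : K) * c) * h7

end Motions
end SmallSubalgebra

namespace SmallSubalgebra

open Polynomial

theorem derivation_eval {K S : Type*} [Field K] [CommRing S] [Algebra K S] (δ : Derivation K S S)
    (x : S) (f : S[X]) : ∃ h : S[X], (∀ k, h.coeff k = δ (f.coeff k)) ∧
      δ (f.eval x) = h.eval x + (derivative f).eval x * δ x := by
  induction f using Polynomial.induction_on' with
  | add f g hf hg =>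
    obtain ⟨h, h1, h2⟩ := hf
    obtain ⟨h', h1', h2'⟩ := hg
    refine ⟨h + h', fun k => by rw [coeff_add, coeff_add, map_add, h1, h1'], ?_⟩
    rw [eval_add, map_add, h2, h2', eval_add, derivative_add, eval_add]
    ring
  | monomial n a =>
    refine ⟨monomial n (δ a), fun k => ?_, ?_⟩
    · rw [coeff_monomial, coeff_monomial]
      split_ifs
      · rfl
      · rw [map_zero]
    · rw [eval_monomial, Derivation.leibniz, Derivation.leibniz_pow, eval_monomial,
        derivative_monomial, eval_monomial]
      simp only [smul_eq_mul, nsmul_eq_mul]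
      ring

theorem exists_eval_of_mem_adjoin_insert {K S : Type*} [Field K] [CommRing S] [Algebra K S]
    {A : Subalgebra K S} {x u : S} (hu : u ∈ Algebra.adjoin K (insert x (A : Set S))) :
    ∃ f ∈ coeffsIn A, f.eval x = u := by
  have : Algebra.adjoin K (insert x (A : Set S)) ≤
      (coeffsIn A).map ((Polynomial.aeval x : S[X] →ₐ[S] S).restrictScalars K) := by
    rw [Algebra.adjoin_le_iff]
    rintro y (rfl | hy)
    · exact ⟨X, X_mem_coeffsIn, by simp⟩
    · exact ⟨C y, C_mem_coeffsIn hy, by simp⟩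
  obtain ⟨f, hf, h⟩ := this hu
  refine ⟨f, hf, ?_⟩
  rw [← h]
  simp

theorem coeff_pow_char {S : Type*} [CommRing S] (p : ℕ) [ExpChar S p] (f : S[X]) (n : ℕ) :
    (f ^ p).coeff n = if p ∣ n then f.coeff (n / p) ^ p else 0 := by
  rw [← map_frobenius_expand, coeff_map, coeff_expand (expChar_pos S p)]
  split_ifs
  · rw [frobenius_def]
  · rw [map_zero]

namespace Motions

variable {K S : Type*} [Field K] [CommRing S] [Algebra K S] {G : PolyGrading K S}
    {p : ℕ} {𝓜 : Motions G p} {A : Subalgebra K S} {n : ℕ} {x : S}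

theorem T_mem_adjoin_insert (hA : 𝓜.Closed A n) (hx : G.deg x ≤ n) {τ : S →ₐ[K] S} (hτ : τ ∈ 𝓜.T)
    {a : S} (ha : a ∈ Algebra.adjoin K (insert x (A : Set S))) :
    τ a ∈ Algebra.adjoin K (insert x (A : Set S)) := by
  have hle : (A : Set S) ⊆ Algebra.adjoin K (insert x (A : Set S)) :=
    (Set.subset_insert _ _).trans Algebra.subset_adjoin
  have : Algebra.adjoin K (insert x (A : Set S)) ≤
      (Algebra.adjoin K (insert x (A : Set S))).comap τ := by
    refine Algebra.adjoin_le_iff.2 ?_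
    rintro y (rfl | hy)
    · have h1 := add_mem (hle (sub_mem_low hA hx hτ)) (Algebra.subset_adjoin (Set.mem_insert y _))
      rw [sub_add_cancel] at h1
      exact h1
    · exact hle (hA.T_mem τ hτ y hy)
  exact this ha

/-- The `p`-th root property for the subalgebra obtained by adjoining a homogeneous element. -/
theorem root_adjoin_insert [IsDomain S] [ExpChar S p] (hp : p.Prime) [CharP S p]
    (hA : 𝓜.Closed A n) (hx : G.IsHom n x) (hxA : x ∉ A)
    (htr : ∀ f ∈ coeffsIn A, f.eval x = 0 → f = 0) (u : S)
    (hu : u ^ p ∈ Algebra.adjoin K (insert x (A : Set S))) :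
    u ∈ Algebra.adjoin K (insert x (A : Set S)) := by
  have hle : A ≤ Algebra.adjoin K (insert x (A : Set S)) := fun a ha =>
    Algebra.subset_adjoin (Set.mem_insert_of_mem _ ha)
  have hxm : x ∈ Algebra.adjoin K (insert x (A : Set S)) :=
    Algebra.subset_adjoin (Set.mem_insert x _)
  have hn := Closed.pos_of_notMem hx hxA
  induction hd : G.deg u using Nat.strong_induction_on generalizing u with
  | _ d ih =>
  subst hd
  obtain ⟨g, hg, hgx⟩ := exists_eval_of_mem_adjoin_insert hu
  have hinv : ∀ τ ∈ 𝓜.T, τ ((derivative g).eval x) = (derivative g).eval x := by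
    intro τ hτ
    have hw : τ u - u ∈ Algebra.adjoin K (insert x (A : Set S)) := by
      rcases 𝓜.T_lower τ hτ u with h | h
      · rw [h, sub_self]
        exact zero_mem _
      · refine ih _ h _ ?_ rfl
        rw [sub_pow_expChar, ← map_pow]
        exact sub_mem (T_mem_adjoin_insert hA hx.deg_le hτ hu) hu
    obtain ⟨w, hwA, hwx⟩ := exists_eval_of_mem_adjoin_insert hw
    have hmap : g.map (τ : S →+* S) ∈ coeffsIn A := by
      intro k
      rw [coeff_map]
      exact hA.T_mem τ hτ _ (hg k)
    have hτg : (g.map (τ : S →+* S)).eval (τ x) = τ (u ^ p) := by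
      rw [← hgx]
      exact eval_map_apply (f := (τ : S →+* S)) (p := g) x
    have h0 := htr (taylor (τ x - x) (g.map (τ : S →+* S)) - g - w ^ p)
      (sub_mem (sub_mem (taylor_mem_coeffsIn hmap (sub_mem_low hA hx.deg_le hτ)) hg)
        (pow_mem hwA p)) (by
      rw [eval_sub, eval_sub, taylor_eval, add_sub_cancel, hτg, hgx, eval_pow, hwx,
        sub_pow_expChar, map_pow]
      ring)
    have h1 := congrArg (fun f => (derivative f).eval x) h0
    simp only [derivative_sub, derivative_pow, CharP.cast_eq_zero, map_zero, zero_mul, sub_zero,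
      eval_sub, taylor_apply, derivative_comp, derivative_add, derivative_X, derivative_C, add_zero,
      eval_comp, eval_add, eval_X, eval_C, add_sub_cancel, derivative_map, one_mul, eval_zero] at h1
    rw [sub_eq_zero] at h1
    conv_rhs => rw [← h1]
    exact (eval_map_apply (f := (τ : S →+* S)) (p := derivative g) x).symm
  obtain ⟨l, hl⟩ := 𝓜.inv _ hinv
  have hgd : derivative g = C (algebraMap K S l) := by
    rw [← sub_eq_zero]
    apply htr
    · refine sub_mem (fun k => ?_) (C_mem_coeffsIn (A.algebraMap_mem l))
      rw [coeff_derivative]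
      exact A.mul_mem (hg _) (by exact_mod_cast A.natCast_mem (k + 1))
    · rw [eval_sub, hl, eval_C, sub_self]
  have hD : ∀ δ ∈ 𝓜.D, (∀ k, k ≠ 0 → δ (g.coeff k) = 0) ∧
      δ (algebraMap K S l * x + g.coeff 0) = 0 := by
    intro δ hδ
    obtain ⟨h, h1, h2⟩ := derivation_eval δ x g
    rw [hgx, Derivation.leibniz_pow, nsmul_eq_mul, CharP.cast_eq_zero, zero_mul, hgd, eval_C] at h2
    have h3 := htr (h + C (algebraMap K S l * δ x)) (add_mem (fun k => by
      rw [h1]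
      exact hA.D_mem δ hδ _ (hg k)) (C_mem_coeffsIn (A.mul_mem (A.algebraMap_mem l)
        (D_mem_low hA hx.deg_le hδ)))) (by
      rw [eval_add, eval_C]
      exact h2.symm)
    have h4 : ∀ k, (h + C (algebraMap K S l * δ x)).coeff k = 0 := fun k => by rw [h3, coeff_zero]
    constructor
    · intro k hk
      have := h4 k
      rwa [coeff_add, coeff_C_of_ne_zero hk, add_zero, h1] at this
    · have := h4 0
      rw [coeff_add, coeff_C_zero, h1] at this
      rw [map_add, Derivation.leibniz, Derivation.map_algebraMap, smul_zero, add_zero, add_comm]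
      exact this
  have hl0 : l = 0 := by
    by_contra hl0
    obtain ⟨w, hw⟩ := 𝓜.pth (algebraMap K S l * x + g.coeff 0) fun δ hδ => (hD δ hδ).2
    have h1 := congrArg (fun s => (G.γ s).coeff n) hw
    simp only [map_pow, map_add, map_mul, G.γ_algebraMap, coeff_add, coeff_C_mul, hx.coeff,
      if_true, coeff_pow_char] at h1
    have hmem : (if p ∣ n then (G.γ w).coeff (n / p) ^ p else 0) ∈ A := by
      split_ifs
      · refine A.pow_mem (hA.low _ ?_) p
        exact (G.isHom_coeff w _).deg_le.trans_lt (Nat.div_lt_self hn hp.one_lt)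
      · exact A.zero_mem
    rw [h1] at hmem
    have h2 := A.mul_mem (A.algebraMap_mem l⁻¹) (A.sub_mem hmem (hA.homog _ (hg 0) n))
    rw [add_sub_cancel_right, ← mul_assoc, ← map_mul, inv_mul_cancel₀ hl0, map_one, one_mul] at h2
    exact hxA h2
  have hroot : ∀ k, ∃ w ∈ A, w ^ p = g.coeff k := by
    intro k
    obtain ⟨w, hw⟩ := 𝓜.pth (g.coeff k) fun δ hδ => by
      rcases eq_or_ne k 0 with rfl | hk
      · have := (hD δ hδ).2
        rwa [hl0, map_zero, zero_mul, zero_add] at this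
      · exact (hD δ hδ).1 k hk
    exact ⟨w, hA.root w (hw ▸ hg k), hw⟩
  choose W hWA hW using hroot
  have hg2 : expand S p (contract p g) = g := by
    apply expand_contract p _ hp.ne_zero
    rw [hgd, hl0, map_zero, C_0]
  have hup : u = ∑ j ∈ Finset.range ((contract p g).natDegree + 1), W (j * p) * x ^ j := by
    apply frobenius_inj S p
    have hev : u ^ p = (contract p g).eval (x ^ p) := by rw [← expand_eval, hg2, hgx]
    rw [frobenius_def, frobenius_def, sum_pow_char, hev, eval_eq_sum_range]
    refine Finset.sum_congr rfl fun j _ => ?_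
    rw [mul_pow, hW, coeff_contract hp.ne_zero, pow_right_comm]
  rw [hup]
  exact sum_mem fun j _ => mul_mem (hle (hWA _)) (pow_mem hxm j)

/-- Adjoining a homogeneous element of degree `n` preserves closedness. -/
theorem Closed.adjoin_insert [IsDomain S] [ExpChar K p] (hA : 𝓜.Closed A n) (hx : G.IsHom n x)
    (hxA : x ∉ A) : 𝓜.Closed (Algebra.adjoin K (insert x (A : Set S))) n := by
  have hle : A ≤ Algebra.adjoin K (insert x (A : Set S)) := fun a ha =>
    Algebra.subset_adjoin (Set.mem_insert_of_mem _ ha)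
  have hxm : x ∈ Algebra.adjoin K (insert x (A : Set S)) :=
    Algebra.subset_adjoin (Set.mem_insert x _)
  refine ⟨fun s hs => hle (hA.low s hs), fun τ hτ a ha => T_mem_adjoin_insert hA hx.deg_le hτ ha,
    ?_, ?_, ?_⟩
  · intro δ hδ a ha
    induction ha using Algebra.adjoin_induction with
    | mem y hy =>
      rcases hy with rfl | hy
      · exact hle (D_mem_low hA hx.deg_le hδ)
      · exact hle (hA.D_mem δ hδ y hy)
    | algebraMap r =>
      rw [Derivation.map_algebraMap]
      exact zero_mem _
    | add y z _ _ h1 h2 =>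
      rw [map_add]
      exact add_mem h1 h2
    | mul y z hy hz h1 h2 =>
      rw [Derivation.leibniz]
      exact add_mem (mul_mem hy h2) (mul_mem hz h1)
  · have : Algebra.adjoin K (insert x (A : Set S)) ≤
        (coeffsIn (Algebra.adjoin K (insert x (A : Set S)))).comap G.γ := by
      refine Algebra.adjoin_le_iff.2 ?_
      rintro y (rfl | hy)
      · change G.γ y ∈ coeffsIn _
        rw [hx]
        exact monomial_mem_coeffsIn hxm n
      · exact fun k => hle (hA.homog y hy k)
    exact fun a ha => this ha
  · intro u hu
    have hS : ExpChar S p := expChar_of_injective_algebraMap (algebraMap K S).injective p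
    cases hS with
    | zero => simpa using hu
    | prime hp =>
      have : ExpChar S p := ExpChar.prime hp
      exact root_adjoin_insert hp hA hx hxA (hA.transcendental hx hxA) u hu

end Motions
end SmallSubalgebra

namespace SmallSubalgebra

open Polynomial

theorem exists_finset_of_mem_adjoin {K S : Type*} [Field K] [CommRing S] [Algebra K S]
    {E : Set S} {u : S} (hu : u ∈ Algebra.adjoin K E) :
    ∃ t : Finset S, (t : Set S) ⊆ E ∧ u ∈ Algebra.adjoin K (t : Set S) := by
  classical
  induction hu using Algebra.adjoin_induction with
  | mem y hy =>
    exact ⟨{y}, by simpa using hy, Algebra.subset_adjoin (by simp)⟩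
  | algebraMap r => exact ⟨∅, by simp, Subalgebra.algebraMap_mem _ r⟩
  | add y z _ _ h1 h2 =>
    obtain ⟨t, ht, hy⟩ := h1
    obtain ⟨t', ht', hz⟩ := h2
    refine ⟨t ∪ t', by simp [ht, ht'], add_mem (Algebra.adjoin_mono ?_ hy)
      (Algebra.adjoin_mono ?_ hz)⟩ <;> simp
  | mul y z _ _ h1 h2 =>
    obtain ⟨t, ht, hy⟩ := h1
    obtain ⟨t', ht', hz⟩ := h2
    refine ⟨t ∪ t', by simp [ht, ht'], mul_mem (Algebra.adjoin_mono ?_ hy)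
      (Algebra.adjoin_mono ?_ hz)⟩ <;> simp

namespace PolyGrading

variable {K : Type*} {S : Type u} [Field K] [CommRing S] [Algebra K S] (G : PolyGrading K S)

theorem isHom_deg_of_isHom {n : ℕ} {x : S} (hx : G.IsHom n x) : G.IsHom (G.deg x) x := by
  by_cases h : x = 0
  · subst h
    simp [IsHom]
  · have : G.deg x = n := by
      unfold deg
      rw [hx, natDegree_monomial_eq _ h]
    rwa [this]

theorem mem_of_coeff_mem {A : Subalgebra K S} {s : S}
    (h : ∀ k ≤ G.deg s, (G.γ s).coeff k ∈ A) : s ∈ A := by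
  rw [← G.sum_coeff s]
  exact sum_mem fun k hk => h k (Nat.lt_succ_iff.1 (Finset.mem_range.1 hk))

/-- The key of a well-ordering of a graded ring refining the order by degrees. -/
noncomputable def key (s : S) : ℕ ×ₗ Cardinal.{u} := toLex (G.deg s, embeddingToCardinal s)

theorem key_injective : Function.Injective G.key := by
  intro a b h
  have : (G.deg a, (embeddingToCardinal a : Cardinal.{u})) = (G.deg b, embeddingToCardinal b) :=
    toLex_inj.1 h
  exact embeddingToCardinal.injective (Prod.ext_iff.1 this).2

theorem deg_le_of_key_lt {a b : S} (h : G.key a < G.key b) : G.deg a ≤ G.deg b := by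
  unfold key at h
  rw [Prod.Lex.toLex_lt_toLex] at h
  rcases h with h | h
  · exact h.le
  · exact h.1.le

theorem key_lt_of_deg_lt {a b : S} (h : G.deg a < G.deg b) : G.key a < G.key b := by
  unfold key
  rw [Prod.Lex.toLex_lt_toLex]
  exact Or.inl h

/-- The homogeneous elements preceding `y`. -/
def below (y : S) : Set S := {z | G.IsHom (G.deg z) z ∧ G.key z < G.key y}

theorem mem_adjoin_below {y s : S} (h : G.deg s < G.deg y) : s ∈ Algebra.adjoin K (G.below y) := by
  refine G.mem_of_coeff_mem fun k hk => Algebra.subset_adjoin ⟨?_, ?_⟩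
  · exact G.isHom_deg_of_isHom (G.isHom_coeff s k)
  · exact G.key_lt_of_deg_lt ((G.isHom_coeff s k).deg_le.trans_lt (hk.trans_lt h))

theorem exists_algebraMap_of_pow (G : PolyGrading K S) [IsDomain S] {p : ℕ} (hp : p ≠ 0)
    {u : S} {c : K}
    (h : u ^ p = algebraMap K S c) : ∃ c, u = algebraMap K S c := by
  apply G.deg_eq_zero
  have := G.deg_algebraMap c
  unfold PolyGrading.deg at *
  rw [← h, map_pow, natDegree_pow] at this
  exact (Nat.mul_eq_zero.1 this).resolve_left hp

end PolyGrading

namespace Motions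

variable {K : Type*} {S : Type u} [Field K] [CommRing S] [Algebra K S] {G : PolyGrading K S}
    {p : ℕ} (𝓜 : Motions G p)

theorem closed_adjoin_below [IsDomain S] [ExpChar K p] (y : S) (hy : G.IsHom (G.deg y) y) :
    𝓜.Closed (Algebra.adjoin K (G.below y)) (G.deg y) := by
  induction hk : G.key y using WellFoundedLT.induction generalizing y with
  | _ k ih =>
  subst hk
  refine ⟨fun s hs => G.mem_adjoin_below hs, ?_, ?_, ?_, ?_⟩
  · intro τ hτ a ha
    have : Algebra.adjoin K (G.below y) ≤ (Algebra.adjoin K (G.below y)).comap τ := by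
      refine Algebra.adjoin_le_iff.2 fun z hz => ?_
      change τ z ∈ Algebra.adjoin K (G.below y)
      rcases 𝓜.T_lower τ hτ z with h | h
      · rw [h]
        exact Algebra.subset_adjoin hz
      · have h1 := add_mem (G.mem_adjoin_below (h.trans_le (G.deg_le_of_key_lt hz.2)))
          (Algebra.subset_adjoin (R := K) hz)
        rwa [sub_add_cancel] at h1
    exact this ha
  · intro δ hδ a ha
    induction ha using Algebra.adjoin_induction with
    | mem z hz =>
      rcases 𝓜.D_lower δ hδ z with h | h
      · rw [h]
        exact zero_mem _
      · exact G.mem_adjoin_below (h.trans_le (G.deg_le_of_key_lt hz.2))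
    | algebraMap r =>
      rw [Derivation.map_algebraMap]
      exact zero_mem _
    | add y z _ _ h1 h2 =>
      rw [map_add]
      exact add_mem h1 h2
    | mul y z hy hz h1 h2 =>
      rw [Derivation.leibniz]
      exact add_mem (mul_mem hy h2) (mul_mem hz h1)
  · exact G.homog_adjoin fun x hx => ⟨_, hx.1⟩
  · intro u hu
    obtain ⟨t, ht, hut⟩ := exists_finset_of_mem_adjoin hu
    rcases t.eq_empty_or_nonempty with rfl | hne
    · rw [Finset.coe_empty, Algebra.adjoin_empty, Algebra.mem_bot] at hut
      obtain ⟨c, hc⟩ := hut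
      obtain ⟨c, rfl⟩ := G.exists_algebraMap_of_pow (expChar_pos K p).ne' hc.symm
      exact Subalgebra.algebraMap_mem _ c
    · obtain ⟨z, hz, hmax⟩ := t.exists_max_image G.key hne
      have hzy := ht hz
      have hcl := ih _ hzy.2 z hzy.1 rfl
      have hle : Algebra.adjoin K (G.below z) ≤ Algebra.adjoin K (G.below y) :=
        Algebra.adjoin_mono fun w hw => ⟨hw.1, hw.2.trans hzy.2⟩
      have hmem : ∀ w ∈ t, w = z ∨ w ∈ G.below z := fun w hw => by
        rcases (hmax w hw).eq_or_lt with h | h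
        · exact Or.inl (G.key_injective h)
        · exact Or.inr ⟨(ht hw).1, h⟩
      by_cases hzA : z ∈ Algebra.adjoin K (G.below z)
      · refine hle (hcl.root u ((Algebra.adjoin_le_iff.2 fun w hw => ?_) hut))
        rcases hmem w hw with rfl | h
        · exact hzA
        · exact Algebra.subset_adjoin h
      · have h2 := (hcl.adjoin_insert hzy.1 hzA).root u
          ((Algebra.adjoin_mono fun w hw => ?_) hut)
        · refine (Algebra.adjoin_le_iff.2 fun w hw => ?_) h2
          rcases hw with rfl | hw
          · exact Algebra.subset_adjoin hzy
          · exact hle hw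
        · rcases hmem w hw with rfl | h
          · exact Set.mem_insert _ _
          · exact Set.mem_insert_of_mem _ (Algebra.subset_adjoin h)

/-- A graded domain with enough motions is a polynomial ring. -/
theorem exists_coordinates (𝓜 : Motions G p) [IsDomain S] [ExpChar K p] :
    ∃ E : Set S, (∀ e ∈ E, ∃ n, 0 < n ∧ G.IsHom n e) ∧ Algebra.adjoin K E = ⊤ ∧
      AlgebraicIndependent K ((↑) : E → S) := by
  classical
  refine ⟨{y | G.IsHom (G.deg y) y ∧ y ∉ Algebra.adjoin K (G.below y)}, ?_, ?_, ?_⟩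
  · intro e he
    exact ⟨_, Closed.pos_of_notMem he.1 he.2, he.1⟩
  · have h : ∀ y, G.IsHom (G.deg y) y → y ∈ Algebra.adjoin K
        {y | G.IsHom (G.deg y) y ∧ y ∉ Algebra.adjoin K (G.below y)} := by
      intro y hy
      induction hk : G.key y using WellFoundedLT.induction generalizing y with
      | _ k ih =>
      subst hk
      by_cases h : y ∈ Algebra.adjoin K (G.below y)
      · exact (Algebra.adjoin_le_iff.2 fun z hz => ih _ hz.2 z hz.1 rfl) h
      · exact Algebra.subset_adjoin ⟨hy, h⟩
    rw [eq_top_iff]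
    intro s _
    exact G.mem_of_coeff_mem fun k _ => h _ (G.isHom_deg_of_isHom (G.isHom_coeff s k))
  · refine algebraicIndependent_of_finite _ fun t ht hfin => ?_
    lift t to Finset S using hfin
    induction t using Finset.induction_on_max_value G.key with
    | empty =>
      have : IsEmpty ((∅ : Finset S) : Set S) := by simp
      exact algebraicIndependent_empty_type_iff.2 (algebraMap K S).injective
    | insert a s ha hmax ih =>
      rw [Finset.coe_insert] at ht ⊢
      have haE := ht (Set.mem_insert a _)
      have hsE := (Set.subset_insert _ _).trans ht
      have hind : AlgebraicIndepOn K id (s : Set S) := ih hsE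
      suffices h : Transcendental (Algebra.adjoin K (id '' (s : Set S))) (id a) from hind.insert h
      rw [Set.image_id]
      have hcl := 𝓜.closed_adjoin_below a haE.1
      rintro ⟨f, hf0, hf⟩
      rw [id_eq, aeval_def] at hf
      apply hf0
      have hsub : Algebra.adjoin K (s : Set S) ≤ Algebra.adjoin K (G.below a) := by
        refine Algebra.adjoin_mono fun z hz => ⟨(hsE hz).1, (hmax z hz).lt_of_ne fun h => ?_⟩
        exact ha (G.key_injective h ▸ hz)
      have h0 := hcl.transcendental haE.1 haE.2
        (f.map (algebraMap (Algebra.adjoin K (s : Set S)) S)) (fun k => by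
          rw [coeff_map]
          exact hsub (f.coeff k).2) (by rw [eval_map]; exact hf)
      ext k
      have h1 := congrArg (fun g => g.coeff k) h0
      simp only [coeff_map, coeff_zero] at h1
      exact h1

end Motions
end SmallSubalgebra

namespace SmallSubalgebra

open Polynomial Pointwise

theorem isPrime_span_of_algebraicIndependent {K S : Type*} [Field K] [CommRing S] [IsDomain S]
    [Algebra K S] {E : Set S} (hind : AlgebraicIndependent K ((↑) : E → S))
    (htop : Algebra.adjoin K E = ⊤) {t : Set S} (ht : t ⊆ E) :
    (Ideal.span t).IsPrime ∧ ∀ e ∈ E, e ∉ t → e ∉ Ideal.span t := by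
  classical
  obtain ⟨θ, hθ⟩ : ∃ θ : S →ₐ[K] S, ∀ e ∈ E, θ e = if e ∈ t then 0 else e := by
    have htop' : Algebra.adjoin K (Set.range ((↑) : E → S)) = ⊤ := by
      rw [Subtype.range_coe, htop]
    let φ : MvPolynomial E K ≃ₐ[K] S := hind.aevalEquiv.trans
      ((Subalgebra.equivOfEq _ _ htop').trans Subalgebra.topEquiv)
    refine ⟨(MvPolynomial.aeval fun e : E => if (e : S) ∈ t then 0 else (e : S)).comp
      φ.symm.toAlgHom, fun e he => ?_⟩
    have h : φ.symm e = MvPolynomial.X ⟨e, he⟩ := by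
      rw [AlgEquiv.symm_apply_eq]
      simp [φ]
    have h2 : φ.symm.toAlgHom e = φ.symm e := rfl
    rw [AlgHom.comp_apply, h2, h, MvPolynomial.aeval_X]
  have hsub : ∀ s, s - θ s ∈ Ideal.span t := by
    intro s
    have hs : s ∈ Algebra.adjoin K E := htop ▸ Algebra.mem_top
    induction hs using Algebra.adjoin_induction with
    | mem y hy =>
      rw [hθ y hy]
      split_ifs with h
      · rw [sub_zero]
        exact Ideal.subset_span h
      · rw [sub_self]
        exact zero_mem _
    | algebraMap r =>
      rw [AlgHom.commutes, sub_self]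
      exact zero_mem _
    | add y z _ _ h1 h2 =>
      rw [map_add, add_sub_add_comm]
      exact add_mem h1 h2
    | mul y z _ _ h1 h2 =>
      have : y * z - θ (y * z) = z * (y - θ y) + θ y * (z - θ z) := by
        rw [map_mul]
        ring
      rw [this]
      exact add_mem (Ideal.mul_mem_left _ _ h1) (Ideal.mul_mem_left _ _ h2)
  have hker : Ideal.span t = RingHom.ker (θ : S →+* S) := by
    apply le_antisymm
    · rw [Ideal.span_le]
      intro e he
      change θ e = 0
      rw [hθ e (ht he), if_pos he]
    · intro s hs
      have h1 : θ s = 0 := hs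
      have := hsub s
      rwa [h1, sub_zero] at this
  refine ⟨hker ▸ RingHom.ker_isPrime _, fun e he het hmem => ?_⟩
  rw [hker] at hmem
  have h1 : θ e = 0 := hmem
  rw [hθ e he, if_neg het] at h1
  exact hind.ne_zero ⟨e, he⟩ h1

namespace PolyGrading

variable {K S : Type*} [Field K] [CommRing S] [Algebra K S] (G : PolyGrading K S)

theorem coeff_mem_of_mem_span {P : Set S} (hP : ∀ b ∈ P, ∃ n, 0 < n ∧ G.IsHom n b) {s : S}
    (hs : s ∈ Ideal.span P) (k : ℕ) : (G.γ s).coeff k ∈ Ideal.span P := by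
  induction hs using Submodule.span_induction generalizing k with
  | mem b hb =>
    obtain ⟨n, _, hn⟩ := hP b hb
    rw [hn.coeff]
    split_ifs
    · exact Ideal.subset_span hb
    · exact zero_mem _
  | zero => simp
  | add a b _ _ h1 h2 =>
    rw [map_add, coeff_add]
    exact add_mem (h1 k) (h2 k)
  | smul a b _ h =>
    rw [smul_eq_mul, map_mul, coeff_mul]
    exact sum_mem fun x _ => Ideal.mul_mem_left _ _ (h _)

theorem coeff_zero_eq_zero_of_mem_span {P : Set S} (hP : ∀ b ∈ P, ∃ n, 0 < n ∧ G.IsHom n b) {s : S}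
    (hs : s ∈ Ideal.span P) : (G.γ s).coeff 0 = 0 := by
  induction hs using Submodule.span_induction with
  | mem b hb =>
    obtain ⟨n, h0, hn⟩ := hP b hb
    rw [hn.coeff, if_neg h0.ne']
  | zero => simp
  | add a b _ _ h1 h2 => rw [map_add, coeff_add, h1, h2, add_zero]
  | smul a b _ h => rw [smul_eq_mul, map_mul, mul_coeff_zero, h, mul_zero]

/-- Graded Nakayama lemma. -/
theorem finite_of_span_sup {B : Subalgebra K S} {P : Set S} (hPB : P ⊆ B)
    (hP : ∀ b ∈ P, ∃ n, 0 < n ∧ G.IsHom n b) {T : Set S} (hT : T.Finite)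
    (h : ∀ s, ∃ w ∈ Submodule.span K T, s - w ∈ Ideal.span P) : Module.Finite B S := by
  let T' : Set S := ⋃ t ∈ T, (fun k => (G.γ t).coeff k) '' (Finset.range (G.deg t + 1) : Set ℕ)
  have hT' : T'.Finite := hT.biUnion fun t _ => (Finset.finite_toSet _).image _
  let W : Submodule B S := Submodule.span B T'
  have hTW : ∀ t ∈ T, ∀ k, (G.γ t).coeff k ∈ W := by
    intro t ht k
    by_cases hk : k ≤ G.deg t
    · exact Submodule.subset_span (Set.mem_biUnion ht ⟨k, by simpa using Nat.lt_succ_of_le hk, rfl⟩)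
    · rw [coeff_eq_zero_of_natDegree_lt (not_le.1 hk)]
      exact zero_mem _
  have hW : ∀ w ∈ Submodule.span K T, ∀ k, (G.γ w).coeff k ∈ W := by
    intro w hw
    induction hw using Submodule.span_induction with
    | mem t ht => exact hTW t ht
    | zero => simp
    | add a b _ _ h1 h2 =>
      intro k
      rw [map_add, coeff_add]
      exact add_mem (h1 k) (h2 k)
    | smul c a _ h1 =>
      intro k
      rw [map_smul, Polynomial.coeff_smul]
      have : c • (G.γ a).coeff k = (algebraMap K B c) • (G.γ a).coeff k := by
        rw [algebraMap_smul]
      rw [this]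
      exact W.smul_mem _ (h1 k)
  have key : ∀ n s, (G.γ s).coeff n ∈ W := by
    intro n
    induction n using Nat.strong_induction_on with
    | _ n ih =>
    intro s
    obtain ⟨w, hw, hs⟩ := h s
    rw [show s = w + (s - w) by ring, map_add, coeff_add]
    refine add_mem (hW w hw n) ?_
    generalize s - w = r at hs
    induction hs using Submodule.span_induction with
    | mem b hb =>
      have h2 : b ∈ Ideal.span P := Ideal.subset_span hb
      obtain ⟨m, h0, hm⟩ := hP b hb
      rw [hm.coeff]
      split_ifs with h
      · subst h
        have h3 := ih 0 h0 1
        rw [map_one, coeff_one_zero] at h3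
        have := W.smul_mem (⟨b, hPB hb⟩ : B) h3
        rwa [Subalgebra.smul_def, smul_eq_mul, mul_one] at this
      · exact zero_mem _
    | zero => simp
    | add a b _ _ h1 h2 =>
      rw [map_add, coeff_add]
      exact add_mem h1 h2
    | smul a b hb h1 =>
      clear h1
      induction hb using Submodule.span_induction generalizing a with
      | mem b hb =>
        obtain ⟨m, h0, hm⟩ := hP b hb
        rw [smul_eq_mul, map_mul, hm]
        by_cases hmn : m ≤ n
        · obtain ⟨l, rfl⟩ := Nat.exists_eq_add_of_le' hmn
          rw [coeff_mul_monomial]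
          have := W.smul_mem (⟨b, hPB hb⟩ : B) (ih l (by omega) a)
          rwa [Subalgebra.smul_def, smul_eq_mul, mul_comm] at this
        · rw [← C_mul_X_pow_eq_monomial, ← mul_assoc, coeff_mul_X_pow', if_neg hmn]
          exact zero_mem _
      | zero => simp
      | add x y _ _ h1 h2 =>
        rw [smul_add, map_add, coeff_add]
        exact add_mem (h1 a) (h2 a)
      | smul x y _ h1 =>
        rw [smul_smul]
        exact h1 _
  refine ⟨⟨hT'.toFinset, ?_⟩⟩
  rw [Set.Finite.coe_toFinset, eq_top_iff]
  intro s _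
  rw [← G.sum_coeff s]
  exact sum_mem fun k _ => key k s

theorem exists_relation {E : Subalgebra K S} {t : Set S} {g : S}
    (hfin : Module.Finite (Algebra.adjoin K ((E : Set S) ∪ t)) S) :
    ∃ (d : ℕ) (e : ℕ → S), (∀ k, e k ∈ E) ∧
      g ^ d + ∑ k ∈ Finset.range d, e k * g ^ k ∈ Ideal.span t := by
  obtain ⟨f, hf, hfg⟩ := IsIntegral.of_finite (Algebra.adjoin K ((E : Set S) ∪ t)) g
  have hmod : ∀ b ∈ Algebra.adjoin K ((E : Set S) ∪ t), ∃ e ∈ E, b - e ∈ Ideal.span t := by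
    intro b hb
    induction hb using Algebra.adjoin_induction with
    | mem y hy =>
      rcases hy with hy | hy
      · exact ⟨y, hy, by simp⟩
      · exact ⟨0, E.zero_mem, by simpa using Ideal.subset_span hy⟩
    | algebraMap r => exact ⟨_, E.algebraMap_mem r, by simp⟩
    | add y z _ _ h1 h2 =>
      obtain ⟨a, ha, h1⟩ := h1
      obtain ⟨b, hb, h2⟩ := h2
      refine ⟨a + b, add_mem ha hb, ?_⟩
      rw [add_sub_add_comm]
      exact add_mem h1 h2
    | mul y z _ _ h1 h2 =>
      obtain ⟨a, ha, h1⟩ := h1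
      obtain ⟨b, hb, h2⟩ := h2
      refine ⟨a * b, mul_mem ha hb, ?_⟩
      have : y * z - a * b = z * (y - a) + a * (z - b) := by ring
      rw [this]
      exact add_mem (Ideal.mul_mem_left _ _ h1) (Ideal.mul_mem_left _ _ h2)
  choose e heE he using fun k => hmod (f.coeff k) (f.coeff k).2
  refine ⟨f.natDegree, e, heE, ?_⟩
  rw [eval₂_eq_sum_range, Finset.sum_range_succ, hf.coeff_natDegree, map_one, one_mul] at hfg
  have : g ^ f.natDegree + ∑ k ∈ Finset.range f.natDegree, e k * g ^ k
      = - ∑ k ∈ Finset.range f.natDegree, ((f.coeff k : S) - e k) * g ^ k := by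
    simp only [sub_mul, Finset.sum_sub_distrib]
    have h2 : ∑ i ∈ Finset.range f.natDegree,
        (algebraMap (Algebra.adjoin K ((E : Set S) ∪ t)) S) (f.coeff i) * g ^ i
        = ∑ i ∈ Finset.range f.natDegree, (f.coeff i : S) * g ^ i := rfl
    rw [h2] at hfg
    linear_combination hfg
  rw [this]
  exact neg_mem (sum_mem fun k _ => Ideal.mul_mem_right _ _ (he k))

theorem exists_homogeneous_mem_span_insert {E : Subalgebra K S} (hE : G.Homog E) {t : Set S}
    {g : S} (hfin : Module.Finite (Algebra.adjoin K ((E : Set S) ∪ t)) S)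
    (hprime : (Ideal.span t).IsPrime) (hg : g ∉ Ideal.span t)
    (hP : ∀ b ∈ insert g t, ∃ n, 0 < n ∧ G.IsHom n b) :
    ∃ a ∈ E, ∃ D, 0 < D ∧ G.IsHom D a ∧ a ≠ 0 ∧ a ∈ Ideal.span (insert g t) := by
  classical
  have hex := exists_relation (g := g) hfin
  obtain ⟨e, heE, he⟩ := Nat.find_spec hex
  have hmin := fun m => Nat.find_min hex (m := m)
  generalize Nat.find hex = d at he hmin
  rcases d with _ | d
  · simp only [pow_zero, Finset.range_zero, Finset.sum_empty, add_zero] at he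
    exact absurd ((Ideal.eq_top_iff_one _).2 he) hprime.ne_top
  have heq : g ^ (d + 1) + ∑ k ∈ Finset.range (d + 1), e k * g ^ k
      = g * (g ^ d + ∑ k ∈ Finset.range d, e (k + 1) * g ^ k) + e 0 := by
    rw [Finset.sum_range_succ', mul_add, Finset.mul_sum, pow_succ', pow_zero, mul_one, add_assoc]
    congr 2
    refine Finset.sum_congr rfl fun k _ => ?_
    ring
  rw [heq] at he
  have he0 : e 0 ∉ Ideal.span t := by
    intro h0
    have h1 := (Ideal.add_mem_iff_left _ h0).1 he
    refine hmin d (Nat.lt_succ_self d) ⟨fun k => e (k + 1), fun k => heE _, ?_⟩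
    exact (hprime.mem_or_mem h1).resolve_left hg
  have he1 : e 0 ∈ Ideal.span (insert g t) := by
    have h1 := Ideal.span_mono (Set.subset_insert g t) he
    refine (Ideal.add_mem_iff_right _ ?_).1 h1
    exact Ideal.mul_mem_right _ _ (Ideal.subset_span (Set.mem_insert g t))
  obtain ⟨D, hD⟩ : ∃ D, (G.γ (e 0)).coeff D ∉ Ideal.span t := by
    by_contra! hcon
    apply he0
    rw [← G.sum_coeff (e 0)]
    exact sum_mem fun k _ => hcon k
  refine ⟨_, hE _ (heE 0) D, D, ?_, G.isHom_coeff _ _, ?_, G.coeff_mem_of_mem_span hP he1 D⟩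
  · rcases Nat.eq_zero_or_pos D with rfl | h
    · rw [G.coeff_zero_eq_zero_of_mem_span hP he1] at hD
      exact absurd (zero_mem _) hD
    · exact h
  · intro h
    rw [h] at hD
    exact hD (zero_mem _)

theorem finite_adjoin_insert {E E' : Subalgebra K S} (hE' : G.Homog E') {z : S}
    (hz : E ≤ Algebra.adjoin K (insert z (E' : Set S))) {t : Set S}
    {g : S} (hfin : Module.Finite (Algebra.adjoin K ((E : Set S) ∪ t)) S)
    (hP : ∀ b ∈ insert g t, ∃ n, 0 < n ∧ G.IsHom n b) {D : ℕ} {c : K} (hc : c ≠ 0) (a : ℕ → S)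
    (haE : ∀ k < D, a k ∈ E') (ha : ∀ k < D, ∃ n, 0 < n ∧ G.IsHom n (a k))
    (hmem : algebraMap K S c * z ^ D + ∑ k ∈ Finset.range D, z ^ k * a k ∈
        Ideal.span (insert g t)) :
    Module.Finite (Algebra.adjoin K ((E' : Set S) ∪ insert g t)) S := by
  let P : Set S := {b | b ∈ E' ∧ ∃ n, 0 < n ∧ G.IsHom n b} ∪ insert g t
  obtain ⟨T, hT⟩ := hfin.fg_top
  let Z : Submodule K S := Submodule.span K ((fun k => z ^ k) '' (Finset.range D : Set ℕ))
  have hzD : z ^ D ∈ Ideal.span P := by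
    have h1 := Ideal.span_mono (Set.subset_union_right
        (s := {b | b ∈ E' ∧ ∃ n, 0 < n ∧ G.IsHom n b}))
      hmem
    have h2 : ∑ k ∈ Finset.range D, z ^ k * a k ∈ Ideal.span P := sum_mem fun k hk =>
      Ideal.mul_mem_left _ _ (Ideal.subset_span (Or.inl ⟨haE k (Finset.mem_range.1 hk),
        ha k (Finset.mem_range.1 hk)⟩))
    have h3 := Ideal.mul_mem_left _ (algebraMap K S c⁻¹) ((Ideal.add_mem_iff_left _ h2).1 h1)
    rwa [← mul_assoc, ← map_mul, inv_mul_cancel₀ hc, map_one, one_mul] at h3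
  have hpow : ∀ k, ∃ w ∈ Z, z ^ k - w ∈ Ideal.span P := by
    intro k
    by_cases hk : k < D
    · exact ⟨z ^ k, Submodule.subset_span ⟨k, by simpa using hk, rfl⟩, by simp⟩
    · refine ⟨0, zero_mem _, ?_⟩
      rw [sub_zero, ← Nat.sub_add_cancel (not_lt.1 hk), pow_add]
      exact Ideal.mul_mem_left _ _ hzD
  have hE'c : ∀ b ∈ E', ∃ l : K, b - algebraMap K S l ∈ Ideal.span P := by
    intro b hb
    obtain ⟨l, hl⟩ := G.coeff_zero b
    refine ⟨l, ?_⟩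
    have h := G.sum_coeff b
    rw [Finset.sum_range_succ', hl] at h
    rw [← h, add_sub_cancel_right]
    exact sum_mem fun k _ => Ideal.subset_span (Or.inl ⟨hE' b hb _, k + 1, k.succ_pos,
      G.isHom_coeff b _⟩)
  have hEZ : ∀ b ∈ E, ∃ w ∈ Z, b - w ∈ Ideal.span P := by
    intro b hb
    obtain ⟨f, hf, rfl⟩ := exists_eval_of_mem_adjoin_insert (hz hb)
    choose l hl using fun k => hE'c _ (hf k)
    choose w hwZ hw using hpow
    refine ⟨∑ k ∈ Finset.range (f.natDegree + 1), l k • w k,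
      sum_mem fun k _ => Z.smul_mem _ (hwZ k), ?_⟩
    rw [eval_eq_sum_range, ← Finset.sum_sub_distrib]
    refine sum_mem fun k _ => ?_
    have : f.coeff k * z ^ k - l k • w k
        = z ^ k * (f.coeff k - algebraMap K S (l k)) + algebraMap K S (l k) * (z ^ k - w k) := by
      rw [Algebra.smul_def]
      ring
    rw [this]
    exact add_mem (Ideal.mul_mem_left _ _ (hl k)) (Ideal.mul_mem_left _ _ (hw k))
  have hBZ : ∀ b ∈ Algebra.adjoin K ((E : Set S) ∪ t), ∃ w ∈ Z, b - w ∈ Ideal.span P := by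
    have hmod : ∀ b ∈ Algebra.adjoin K ((E : Set S) ∪ t), ∃ e ∈ E, b - e ∈ Ideal.span P := by
      intro b hb
      induction hb using Algebra.adjoin_induction with
      | mem y hy =>
        rcases hy with hy | hy
        · exact ⟨y, hy, by simp⟩
        · refine ⟨0, E.zero_mem, ?_⟩
          rw [sub_zero]
          exact Ideal.subset_span (Or.inr (Set.mem_insert_of_mem _ hy))
      | algebraMap r => exact ⟨_, E.algebraMap_mem r, by simp⟩
      | add y z _ _ h1 h2 =>
        obtain ⟨a, ha, h1⟩ := h1
        obtain ⟨b, hb, h2⟩ := h2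
        refine ⟨a + b, add_mem ha hb, ?_⟩
        rw [add_sub_add_comm]
        exact add_mem h1 h2
      | mul y z _ _ h1 h2 =>
        obtain ⟨a, ha, h1⟩ := h1
        obtain ⟨b, hb, h2⟩ := h2
        refine ⟨a * b, mul_mem ha hb, ?_⟩
        have : y * z - a * b = z * (y - a) + a * (z - b) := by ring
        rw [this]
        exact add_mem (Ideal.mul_mem_left _ _ h1) (Ideal.mul_mem_left _ _ h2)
    intro b hb
    obtain ⟨e, he, hbe⟩ := hmod b hb
    obtain ⟨w, hw, hew⟩ := hEZ e he
    exact ⟨w, hw, by simpa using add_mem hbe hew⟩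
  have hPB : P ⊆ Algebra.adjoin K ((E' : Set S) ∪ insert g t) := by
    rintro b (hb | hb)
    · exact Algebra.subset_adjoin (Or.inl hb.1)
    · exact Algebra.subset_adjoin (Or.inr hb)
  have hPh : ∀ b ∈ P, ∃ n, 0 < n ∧ G.IsHom n b := by
    rintro b (hb | hb)
    · exact hb.2
    · exact hP b hb
  refine G.finite_of_span_sup hPB hPh
    (T := ((fun k => z ^ k) '' (Finset.range D : Set ℕ)) * (T : Set S))
    (((Finset.finite_toSet _).image _).mul T.finite_toSet) ?_
  intro s
  have hs : s ∈ Submodule.span (Algebra.adjoin K ((E : Set S) ∪ t)) (T : Set S) := by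
    rw [hT]
    trivial
  obtain ⟨b, _, rfl⟩ := Submodule.mem_span_finset.1 hs
  choose w hwZ hw using fun y => hBZ (b y) (b y).2
  refine ⟨∑ y ∈ T, w y * y, ?_, ?_⟩
  · rw [← Submodule.span_mul_span]
    exact sum_mem fun y hy => Submodule.mul_mem_mul (hwZ y) (Submodule.subset_span hy)
  · rw [← Finset.sum_sub_distrib]
    refine sum_mem fun y _ => ?_
    rw [Subalgebra.smul_def, smul_eq_mul, ← sub_mul]
    exact Ideal.mul_mem_right _ _ (hw y)

end PolyGrading
end SmallSubalgebra

namespace SmallSubalgebra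

open Polynomial

theorem flat_mapRingHom {R S : Type*} [CommRing R] [CommRing S] {f : R →+* S} (hf : f.Flat) :
    (mapRingHom f).Flat := by
  let := f.toAlgebra
  let : Algebra R[X] S[X] := Polynomial.algebra R S
  have hf' : Module.Flat R S := hf
  have h : IsBaseChange R[X] (IsScalarTower.toAlgHom R S S[X]).toLinearMap :=
    (inferInstance : Algebra.IsPushout R R[X] S S[X]).out
  have h2 : Module.Flat R[X] S[X] := Module.Flat.isBaseChange R R[X] S S[X] h
  exact h2

theorem exists_trivial_of_flat {R S : Type*} [CommRing R] [CommRing S] {f : R →+* S} (hf : f.Flat)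
    {ι : Type*} [Fintype ι] (c : ι → R) (u : ι → S) (h : ∑ i, f (c i) * u i = 0) :
    ∃ (m : ℕ) (b : ι → Fin m → R) (y : Fin m → S),
      (∀ i, u i = ∑ j, f (b i j) * y j) ∧ ∀ j, ∑ i, c i * b i j = 0 :=
  letI := f.toAlgebra
  haveI : Module.Flat R S := hf
  Module.Flat.isTrivialRelation_of_sum_smul_eq_zero (R := R) (M := S) (f := c) (x := u) h

theorem flat_of_exists_trivial {R S : Type*} [CommRing R] [CommRing S] {f : R →+* S}
    (hf : ∀ (l : ℕ) (c : Fin l → R) (u : Fin l → S), ∑ i, f (c i) * u i = 0 →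
      ∃ (m : ℕ) (b : Fin l → Fin m → R) (y : Fin m → S),
      (∀ i, u i = ∑ j, f (b i j) * y j) ∧ ∀ j, ∑ i, c i * b i j = 0) : f.Flat :=
  letI := f.toAlgebra
  Module.Flat.of_forall_isTrivialRelation (R := R) (M := S) fun h => hf _ _ _ h

theorem mem_span_of_monic_mul_mem {R ι : Type*} [CommRing R] [Fintype ι] (c : ι → R) {H b : R[X]}
    (hH : H.Monic) (h : ∃ a : ι → R[X], H * b = ∑ i, C (c i) * a i) :
    ∃ a : ι → R[X], b = ∑ i, C (c i) * a i := by
  have hmem : ∀ g : R[X], (∃ a : ι → R[X], g = ∑ i, C (c i) * a i) ↔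
      g.map (Ideal.Quotient.mk (Ideal.span (Set.range c))) = 0 := by
    intro g
    have h1 : g.map (Ideal.Quotient.mk (Ideal.span (Set.range c))) = 0 ↔
        g ∈ (Ideal.span (Set.range c)).map C := by
      rw [Ideal.mem_map_C_iff, Polynomial.ext_iff]
      simp only [coeff_map, coeff_zero, Ideal.Quotient.eq_zero_iff_mem]
    rw [h1, Ideal.map_span, ← Set.range_comp, Ideal.mem_span_range_iff_exists_fun]
    refine exists_congr fun a => ?_
    rw [eq_comm]
    simp only [Function.comp_apply, mul_comm]
  rw [hmem] at h ⊢
  rw [Polynomial.map_mul] at h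
  exact (hH.map _).mul_right_eq_zero_iff.1 h

/-- Exchange lemma: in a flat family, a member which is integral over the remaining members and a
new element can be exchanged for the new element. -/
theorem flat_exchange {C₀ R : Type*} [CommRing C₀] [CommRing R] (φ : C₀ →+* R) {z g : R}
    (hflat : (eval₂RingHom φ z).Flat) {H : C₀[X][X]} (hH : H.Monic)
    (hHz : H.eval₂ (eval₂RingHom φ g) z = 0) : (eval₂RingHom φ g).Flat := by
  -- the two flat maps into `R[X]`
  have hφ : φ.Flat := by
    have h1 : (C : C₀ →+* C₀[X]).Flat := RingHom.flat_algebraMap_iff.2 inferInstance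
    have := h1.comp hflat
    have h2 : (eval₂RingHom φ z).comp C = φ := by
      ext
      simp
    rwa [h2] at this
  have hY : (mapRingHom φ).Flat := flat_mapRingHom hφ
  let Φ : C₀[X][X] →+* R[X] := eval₂RingHom (mapRingHom φ) (C z)
  have hΦ : Φ.Flat := by
    have h1 := flat_mapRingHom hflat
    have h2 : Φ = (mapRingHom (eval₂RingHom φ z)).comp (Bivariate.swap (R := C₀)).toRingHom := by
      refine Polynomial.ringHom_ext (fun f => ?_) ?_
      · have : Φ.comp C = ((mapRingHom (eval₂RingHom φ z)).comp
            (Bivariate.swap (R := C₀)).toRingHom).comp C := by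
          ext
          · simp [Φ, Bivariate.swap_C_C]
          · simp [Φ, Bivariate.swap_X]
        exact RingHom.congr_fun this f
      · simp [Φ, Bivariate.swap_Y]
    rw [h2]
    exact (RingHom.Flat.of_bijective (Bivariate.swap (R := C₀)).bijective).comp h1
  refine flat_of_exists_trivial fun l c u hrel => ?_
  have hdvd : ∀ F : R[X], F.eval g = 0 → ∃ w, F = (X - C g) * w := fun F hF =>
    dvd_iff_isRoot.2 hF
  have hev : ∀ f : C₀[X], (mapRingHom φ f).eval g = eval₂RingHom φ g f := fun f => by
    rw [coe_mapRingHom, eval_map, coe_eval₂RingHom]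
  obtain ⟨w, hw⟩ := hdvd (∑ i, mapRingHom φ (c i) * C (u i)) (by
    simp only [eval_finsetSum, eval_mul, eval_C, hev]
    exact hrel)
  obtain ⟨H', hH'⟩ := hdvd (Φ H) (by
    have : (evalRingHom g).comp Φ = eval₂RingHom (eval₂RingHom φ g) z := by
      ext <;> simp [Φ]
    have h2 := RingHom.congr_fun this H
    exact h2.trans hHz)
  obtain ⟨m, b, y, hb, hrel2⟩ := exists_trivial_of_flat hΦ
    (fun i : Option (Fin l) => i.elim H (fun i => - C (c i)))
    (fun i : Option (Fin l) => i.elim w (fun i => H' * C (u i))) (by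
      rw [Fintype.sum_option]
      simp only [Option.elim, map_neg, neg_mul, Finset.sum_neg_distrib]
      have : ∀ i, Φ (C (c i)) = mapRingHom φ (c i) := fun i => by simp [Φ]
      simp only [this]
      rw [hH', mul_right_comm, ← hw, Finset.sum_mul, ← sub_eq_add_neg, sub_eq_zero]
      exact Finset.sum_congr rfl fun i _ => by ring)
  have hb' : ∀ j, ∃ a : Fin l → C₀[X][X], b none j = ∑ i, C (c i) * a i := by
    intro j
    refine mem_span_of_monic_mul_mem c hH ⟨fun i => b (some i) j, ?_⟩
    have := hrel2 j
    rw [Fintype.sum_option] at this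
    have h2 : ∑ i, - C (c i) * b (some i) j = - ∑ i, C (c i) * b (some i) j := by
      rw [← Finset.sum_neg_distrib]
      exact Finset.sum_congr rfl fun i _ => by ring
    exact eq_of_sub_eq_zero (by rw [sub_eq_add_neg, ← h2]; exact this)
  choose a ha using hb'
  let W : Fin l → R[X] := fun i => ∑ j, Φ (a j i) * y j
  have hwW : w = ∑ i, mapRingHom φ (c i) * W i := by
    have h0 := hb none
    simp only [Option.elim] at h0
    rw [h0]
    simp only [W, ha, map_sum, map_mul, Finset.sum_mul, Finset.mul_sum]
    rw [Finset.sum_comm]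
    refine Finset.sum_congr rfl fun i _ => Finset.sum_congr rfl fun j _ => ?_
    have : Φ (C (c i)) = mapRingHom φ (c i) := by simp [Φ]
    rw [this, mul_assoc]
  obtain ⟨m', b', y', hb', hrel'⟩ := exists_trivial_of_flat hY c
    (fun i => C (u i) - (X - C g) * W i) (by
      simp only [mul_sub, Finset.sum_sub_distrib]
      rw [hw, hwW, Finset.mul_sum, sub_eq_zero]
      exact Finset.sum_congr rfl fun i _ => by ring)
  refine ⟨m', b', fun j => (y' j).eval g, fun i => ?_, hrel'⟩
  have := congrArg (eval g) (hb' i)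
  simpa only [eval_sub, eval_C, eval_mul, eval_X, sub_self, zero_mul, sub_zero, eval_finsetSum,
    hev] using this

end SmallSubalgebra

namespace SmallSubalgebra

section

open MvPolynomial

variable {k : Type*} [Field k] {R : Type*} [CommRing R] [Algebra k R]

/-- A family of elements of an algebra is flat if the algebra is flat over the polynomial ring on
that family. -/
def FlatFam {σ : Type*} (v : σ → R) : Prop := (aeval (R := k) v).toRingHom.Flat

theorem FlatFam.of_algEquiv {σ τ : Type*} {v : σ → R} (hv : FlatFam (k := k) v)
    (Ψ : MvPolynomial τ k ≃ₐ[k] MvPolynomial σ k) {v' : τ → R}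
    (h : ∀ t, aeval (R := k) v (Ψ (X t)) = v' t) : FlatFam (k := k) v' := by
  have h2 : aeval (R := k) v' = (aeval (R := k) v).comp Ψ.toAlgHom := by
    ext t
    simp [h]
  have h3 : (aeval (R := k) v').toRingHom =
      (aeval (R := k) v).toRingHom.comp Ψ.toAlgHom.toRingHom := by
    rw [h2]
    rfl
  unfold FlatFam
  rw [h3]
  exact (RingHom.Flat.of_bijective Ψ.bijective).comp hv

theorem FlatFam.reindex {σ τ : Type*} {v : σ → R} (hv : FlatFam (k := k) v) (e : τ ≃ σ) :
    FlatFam (k := k) (v ∘ e) :=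
  hv.of_algEquiv (renameEquiv k e) (by simp)

theorem flatFam_X {σ : Type*} : FlatFam (k := k) (X : σ → MvPolynomial σ k) := by
  have h : (aeval (R := k) (X : σ → MvPolynomial σ k)).toRingHom = RingHom.id _ := by
    rw [aeval_X_left]
    rfl
  unfold FlatFam
  rw [h]
  exact RingHom.Flat.id _

theorem aeval_option {σ : Type*} (z : R) (v : σ → R) :
    (aeval (R := k) (fun o : Option σ => o.elim z v)).toRingHom =
      (Polynomial.eval₂RingHom (aeval (R := k) v).toRingHom z).comp
        (optionEquivLeft k σ).toAlgHom.toRingHom := by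
  refine MvPolynomial.ringHom_ext (fun r => ?_) fun o => ?_
  · simp
  · cases o <;> simp

theorem flatFam_option_iff {σ : Type*} (z : R) (v : σ → R) :
    FlatFam (k := k) (fun o : Option σ => o.elim z v) ↔
      (Polynomial.eval₂RingHom (aeval (R := k) v).toRingHom z).Flat := by
  unfold FlatFam
  rw [aeval_option]
  constructor
  · intro h
    have h2 := (RingHom.Flat.of_bijective (f := (optionEquivLeft k σ).symm.toAlgHom.toRingHom)
      (optionEquivLeft k σ).symm.bijective).comp h
    convert h2 using 1
    ext x <;> simp
  · exact (RingHom.Flat.of_bijective (optionEquivLeft k σ).bijective).comp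

theorem FlatFam.of_option {σ : Type*} {z : R} {v : σ → R}
    (h : FlatFam (k := k) (fun o : Option σ => o.elim z v)) : FlatFam (k := k) v := by
  rw [flatFam_option_iff] at h
  have h1 : (Polynomial.C : MvPolynomial σ k →+* _).Flat :=
    RingHom.flat_algebraMap_iff.2 inferInstance
  have := h1.comp h
  have h2 : (Polynomial.eval₂RingHom (aeval (R := k) v).toRingHom z).comp Polynomial.C =
      (aeval (R := k) v).toRingHom := by
    refine RingHom.ext fun f => ?_
    simp
  unfold FlatFam
  rwa [h2] at this

/-- The exchange lemma for flat families. -/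
theorem FlatFam.exchange {σ : Type*} {z g : R} {v : σ → R}
    (h : FlatFam (k := k) (fun o : Option σ => o.elim z v))
    (hz : ∃ (n : ℕ) (b : ℕ → R),
      (∀ i, b i ∈ (aeval (R := k) (fun o : Option σ => o.elim g v)).range) ∧
      z ^ n + ∑ i ∈ Finset.range n, b i * z ^ i = 0) :
    FlatFam (k := k) (fun o : Option σ => o.elim g v) := by
  obtain ⟨n, b, hb, hz⟩ := hz
  have hb' : ∀ i, ∃ p, Polynomial.eval₂RingHom (aeval (R := k) v).toRingHom g p = b i := by
    intro i
    obtain ⟨q, hq⟩ := hb i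
    refine ⟨optionEquivLeft k σ q, ?_⟩
    rw [← hq]
    exact (RingHom.congr_fun (aeval_option (k := k) g v) q).symm
  choose p hp using hb'
  rw [flatFam_option_iff] at h ⊢
  refine flat_exchange _ h
    (H := Polynomial.X ^ n + ∑ i ∈ Finset.range n, Polynomial.C (p i) * Polynomial.X ^ i) ?_ ?_
  · refine Polynomial.monic_X_pow_add ?_
    rw [← Polynomial.mem_degreeLT]
    refine Submodule.sum_mem _ fun i hi => Polynomial.mem_degreeLT.2 ?_
    refine (Polynomial.degree_C_mul_X_pow_le _ _).trans_lt ?_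
    exact_mod_cast Finset.mem_range.1 hi
  · rw [Polynomial.eval₂_add, Polynomial.eval₂_finsetSum]
    simp only [Polynomial.eval₂_mul, Polynomial.eval₂_C, Polynomial.eval₂_X_pow, hp]
    exact hz

theorem FlatFam.of_sumElim {M : ℕ} {τ : Type*} {ℓ : Fin M → R} {v : τ → R}
    (h : FlatFam (k := k) (Sum.elim ℓ v)) : FlatFam (k := k) v := by
  induction M with
  | zero =>
    have := h.reindex (Equiv.emptySum (Fin 0) τ).symm
    convert this using 1
    funext t
    simp
  | succ M ih =>
    let e : Option (Fin M ⊕ τ) ≃ Fin (M + 1) ⊕ τ :=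
      { toFun := fun o => o.elim (Sum.inl 0) (Sum.map Fin.succ id)
        invFun := Sum.elim (Fin.cases none fun j => some (Sum.inl j)) fun t => some (Sum.inr t)
        left_inv := by rintro (_ | _ | _) <;> simp
        right_inv := by
          rintro (j | _)
          · cases j using Fin.cases <;> simp
          · simp }
    have h2 := h.reindex e
    refine ih (ℓ := ℓ ∘ Fin.succ) (FlatFam.of_option (z := ℓ 0) ?_)
    convert h2 using 1
    funext o
    rcases o with _ | _ | _ <;> simp [e]

end

section

open MvPolynomial

variable {k : Type*} [Field k] {σ : Type*}

theorem homogeneousComponent_aeval {τ : Type*} {ℓ : τ → MvPolynomial σ k}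
    (hℓ : ∀ j, (ℓ j).IsHomogeneous 1) (D : ℕ) (q : MvPolynomial τ k) :
    homogeneousComponent D (aeval ℓ q) = aeval ℓ (homogeneousComponent D q) := by
  have h : ∀ i, (aeval ℓ (homogeneousComponent i q)).IsHomogeneous i := fun i => by
    simpa using (homogeneousComponent_isHomogeneous i q).aeval ℓ hℓ
  conv_lhs => rw [← sum_homogeneousComponent q]
  rw [map_sum, map_sum]
  rw [Finset.sum_congr rfl fun i _ => homogeneousComponent_of_mem (h i)]
  rw [Finset.sum_ite_eq]
  split_ifs with h2
  · rfl
  · rw [homogeneousComponent_eq_zero _ _ (by simpa using h2), map_zero]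

/-- Evaluation of a polynomial in linear forms, expanded in powers of the first form. -/
theorem exists_expansion {M : ℕ} {z : MvPolynomial σ k} {ℓ : Fin M → MvPolynomial σ k}
    (hℓ : ∀ j, (ℓ j).IsHomogeneous 1) {D : ℕ} {q : MvPolynomial (Fin (M + 1)) k}
    (hq : q.IsHomogeneous D) :
    aeval (Fin.cons z ℓ : Fin (M + 1) → MvPolynomial σ k) q =
        ∑ i ∈ Finset.range (D + 1), z ^ i * aeval ℓ ((finSuccEquiv k M q).coeff i) ∧
      ∀ i ≤ D, (aeval ℓ ((finSuccEquiv k M q).coeff i)).IsHomogeneous (D - i) := by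
  constructor
  · have h1 : aeval (Fin.cons z ℓ : Fin (M + 1) → MvPolynomial σ k) q =
        (finSuccEquiv k M q).eval₂ (aeval (R := k) ℓ).toRingHom z := by
      have : (aeval (R := k) (Fin.cons z ℓ : Fin (M + 1) → MvPolynomial σ k)).toRingHom =
          (Polynomial.eval₂RingHom (aeval (R := k) ℓ).toRingHom z).comp
            (finSuccEquiv k M).toAlgHom.toRingHom := by
        refine MvPolynomial.ringHom_ext (fun r => ?_) fun o => ?_
        · simp [finSuccEquiv_apply]
        · cases o using Fin.cases <;> simp [finSuccEquiv_X_zero, finSuccEquiv_X_succ]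
      exact RingHom.congr_fun this q
    rw [h1, Polynomial.eval₂_eq_sum_range' (n := D + 1)]
    · exact Finset.sum_congr rfl fun i _ => mul_comm _ _
    · rw [natDegree_finSuccEquiv]
      exact Nat.lt_succ_of_le ((degreeOf_le_totalDegree _ _).trans hq.totalDegree_le)
  · intro i hi
    simpa using (hq.finSuccEquiv_coeff_isHomogeneous i (D - i) (by omega)).aeval ℓ hℓ

theorem eval_smul_of_isHomogeneous {τ : Type*} {p : MvPolynomial τ k} {n : ℕ}
    (hp : p.IsHomogeneous n) (c : k) (x : τ → k) : eval (c • x) p = c ^ n * eval x p := by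
  rw [eval_eq, eval_eq, Finset.mul_sum]
  refine Finset.sum_congr rfl fun d hd => ?_
  simp only [Pi.smul_apply, smul_eq_mul, mul_pow, Finset.prod_mul_distrib,
      Finset.prod_pow_eq_pow_sum]
  rw [hp.degree_eq_sum_deg_support hd]
  ring

/-- A nonzero form is nonzero at some point with first coordinate one. -/
theorem exists_eval_cons_one_ne_zero [Infinite k] {M D : ℕ} {p : MvPolynomial (Fin (M + 1)) k}
    (hp : p.IsHomogeneous D) (hp0 : p ≠ 0) :
    ∃ w : Fin M → k, eval (Fin.cons 1 w : Fin (M + 1) → k) p ≠ 0 := by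
  obtain ⟨x, hx⟩ : ∃ x, eval x (X 0 * p) ≠ 0 := by
    by_contra! h
    refine mul_ne_zero (X_ne_zero (0 : Fin (M + 1))) hp0 (MvPolynomial.funext fun x => ?_)
    rw [h, map_zero]
  rw [map_mul, eval_X, mul_ne_zero_iff] at hx
  refine ⟨fun j => x j.succ / x 0, fun h => hx.2 ?_⟩
  have hxx : x = x 0 • (Fin.cons 1 fun j => x j.succ / x 0 : Fin (M + 1) → k) := by
    funext j
    cases j using Fin.cases
    · simp
    · simp [mul_div_cancel₀ _ hx.1]
  rw [hxx, eval_smul_of_isHomogeneous hp, h, mul_zero]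

/-- The substitution fixing the first variable and adding multiples of it to the others. -/
noncomputable def shearHom {M : ℕ} (w : Fin M → k) :
    MvPolynomial (Fin (M + 1)) k →ₐ[k] MvPolynomial (Fin (M + 1)) k :=
  aeval (Fin.cons (X 0) fun j => X j.succ + C (w j) * X 0)

theorem isHomogeneous_shearHom {M D : ℕ} (w : Fin M → k) {p : MvPolynomial (Fin (M + 1)) k}
    (hp : p.IsHomogeneous D) : (shearHom w p).IsHomogeneous D := by
  have hx : ∀ j, (Fin.cons (X 0) (fun j => X j.succ + C (w j) * X 0) :
      Fin (M + 1) → MvPolynomial (Fin (M + 1)) k) j |>.IsHomogeneous 1 := by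
    intro j
    cases j using Fin.cases
    · exact isHomogeneous_X _ _
    · exact (isHomogeneous_X _ _).add
        (by simpa using (isHomogeneous_C _ _).mul (isHomogeneous_X k 0))
  simpa [shearHom] using hp.aeval _ hx

theorem coeff_finSuccEquiv_shearHom {M D : ℕ} (w : Fin M → k) {p : MvPolynomial (Fin (M + 1)) k}
    (hp : p.IsHomogeneous D) :
    (finSuccEquiv k M (shearHom w p)).coeff D = C (eval (Fin.cons 1 w : Fin (M + 1) → k) p) := by
  have hs := isHomogeneous_shearHom w hp
  have hc : ∀ i ≤ D, ((finSuccEquiv k M (shearHom w p)).coeff i).IsHomogeneous (D - i) :=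
    fun i hi => hs.finSuccEquiv_coeff_isHomogeneous i (D - i) (by omega)
  obtain ⟨c, hcc⟩ : ∃ c, (finSuccEquiv k M (shearHom w p)).coeff D = C c := by
    have := hc D le_rfl
    rw [Nat.sub_self, ← totalDegree_zero_iff_isHomogeneous, totalDegree_eq_zero_iff_eq_C] at this
    exact ⟨_, this⟩
  have h3 : eval (Fin.cons 1 w : Fin (M + 1) → k) p =
      eval (Fin.cons 1 0 : Fin (M + 1) → k) (shearHom w p) := by
    have : aeval (R := k) (Fin.cons 1 w : Fin (M + 1) → k) =
        (aeval (R := k) (Fin.cons 1 0 : Fin (M + 1) → k)).comp (shearHom w) := by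
      ext1 j
      cases j using Fin.cases
      · simp [shearHom]
      · simp [shearHom, ← algebraMap_eq]
    have h4 := DFunLike.congr_fun this p
    simpa [aeval_eq_eval] using h4
  rw [hcc, h3, eval_eq_eval_mv_eval', Polynomial.eval_map,
    Polynomial.eval₂_eq_sum_range' (n := D + 1), Finset.sum_range_succ, Finset.sum_eq_zero, hcc]
  · simp
  · intro i hi
    rw [Finset.mem_range] at hi
    have : eval (0 : Fin M → k) ((finSuccEquiv k M (shearHom w p)).coeff i) = 0 := by
      rw [eval_zero, constantCoeff_eq]
      exact (hc i hi.le).coeff_eq_zero (by simp; omega)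
    rw [this, zero_mul]
  · rw [natDegree_finSuccEquiv]
    exact Nat.lt_succ_of_le ((degreeOf_le_totalDegree _ _).trans hs.totalDegree_le)

/-- Noether normalisation step: a nonzero form in some linear forms becomes monic in one of them
after a linear change of the others. -/
theorem exists_linear_change [Infinite k] {M : ℕ} {ℓ : Fin M → MvPolynomial σ k}
    (hℓ : ∀ j, (ℓ j).IsHomogeneous 1) {D : ℕ} (hD : 0 < D) {f₀ : MvPolynomial σ k}
    (hf₀ : f₀ ∈ (aeval (R := k) ℓ).range) (hhom : f₀.IsHomogeneous D) (hne : f₀ ≠ 0) :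
    ∃ (M' : ℕ) (ℓ' : Fin M' → MvPolynomial σ k) (z : MvPolynomial σ k),
      (∀ j, (ℓ' j).IsHomogeneous 1) ∧ z.IsHomogeneous 1 ∧
      (∀ n, ∀ f ∈ (aeval (R := k) ℓ).range, f.IsHomogeneous n →
        ∃ a : ℕ → MvPolynomial σ k, (∀ i, a i ∈ (aeval (R := k) ℓ').range) ∧
          (∀ i ≤ n, (a i).IsHomogeneous (n - i)) ∧
          f = ∑ i ∈ Finset.range (n + 1), z ^ i * a i) ∧
      (∃ c : k, c ≠ 0 ∧ ∃ a : ℕ → MvPolynomial σ k, (∀ i, a i ∈ (aeval (R := k) ℓ').range) ∧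
          (∀ i < D, (a i).IsHomogeneous (D - i)) ∧
          f₀ = C c * z ^ D + ∑ i ∈ Finset.range D, z ^ i * a i) ∧
      ∀ (τ : Type) (v : τ → MvPolynomial σ k), FlatFam (k := k) (Sum.elim ℓ v) →
        FlatFam (k := k) (fun o : Option (Fin M' ⊕ τ) => o.elim z (Sum.elim ℓ' v)) := by
  have hpre : ∀ n, ∀ f ∈ (aeval (R := k) ℓ).range, f.IsHomogeneous n →
      ∃ q : MvPolynomial (Fin M) k, q.IsHomogeneous n ∧ aeval ℓ q = f := by
    rintro n f ⟨q, hq⟩ hf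
    refine ⟨homogeneousComponent n q, homogeneousComponent_isHomogeneous n q, ?_⟩
    rw [← homogeneousComponent_aeval hℓ]
    have : aeval ℓ q = f := hq
    rw [this, homogeneousComponent_eq_self hf]
  obtain ⟨p, hp, hpf⟩ := hpre D f₀ hf₀ hhom
  have hp0 : p ≠ 0 := by
    rintro rfl
    exact hne (by rw [← hpf, map_zero])
  obtain _ | M := M
  · exact absurd ((isHomogeneous_of_isEmpty (Fin 0) k p).inj_right hp hp0) hD.ne
  obtain ⟨w, hw⟩ := exists_eval_cons_one_ne_zero hp hp0
  let z := ℓ 0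
  let ℓ' : Fin M → MvPolynomial σ k := fun j => ℓ j.succ - C (w j) * ℓ 0
  have hℓ' : ∀ j, (ℓ' j).IsHomogeneous 1 := fun j =>
    (hℓ _).sub (by simpa using (isHomogeneous_C _ (w j)).mul (hℓ 0))
  have hψ : ∀ q, aeval ℓ q =
      aeval (Fin.cons z ℓ' : Fin (M + 1) → MvPolynomial σ k) (shearHom w q) := by
    intro q
    have : aeval (R := k) ℓ =
        (aeval (R := k) (Fin.cons z ℓ' : Fin (M + 1) → MvPolynomial σ k)).comp (shearHom w) := by
      ext1 j
      cases j using Fin.cases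
      · simp [shearHom, z]
      · simp [shearHom, z, ℓ', ← algebraMap_eq]
    exact DFunLike.congr_fun this q
  refine ⟨M, ℓ', z, hℓ', hℓ 0, ?_, ?_, ?_⟩
  · intro n f hf hfn
    obtain ⟨q, hq, rfl⟩ := hpre n f hf hfn
    obtain ⟨h1, h2⟩ := exists_expansion (z := z) hℓ' (isHomogeneous_shearHom w hq)
    exact ⟨_, fun i => ⟨_, rfl⟩, h2, by rw [hψ]; exact h1⟩
  · obtain ⟨h1, h2⟩ := exists_expansion (z := z) hℓ' (isHomogeneous_shearHom w hp)
    refine ⟨_, hw, fun i => aeval ℓ' ((finSuccEquiv k M (shearHom w p)).coeff i),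
      fun i => ⟨_, rfl⟩, fun i hi => h2 i hi.le, ?_⟩
    rw [← hpf, hψ, h1, Finset.sum_range_succ, coeff_finSuccEquiv_shearHom w hp, add_comm, mul_comm]
    simp [algebraMap_eq]
  · intro τ v h
    let F : Option (Fin M ⊕ τ) → MvPolynomial (Fin (M + 1) ⊕ τ) k := fun o =>
      o.elim (X (Sum.inl 0)) (Sum.elim (fun j => X (Sum.inl j.succ) - C (w j) * X (Sum.inl 0))
        fun t => X (Sum.inr t))
    let F' : Fin (M + 1) ⊕ τ → MvPolynomial (Option (Fin M ⊕ τ)) k :=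
      Sum.elim (Fin.cons (X none) fun j => X (some (Sum.inl j)) + C (w j) * X none)
        fun t => X (some (Sum.inr t))
    refine h.of_algEquiv (AlgEquiv.ofAlgHom (aeval F) (aeval F') ?_ ?_) ?_
    · ext1 j
      rcases j with j | t
      · cases j using Fin.cases <;> simp [F, F', ← algebraMap_eq]
      · simp [F, F']
    · ext1 o
      rcases o with _ | j | t <;> simp [F, F', ← algebraMap_eq]
    · intro o
      rcases o with _ | j | t <;> simp [F, z, ℓ', ← algebraMap_eq]

end

end SmallSubalgebra

namespace SmallSubalgebra

open Filter

/-- The sequences vanishing along an ultrafilter. -/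
def nullIdeal (U : Ultrafilter ℕ) (R : ℕ → Type*) [∀ i, CommRing (R i)] : Ideal (∀ i, R i) where
  carrier := {f | ∀ᶠ i in U, f i = 0}
  add_mem' := by
    intro f g hf hg
    filter_upwards [hf, hg] with i h1 h2
    rw [Pi.add_apply, h1, h2, add_zero]
  zero_mem' := Eventually.of_forall fun _ => rfl
  smul_mem' := by
    intro c f hf
    filter_upwards [hf] with i h
    rw [smul_eq_mul, Pi.mul_apply, h, mul_zero]

/-- The ultraproduct of a sequence of commutative rings. -/
def UProd (U : Ultrafilter ℕ) (R : ℕ → Type*) [∀ i, CommRing (R i)] : Type _ :=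
  (∀ i, R i) ⧸ nullIdeal U R

namespace UProd

variable {U : Ultrafilter ℕ} {R R' : ℕ → Type*} [∀ i, CommRing (R i)] [∀ i, CommRing (R' i)]

noncomputable instance : CommRing (UProd U R) :=
  inferInstanceAs (CommRing ((∀ i, R i) ⧸ nullIdeal U R))

/-- The class of a sequence. -/
noncomputable def mk (U : Ultrafilter ℕ) : (∀ i, R i) →+* UProd U R :=
  Ideal.Quotient.mk (nullIdeal U R)

theorem mk_surjective : Function.Surjective (mk U : (∀ i, R i) →+* UProd U R) :=
  Ideal.Quotient.mk_surjective

theorem mk_eq_zero {f : ∀ i, R i} : mk U f = 0 ↔ ∀ᶠ i in U, f i = 0 :=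
  Ideal.Quotient.eq_zero_iff_mem

theorem mk_eq_mk {f g : ∀ i, R i} : mk U f = mk U g ↔ ∀ᶠ i in U, f i = g i := by
  rw [← sub_eq_zero, ← map_sub, mk_eq_zero]
  simp only [Pi.sub_apply, sub_eq_zero]

theorem mk_ne_zero {f : ∀ i, R i} : mk U f ≠ 0 ↔ ∀ᶠ i in U, f i ≠ 0 := by
  rw [Ne, mk_eq_zero, ← Ultrafilter.eventually_not]

/-- Additive maps between the factors induce an additive map of ultraproducts. -/
noncomputable def mapAdd (U : Ultrafilter ℕ) (φ : ∀ i, R i →+ R' i) : UProd U R →+ UProd U R' :=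
  QuotientAddGroup.map (nullIdeal U R).toAddSubgroup (nullIdeal U R').toAddSubgroup
    { toFun := fun f i => φ i (f i)
      map_zero' := funext fun i => map_zero _
      map_add' := fun f g => funext fun i => map_add _ _ _ } (by
    intro f hf
    have hf : ∀ᶠ i in U, f i = 0 := hf
    change ∀ᶠ i in U, φ i (f i) = 0
    filter_upwards [hf] with i h
    rw [h, map_zero])

theorem mapAdd_mk (φ : ∀ i, R i →+ R' i) (f : ∀ i, R i) :
    mapAdd U φ (mk U f) = mk U fun i => φ i (f i) := rfl

/-- Ring homomorphisms between the factors induce a ring homomorphism of ultraproducts. -/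
noncomputable def map (U : Ultrafilter ℕ) (φ : ∀ i, R i →+* R' i) : UProd U R →+* UProd U R' :=
  { mapAdd U fun i => (φ i).toAddMonoidHom with
    map_one' := by
      change mapAdd U _ (mk U 1) = mk U 1
      rw [mapAdd_mk]
      exact congrArg _ (funext fun i => map_one (φ i))
    map_mul' := by
      intro x y
      obtain ⟨f, rfl⟩ := mk_surjective x
      obtain ⟨g, rfl⟩ := mk_surjective y
      change mapAdd U _ (mk U f * mk U g) = mapAdd U _ (mk U f) * mapAdd U _ (mk U g)
      rw [← map_mul, mapAdd_mk, mapAdd_mk, mapAdd_mk, ← map_mul]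
      exact congrArg _ (funext fun i => map_mul (φ i) _ _) }

theorem map_mk (φ : ∀ i, R i →+* R' i) (f : ∀ i, R i) :
    map U φ (mk U f) = mk U fun i => φ i (f i) := rfl

instance [∀ i, Nontrivial (R i)] : Nontrivial (UProd U R) := by
  refine ⟨mk U 1, 0, mk_ne_zero.2 (Eventually.of_forall fun i => ?_)⟩
  exact one_ne_zero

instance [∀ i, IsDomain (R i)] : IsDomain (UProd U R) := by
  have : NoZeroDivisors (UProd U R) := ⟨by
    intro x y h
    obtain ⟨f, rfl⟩ := mk_surjective x
    obtain ⟨g, rfl⟩ := mk_surjective y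
    rw [← map_mul, mk_eq_zero] at h
    rw [mk_eq_zero, mk_eq_zero, ← Ultrafilter.eventually_or]
    filter_upwards [h] with i hi
    exact mul_eq_zero.1 hi⟩
  exact NoZeroDivisors.to_isDomain _

noncomputable instance {K : ℕ → Type*} [∀ i, Field (K i)] : Field (UProd U K) :=
  Field.ofIsUnitOrEqZero (by
    intro x
    obtain ⟨f, rfl⟩ := mk_surjective x
    by_cases h : mk U f = 0
    · exact Or.inr h
    · refine Or.inl (IsUnit.of_mul_eq_one (mk U fun i => (f i)⁻¹) ?_)
      rw [← map_mul, ← map_one (mk U), mk_eq_mk]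
      filter_upwards [mk_ne_zero.1 h] with i hi
      exact mul_inv_cancel₀ hi)

noncomputable instance {K : ℕ → Type*} [∀ i, Field (K i)] [∀ i, Algebra (K i) (R i)] :
    Algebra (UProd U K) (UProd U R) :=
  (map U fun i => algebraMap (K i) (R i)).toAlgebra

theorem algebraMap_mk {K : ℕ → Type*} [∀ i, Field (K i)] [∀ i, Algebra (K i) (R i)]
    (c : ∀ i, K i) :
    algebraMap (UProd U K) (UProd U R) (mk U c) = mk U fun i => algebraMap (K i) (R i) (c i) :=
  rfl

end UProd

open MvPolynomial in
/-- The subalgebra of an ultraproduct of polynomial rings formed by the classes of sequences of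
bounded degree. -/
noncomputable def bdd (U : Ultrafilter ℕ) (K : ℕ → Type u) [∀ i, Field (K i)] (N : ℕ → ℕ) :
    Subalgebra (UProd U K) (UProd U fun i => MvPolynomial (Fin (N i)) (K i)) where
  carrier := {x | ∃ (f : ∀ i, MvPolynomial (Fin (N i)) (K i)) (B : ℕ),
    (∀ i, (f i).totalDegree ≤ B) ∧ UProd.mk U f = x}
  mul_mem' := by
    rintro _ _ ⟨f, B, hf, rfl⟩ ⟨g, C, hg, rfl⟩
    refine ⟨f * g, B + C, fun i => ?_, map_mul _ _ _⟩
    exact (totalDegree_mul _ _).trans (add_le_add (hf i) (hg i))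
  add_mem' := by
    rintro _ _ ⟨f, B, hf, rfl⟩ ⟨g, C, hg, rfl⟩
    refine ⟨f + g, max B C, fun i => ?_, map_add _ _ _⟩
    exact (totalDegree_add _ _).trans (max_le_max (hf i) (hg i))
  algebraMap_mem' := by
    intro c
    obtain ⟨c, rfl⟩ := UProd.mk_surjective c
    refine ⟨fun i => C (c i), 0, fun i => ?_, UProd.algebraMap_mk c⟩
    rw [totalDegree_C]

namespace bdd

open MvPolynomial

variable {U : Ultrafilter ℕ} {K : ℕ → Type u} [∀ i, Field (K i)] {N : ℕ → ℕ}

/-- The class of a sequence of polynomials of bounded degree. -/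
noncomputable def mk (f : ∀ i, MvPolynomial (Fin (N i)) (K i))
    (hf : ∃ B : ℕ, ∀ i, (f i).totalDegree ≤ B) : bdd U K N :=
  ⟨UProd.mk U f, f, hf.choose, hf.choose_spec, rfl⟩

theorem exists_mk (s : bdd U K N) : ∃ f hf, s = mk (U := U) (K := K) (N := N) f hf := by
  obtain ⟨_, f, B, hf, rfl⟩ := s
  exact ⟨f, ⟨B, hf⟩, rfl⟩

theorem coe_mk (f : ∀ i, MvPolynomial (Fin (N i)) (K i)) (hf) :
    ((mk f hf : bdd U K N) : UProd U fun i => MvPolynomial (Fin (N i)) (K i)) = UProd.mk U f := rfl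

theorem mk_eq_mk {f g : ∀ i, MvPolynomial (Fin (N i)) (K i)} {hf hg} :
    (mk f hf : bdd U K N) = mk g hg ↔ ∀ᶠ i in U, f i = g i := by
  rw [← UProd.mk_eq_mk]
  exact Subtype.ext_iff

theorem mk_eq_zero {f : ∀ i, MvPolynomial (Fin (N i)) (K i)} {hf} :
    (mk f hf : bdd U K N) = 0 ↔ ∀ᶠ i in U, f i = 0 := by
  rw [← UProd.mk_eq_zero]
  exact Subtype.ext_iff

theorem eq_algebraMap_iff {f : ∀ i, MvPolynomial (Fin (N i)) (K i)} {hf} :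
    (∃ c, (mk f hf : bdd U K N) = algebraMap (UProd U K) _ c) ↔ ∀ᶠ i in U, ∃ c, f i = C c := by
  constructor
  · rintro ⟨c, h⟩
    obtain ⟨c, rfl⟩ := UProd.mk_surjective c
    have := UProd.mk_eq_mk.1 (congrArg Subtype.val h)
    filter_upwards [this] with i hi
    exact ⟨c i, hi⟩
  · intro h
    refine ⟨UProd.mk U fun i => coeff 0 (f i), Subtype.ext (UProd.mk_eq_mk.2 ?_)⟩
    filter_upwards [h] with i hi
    obtain ⟨c, hc⟩ := hi
    change f i = C (coeff 0 (f i))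
    rw [hc, coeff_C, if_pos rfl]

/-- Additive operators on the factors which do not raise degrees too much act on the ring of
bounded sequences. -/
noncomputable def op (φ : ∀ i, MvPolynomial (Fin (N i)) (K i) →+ MvPolynomial (Fin (N i)) (K i))
    (hφ : ∀ B, ∃ B', ∀ i f, f.totalDegree ≤ B → (φ i f).totalDegree ≤ B') :
    bdd U K N →+ bdd U K N :=
  ((UProd.mapAdd U φ).comp (bdd U K N).toSubring.subtype.toAddMonoidHom).codRestrict
    (bdd U K N).toSubring.toAddSubgroup (by
      rintro ⟨_, f, B, hf, rfl⟩
      obtain ⟨B', hB'⟩ := hφ B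
      exact ⟨fun i => φ i (f i), B', fun i => hB' i _ (hf i), rfl⟩)

theorem op_bdd {φ : ∀ i, MvPolynomial (Fin (N i)) (K i) →+ MvPolynomial (Fin (N i)) (K i)}
    (hφ : ∀ B, ∃ B', ∀ i f, f.totalDegree ≤ B → (φ i f).totalDegree ≤ B')
    {f : ∀ i, MvPolynomial (Fin (N i)) (K i)} (hf : ∃ B : ℕ, ∀ i, (f i).totalDegree ≤ B) :
    ∃ B : ℕ, ∀ i, (φ i (f i)).totalDegree ≤ B := by
  obtain ⟨B, hf⟩ := hf
  obtain ⟨B', hB'⟩ := hφ B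
  exact ⟨B', fun i => hB' i _ (hf i)⟩

theorem op_mk (φ : ∀ i, MvPolynomial (Fin (N i)) (K i) →+ MvPolynomial (Fin (N i)) (K i)) (hφ)
    (f : ∀ i, MvPolynomial (Fin (N i)) (K i)) (hf) :
    op (U := U) φ hφ (mk f hf) = mk (fun i => φ i (f i)) (op_bdd hφ hf) := rfl

theorem mul_bdd {f g : ∀ i, MvPolynomial (Fin (N i)) (K i)}
    (hf : ∃ B : ℕ, ∀ i, (f i).totalDegree ≤ B) (hg : ∃ B : ℕ, ∀ i, (g i).totalDegree ≤ B) :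
    ∃ B : ℕ, ∀ i, (f i * g i).totalDegree ≤ B := by
  obtain ⟨B, hf⟩ := hf
  obtain ⟨C, hg⟩ := hg
  exact ⟨B + C, fun i => (totalDegree_mul _ _).trans (add_le_add (hf i) (hg i))⟩

theorem mk_mul (f g : ∀ i, MvPolynomial (Fin (N i)) (K i)) (hf hg) :
    (mk f hf * mk g hg : bdd U K N) = mk (fun i => f i * g i) (mul_bdd hf hg) := rfl

theorem add_bdd {f g : ∀ i, MvPolynomial (Fin (N i)) (K i)}
    (hf : ∃ B : ℕ, ∀ i, (f i).totalDegree ≤ B) (hg : ∃ B : ℕ, ∀ i, (g i).totalDegree ≤ B) :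
    ∃ B : ℕ, ∀ i, (f i + g i).totalDegree ≤ B := by
  obtain ⟨B, hf⟩ := hf
  obtain ⟨C, hg⟩ := hg
  exact ⟨max B C, fun i => (totalDegree_add _ _).trans (max_le_max (hf i) (hg i))⟩

theorem mk_add (f g : ∀ i, MvPolynomial (Fin (N i)) (K i)) (hf hg) :
    (mk f hf + mk g hg : bdd U K N) = mk (fun i => f i + g i) (add_bdd hf hg) := rfl

theorem smul_bdd (c : ∀ i, K i) {f : ∀ i, MvPolynomial (Fin (N i)) (K i)}
    (hf : ∃ B : ℕ, ∀ i, (f i).totalDegree ≤ B) :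
    ∃ B : ℕ, ∀ i, (c i • f i).totalDegree ≤ B := by
  obtain ⟨B, hf⟩ := hf
  exact ⟨B, fun i => (totalDegree_smul_le _ _).trans (hf i)⟩

theorem smul_mk (c : ∀ i, K i) (f : ∀ i, MvPolynomial (Fin (N i)) (K i)) (hf) :
    UProd.mk U c • (mk f hf : bdd U K N) = mk (fun i => c i • f i) (smul_bdd c hf) := by
  refine Subtype.ext ?_
  change algebraMap _ _ _ * UProd.mk U f = UProd.mk U _
  rw [UProd.algebraMap_mk, ← map_mul]
  refine congrArg _ (funext fun i => ?_)
  rw [Algebra.smul_def]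
  rfl

theorem one_bdd : ∃ B : ℕ, ∀ i, (1 : MvPolynomial (Fin (N i)) (K i)).totalDegree ≤ B :=
  ⟨0, fun i => by rw [totalDegree_one]⟩

theorem mk_one : (1 : bdd U K N) = mk (fun _ => 1) one_bdd := rfl

end bdd

end SmallSubalgebra

namespace SmallSubalgebra

section

open MvPolynomial

variable {k : Type*} [CommRing k] {σ : Type*}

theorem sum_range_homogeneousComponent (f : MvPolynomial σ k) {A : ℕ} (hA : f.totalDegree < A) :
    ∑ i ∈ Finset.range A, homogeneousComponent i f = f := by
  conv_rhs => rw [← sum_homogeneousComponent f]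
  refine (Finset.sum_subset (Finset.range_mono hA) fun i _ hi => ?_).symm
  exact homogeneousComponent_eq_zero _ _ (by simpa using hi)

theorem homogeneousComponent_mul (n : ℕ) (f g : MvPolynomial σ k) :
    homogeneousComponent n (f * g) = ∑ x ∈ Finset.HasAntidiagonal.antidiagonal n,
      homogeneousComponent x.1 f * homogeneousComponent x.2 g := by
  classical
  let A := f.totalDegree + g.totalDegree + n + 1
  conv_lhs => rw [← sum_range_homogeneousComponent f (show f.totalDegree < A by omega),
    ← sum_range_homogeneousComponent g (show g.totalDegree < A by omega),
    Finset.sum_mul_sum, ← Finset.sum_product', map_sum]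
  have h : ∀ x : ℕ × ℕ, homogeneousComponent n
      (homogeneousComponent x.1 f * homogeneousComponent x.2 g) = if n = x.1 + x.2 then
        homogeneousComponent x.1 f * homogeneousComponent x.2 g else 0 := fun x =>
    homogeneousComponent_of_mem
      ((homogeneousComponent_isHomogeneous x.1 f).mul (homogeneousComponent_isHomogeneous x.2 g))
  simp only [h]
  rw [← Finset.sum_filter]
  refine Finset.sum_congr ?_ fun _ _ => rfl
  ext ⟨a, b⟩
  simp only [Finset.mem_filter, Finset.mem_product, Finset.mem_range,
      Finset.HasAntidiagonal.mem_antidiagonal, A]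
  omega

end

namespace bdd

open MvPolynomial Filter

variable {U : Ultrafilter ℕ} {K : ℕ → Type u} [∀ i, Field (K i)] {N : ℕ → ℕ}

theorem hc_bdd (n : ℕ) (B : ℕ) : ∃ B', ∀ (i : ℕ) (f : MvPolynomial (Fin (N i)) (K i)),
    f.totalDegree ≤ B → (((homogeneousComponent n).toAddMonoidHom :
      MvPolynomial (Fin (N i)) (K i) →+ MvPolynomial (Fin (N i)) (K i)) f).totalDegree ≤ B' :=
  ⟨n, fun _ f _ => (homogeneousComponent_isHomogeneous n f).totalDegree_le⟩

/-- The homogeneous component of a bounded sequence. -/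
noncomputable def hc (n : ℕ) : bdd U K N →+ bdd U K N :=
  op (fun _ => (homogeneousComponent n).toAddMonoidHom) (hc_bdd n)

theorem hc_bdd' (n : ℕ) (f : ∀ i, MvPolynomial (Fin (N i)) (K i)) :
    ∃ B : ℕ, ∀ i, (homogeneousComponent n (f i)).totalDegree ≤ B :=
  ⟨n, fun i => (homogeneousComponent_isHomogeneous n (f i)).totalDegree_le⟩

theorem hc_mk (n : ℕ) (f : ∀ i, MvPolynomial (Fin (N i)) (K i)) (hf) :
    hc (U := U) n (mk f hf) = mk (fun i => homogeneousComponent n (f i)) (hc_bdd' n f) := rfl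

theorem exists_hc_eq_zero (s : bdd U K N) : ∃ B, ∀ n, B < n → hc n s = 0 := by
  obtain ⟨f, ⟨B, hf⟩, rfl⟩ := exists_mk s
  refine ⟨B, fun n hn => ?_⟩
  rw [hc_mk, mk_eq_zero]
  exact Eventually.of_forall fun i => homogeneousComponent_eq_zero _ _ ((hf i).trans_lt hn)

theorem hc_mul (n : ℕ) (s t : bdd U K N) :
    hc n (s * t) = ∑ x ∈ Finset.HasAntidiagonal.antidiagonal n, hc x.1 s * hc x.2 t := by
  obtain ⟨f, hf, rfl⟩ := exists_mk s
  obtain ⟨g, hg, rfl⟩ := exists_mk t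
  refine Subtype.ext ?_
  rw [AddSubmonoidClass.coe_finsetSum]
  simp only [hc_mk, mk_mul, coe_mk]
  rw [← map_sum]
  refine congrArg _ (funext fun i => ?_)
  rw [homogeneousComponent_mul, Finset.sum_apply]

theorem hc_algebraMap (n : ℕ) (c : UProd U K) :
    hc n (algebraMap (UProd U K) (bdd U K N) c) = if n = 0 then algebraMap _ _ c else 0 := by
  obtain ⟨c, rfl⟩ := UProd.mk_surjective c
  have h0 : algebraMap (UProd U K) (bdd U K N) (UProd.mk U c) =
      mk (fun i => C (c i)) ⟨0, fun i => by rw [totalDegree_C]⟩ := rfl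
  rw [h0, hc_mk]
  split_ifs with h
  · refine mk_eq_mk.2 (Eventually.of_forall fun i => ?_)
    rw [homogeneousComponent_of_mem (isHomogeneous_C _ (c i)), if_pos h]
  · refine mk_eq_zero.2 (Eventually.of_forall fun i => ?_)
    rw [homogeneousComponent_of_mem (isHomogeneous_C _ (c i)), if_neg h]

/-- The polynomial whose coefficients are the homogeneous components. -/
noncomputable def γ (s : bdd U K N) : Polynomial (bdd U K N) :=
  ∑ n ∈ Finset.range ((exists_hc_eq_zero s).choose + 1), Polynomial.monomial n (hc n s)

theorem coeff_γ (s : bdd U K N) (n : ℕ) : (γ s).coeff n = hc n s := by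
  rw [γ, Polynomial.finsetSum_coeff]
  simp only [Polynomial.coeff_monomial]
  rw [Finset.sum_ite_eq' (Finset.range _) n fun n => hc n s]
  split_ifs with h
  · rfl
  · exact ((exists_hc_eq_zero s).choose_spec n (by simpa using h)).symm

theorem hc_hc (m n : ℕ) (s : bdd U K N) : hc m (hc n s) = if n = m then hc n s else 0 := by
  obtain ⟨f, hf, rfl⟩ := exists_mk s
  rw [hc_mk, hc_mk]
  split_ifs with h
  · refine mk_eq_mk.2 (Eventually.of_forall fun i => ?_)
    rw [homogeneousComponent_of_mem (homogeneousComponent_isHomogeneous n (f i)), if_pos h.symm]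
  · refine mk_eq_zero.2 (Eventually.of_forall fun i => ?_)
    rw [homogeneousComponent_of_mem (homogeneousComponent_isHomogeneous n (f i)),
      if_neg (Ne.symm h)]

variable (U K N) in
/-- The grading of the ring of bounded sequences. -/
noncomputable def grading : PolyGrading (UProd U K) (bdd U K N) where
  γ :=
    { toFun := γ
      map_one' := by
        ext1 n
        have := hc_algebraMap (U := U) (K := K) (N := N) n 1
        rw [coeff_γ, Polynomial.coeff_one]
        rw [map_one] at this
        simpa only [eq_comm] using this
      map_mul' := fun s t => by
        ext1 n
        simp only [coeff_γ, Polynomial.coeff_mul, hc_mul]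
      map_zero' := by
        ext1 n
        rw [coeff_γ, map_zero, Polynomial.coeff_zero]
      map_add' := fun s t => by
        ext1 n
        simp only [coeff_γ, Polynomial.coeff_add, map_add]
      commutes' := fun c => by
        ext1 n
        rw [coeff_γ, hc_algebraMap, Polynomial.algebraMap_apply, Polynomial.coeff_C] }
  eval_one := fun s => by
    obtain ⟨f, ⟨B, hf⟩, hs⟩ := exists_mk s
    have h : ∀ n, B < n → hc n s = 0 := fun n hn => by
      rw [hs, hc_mk, mk_eq_zero]
      exact Eventually.of_forall fun i =>
        homogeneousComponent_eq_zero _ _ ((hf i).trans_lt hn)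
    change (γ s).eval 1 = s
    rw [Polynomial.eval_eq_sum_range' (n := B + 1)]
    · simp only [one_pow, mul_one, coeff_γ]
      rw [hs]
      refine Subtype.ext ?_
      rw [AddSubmonoidClass.coe_finsetSum]
      simp only [hc_mk, coe_mk]
      rw [← map_sum]
      refine congrArg _ (funext fun i => ?_)
      rw [Finset.sum_apply, sum_range_homogeneousComponent _ (Nat.lt_succ_of_le (hf i))]
    · rw [Nat.lt_succ_iff, Polynomial.natDegree_le_iff_coeff_eq_zero]
      intro n hn
      rw [coeff_γ, h n hn]
  coact := fun s n => by
    change γ ((γ s).coeff n) = Polynomial.monomial n ((γ s).coeff n)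
    ext1 m
    rw [coeff_γ, coeff_γ, hc_hc, Polynomial.coeff_monomial]
  coeff_zero := fun s => by
    obtain ⟨f, hf, rfl⟩ := exists_mk s
    change ∃ c, (γ _).coeff 0 = _
    rw [coeff_γ, hc_mk, eq_algebraMap_iff]
    exact Eventually.of_forall fun i => ⟨_, homogeneousComponent_zero _⟩

theorem coeff_grading_γ (s : bdd U K N) (n : ℕ) : ((grading U K N).γ s).coeff n = hc n s :=
  coeff_γ s n

theorem deg_mk_le_iff {f : ∀ i, MvPolynomial (Fin (N i)) (K i)} {hf} {n : ℕ} :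
    (grading U K N).deg (mk f hf) ≤ n ↔ ∀ᶠ i in U, (f i).totalDegree ≤ n := by
  unfold PolyGrading.deg
  rw [Polynomial.natDegree_le_iff_coeff_eq_zero]
  simp only [coeff_grading_γ, hc_mk, mk_eq_zero]
  constructor
  · intro h
    obtain ⟨B, hB⟩ := hf
    have h2 : ∀ᶠ i in U, ∀ m ∈ Finset.range (B + 1), n < m → homogeneousComponent m (f i) = 0 := by
      rw [Finset.eventually_all]
      intro m _
      by_cases hm : n < m
      · filter_upwards [h m hm] with i hi _
        exact hi
      · exact Eventually.of_forall fun i hm' => absurd hm' hm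
    filter_upwards [h2] with i hi
    rw [← sum_range_homogeneousComponent (f i) (Nat.lt_succ_of_le (hB i))]
    refine totalDegree_finsetSum_le fun m hm => ?_
    by_cases hmn : n < m
    · rw [hi m hm hmn, totalDegree_zero]
      exact Nat.zero_le _
    · exact (homogeneousComponent_isHomogeneous m _).totalDegree_le.trans (not_lt.1 hmn)
  · intro h m hm
    filter_upwards [h] with i hi
    exact homogeneousComponent_eq_zero _ _ (hi.trans_lt hm)

theorem isHom_mk_iff {f : ∀ i, MvPolynomial (Fin (N i)) (K i)} {hf} {n : ℕ} :
    (grading U K N).IsHom n (mk f hf) ↔ ∀ᶠ i in U, (f i).IsHomogeneous n := by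
  constructor
  · intro h
    have h2 := h.coeff n
    rw [coeff_grading_γ, if_pos rfl, hc_mk, mk_eq_mk] at h2
    filter_upwards [h2] with i hi
    rw [← hi]
    exact homogeneousComponent_isHomogeneous _ _
  · intro h
    have h2 : mk f hf = ((grading U K N).γ (mk f hf)).coeff n := by
      rw [coeff_grading_γ, hc_mk, mk_eq_mk]
      filter_upwards [h] with i hi
      exact (homogeneousComponent_eq_self hi).symm
    rw [h2]
    exact (grading U K N).isHom_coeff _ _

end bdd

end SmallSubalgebra

namespace SmallSubalgebra

section

open MvPolynomial

variable {σ k : Type*} [CommRing k]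

/-- `f` vanishes or has total degree less than `e`. -/
def Low (e : ℕ) (f : MvPolynomial σ k) : Prop := f = 0 ∨ f.totalDegree < e

theorem Low.mono {e e' : ℕ} (h : e ≤ e') {f : MvPolynomial σ k} (hf : Low e f) : Low e' f :=
  hf.imp_right fun h' => h'.trans_le h

theorem Low.add {e : ℕ} {f g : MvPolynomial σ k} (hf : Low e f) (hg : Low e g) :
    Low e (f + g) := by
  rcases hf with rfl | hf
  · simpa using hg
  rcases hg with rfl | hg
  · exact Or.inr (by simpa using hf)
  exact Or.inr ((totalDegree_add _ _).trans_lt (max_lt hf hg))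

theorem Low.sum {ι : Type*} {e : ℕ} {s : Finset ι} {f : ι → MvPolynomial σ k}
    (h : ∀ i ∈ s, Low e (f i)) : Low e (∑ i ∈ s, f i) :=
  Finset.sum_induction _ (Low e) (fun _ _ => Low.add) (Or.inl rfl) h

theorem Low.mul {e e' : ℕ} {f g : MvPolynomial σ k} (hf : Low e f) (hg : g.totalDegree ≤ e') :
    Low (e + e') (f * g) := by
  rcases hf with rfl | hf
  · exact Or.inl (zero_mul _)
  exact Or.inr ((totalDegree_mul _ _).trans_lt (by omega))

variable {L : MvPolynomial σ k →ₗ[k] MvPolynomial σ k} {T : MvPolynomial σ k → MvPolynomial σ k}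

theorem low_monomial_one (hT : ∀ f, (T f).totalDegree ≤ f.totalDegree)
    (hL : ∀ f g, L (f * g) = L g * f + L f * T g) (h1 : L 1 = 0)
    (hX : ∀ j, ∃ c, L (X j) = C c) (d : σ →₀ ℕ) : Low d.degree (L (monomial d 1)) := by
  have hmul : ∀ d₁ d₂ : σ →₀ ℕ, Low d₁.degree (L (monomial d₁ 1)) →
      Low d₂.degree (L (monomial d₂ 1)) → Low (d₁ + d₂).degree (L (monomial (d₁ + d₂) 1)) := by
    intro d₁ d₂ h₁ h₂
    have : (monomial (d₁ + d₂) (1 : k)) = monomial d₁ 1 * monomial d₂ 1 := by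
      rw [monomial_mul, one_mul]
    rw [this, hL, map_add]
    have hd : ∀ d : σ →₀ ℕ, (monomial d (1 : k)).totalDegree ≤ d.degree := fun d =>
      totalDegree_monomial_le _ _
    refine Low.add ?_ (h₁.mul ((hT _).trans (hd _)))
    rw [add_comm]
    exact h₂.mul (hd _)
  induction d using Finsupp.induction_linear with
  | zero => exact Or.inl h1
  | add d₁ d₂ h₁ h₂ => exact hmul _ _ h₁ h₂
  | single j n =>
    induction n with
    | zero =>
      rw [Finsupp.single_zero]
      exact Or.inl h1
    | succ n ih =>
      rw [Finsupp.single_add]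
      refine hmul _ _ ih ?_
      obtain ⟨c, hc⟩ := hX j
      refine Or.inr ?_
      change (L (X j)).totalDegree < _
      rw [hc, totalDegree_C, Finsupp.degree_single]
      exact one_pos

theorem low_of_twisted (hT : ∀ f, (T f).totalDegree ≤ f.totalDegree)
    (hL : ∀ f g, L (f * g) = L g * f + L f * T g) (h1 : L 1 = 0)
    (hX : ∀ j, ∃ c, L (X j) = C c) (f : MvPolynomial σ k) : Low f.totalDegree (L f) := by
  conv => arg 2; rw [f.as_sum, map_sum]
  refine Low.sum fun d hd => ?_
  have : monomial d (coeff d f) = coeff d f • monomial d (1 : k) := by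
    rw [smul_monomial, smul_eq_mul, mul_one]
  rw [this, map_smul, smul_eq_C_mul, mul_comm]
  exact ((low_monomial_one hT hL h1 hX d).mul (totalDegree_C _).le).mono
    (by rw [add_zero]; exact le_totalDegree hd)

/-- Translation of the variables by `v`. -/
noncomputable def translate (v : σ → k) : MvPolynomial σ k →ₐ[k] MvPolynomial σ k :=
  aeval fun j => X j + C (v j)

theorem totalDegree_translate_le (v : σ → k) (f : MvPolynomial σ k) :
    (translate v f).totalDegree ≤ f.totalDegree := by
  conv_lhs => rw [f.as_sum, map_sum]
  refine totalDegree_finsetSum_le fun d hd => ?_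
  rw [translate, aeval_monomial, ← C_eq_algebraMap]
  refine (totalDegree_mul _ _).trans ?_
  rw [totalDegree_C, zero_add]
  refine ((totalDegree_finsetProd _ _).trans (Finset.sum_le_sum fun j _ => ?_)).trans
    (le_totalDegree hd)
  refine (totalDegree_pow _ _).trans ((Nat.mul_le_mul_left _ ?_).trans_eq (mul_one _))
  refine (totalDegree_add _ _).trans (max_le ?_ (by rw [totalDegree_C]; exact zero_le_one))
  exact (totalDegree_monomial_le _ _).trans_eq (Finsupp.degree_single _ _)

theorem low_translate (v : σ → k) (f : MvPolynomial σ k) :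
    Low f.totalDegree (translate v f - f) := by
  refine low_of_twisted (L := (translate v).toLinearMap - LinearMap.id) (T := translate v)
    (totalDegree_translate_le v) (fun f g => ?_) ?_ (fun j => ⟨v j, ?_⟩) f
  · simp only [LinearMap.sub_apply, AlgHom.toLinearMap_apply, LinearMap.id_apply, map_mul]
    ring
  · simp
  · simp [translate]

theorem low_mkDerivation (v : σ → k) (f : MvPolynomial σ k) :
    Low f.totalDegree (mkDerivation k (fun j => (C (v j) : MvPolynomial σ k)) f) := by
  refine low_of_twisted
    (L := (mkDerivation k fun j => (C (v j) : MvPolynomial σ k)).toLinearMap) (T := id)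
    (fun _ => le_rfl) (fun f g => ?_) ?_ (fun j => ⟨v j, ?_⟩) f
  · simp only [Derivation.coeFn_coe, Derivation.leibniz,
      smul_eq_mul, id]
    ring
  · simp
  · simp

theorem eq_C_of_translate_eq {k : Type*} [Field k] [Infinite k] {f : MvPolynomial σ k}
    (h : ∀ v, translate v f = f) : ∃ c, f = C c := by
  refine ⟨eval 0 f, MvPolynomial.funext fun v => ?_⟩
  rw [eval_C]
  conv_rhs => rw [← h v]
  rw [translate, ← coe_aeval_eq_eval, ← coe_aeval_eq_eval, RingHom.coe_coe, RingHom.coe_coe]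
  rw [← AlgHom.comp_apply, comp_aeval]
  simp

theorem exists_pow_eq_of_pderiv_eq_zero {k : Type*} [Field k] [IsAlgClosed k] {p : ℕ}
    (hp : p.Prime) [CharP k p] {f : MvPolynomial σ k} (h : ∀ j, pderiv j f = 0) :
    ∃ w, w ^ p = f ∧ w.totalDegree ≤ f.totalDegree := by
  have hdvd : ∀ d ∈ f.support, ∀ j, p ∣ d j := by
    intro d hd j
    rcases Nat.eq_zero_or_pos (d j) with h0 | h0
    · rw [h0]; exact dvd_zero p
    have h1 := congrArg (coeff (d - Finsupp.single j 1)) (h j)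
    rw [coeff_zero, coeff_pderiv] at h1
    have h2 : d - Finsupp.single j 1 + Finsupp.single j 1 = d :=
      tsub_add_cancel_of_le (Finsupp.single_le_iff.2 h0)
    rw [h2] at h1
    have h3 := (mul_eq_zero.1 h1).resolve_left (mem_support_iff.1 hd)
    rw [← Nat.cast_succ, CharP.cast_eq_zero_iff k p] at h3
    simpa [Nat.sub_add_cancel h0] using h3
  have hdvd' : ∀ d ∈ f.support, ∃ e : σ →₀ ℕ, d = p • e := fun d hd =>
    ⟨d.mapRange (· / p) (Nat.zero_div p), by
      ext j
      simp [Nat.mul_div_cancel' (hdvd d hd j)]⟩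
  have hroot : ∀ a : k, ∃ b, b ^ p = a := fun a =>
    IsAlgClosed.exists_pow_nat_eq a hp.pos
  choose r hr using hroot
  choose! e he using hdvd'
  have : Fact p.Prime := ⟨hp⟩
  have hw : (∑ d ∈ f.support, monomial (e d) (r (coeff d f))) ^ p = f := by
    rw [sum_pow_char]
    conv_rhs => rw [f.as_sum]
    refine Finset.sum_congr rfl fun d hd => ?_
    rw [monomial_pow, hr, ← he d hd]
  refine ⟨_, hw, ?_⟩
  refine totalDegree_finsetSum_le fun d hd => (totalDegree_monomial_le _ _).trans ?_
  refine le_trans ?_ (le_totalDegree hd)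
  conv_rhs => rw [he d hd]
  change (e d).degree ≤ (p • e d).degree
  rw [map_nsmul, smul_eq_mul]
  exact Nat.le_mul_of_pos_left _ hp.pos

end

end SmallSubalgebra

namespace SmallSubalgebra

namespace bdd

open MvPolynomial Filter

variable {U : Ultrafilter ℕ} {K : ℕ → Type u} [∀ i, Field (K i)] {N : ℕ → ℕ}

theorem totalDegree_le_of_low {k σ : Type*} [CommRing k] {f g : MvPolynomial σ k}
    (h : Low f.totalDegree g) {B : ℕ} (hB : f.totalDegree ≤ B) : g.totalDegree ≤ B := by
  rcases h with rfl | h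
  · rw [totalDegree_zero]
    exact Nat.zero_le B
  · exact h.le.trans hB

theorem deg_lt_of_low {f g : ∀ i, MvPolynomial (Fin (N i)) (K i)} (hf hg)
    (h : ∀ i, Low (f i).totalDegree (g i)) :
    (mk g hg : bdd U K N) = 0 ∨ (grading U K N).deg (mk g hg) < (grading U K N).deg (mk f hf) := by
  have h1 := deg_mk_le_iff.1 (le_refl ((grading U K N).deg (mk f hf)))
  by_cases h0 : (grading U K N).deg (mk f hf) = 0
  · left
    rw [mk_eq_zero]
    filter_upwards [h1] with i hi
    rcases h i with h | h
    · exact h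
    · omega
  · right
    have : (grading U K N).deg (mk g hg) ≤ (grading U K N).deg (mk f hf) - 1 := by
      rw [deg_mk_le_iff]
      filter_upwards [h1] with i hi
      rcases h i with h | h
      · rw [h, totalDegree_zero]
        exact Nat.zero_le _
      · omega
    omega

theorem translate_bdd (v : ∀ i, Fin (N i) → K i) (B : ℕ) : ∃ B', ∀ i f,
    f.totalDegree ≤ B → ((translate (v i)).toLinearMap.toAddMonoidHom f).totalDegree ≤ B' :=
  ⟨B, fun i f hf => (totalDegree_translate_le (v i) f).trans hf⟩

/-- Translation of bounded sequences. -/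
noncomputable def trans (v : ∀ i, Fin (N i) → K i) : bdd U K N →ₐ[UProd U K] bdd U K N where
  toFun := op _ (translate_bdd v)
  map_one' := by
    rw [mk_one, op_mk, mk_eq_mk]
    exact Eventually.of_forall fun i => (translate (v i)).map_one
  map_mul' := fun s t => by
    obtain ⟨f, hf, rfl⟩ := exists_mk s
    obtain ⟨g, hg, rfl⟩ := exists_mk t
    rw [mk_mul, op_mk, op_mk, op_mk, mk_mul, mk_eq_mk]
    exact Eventually.of_forall fun i => (translate (v i)).map_mul _ _
  map_zero' := map_zero _
  map_add' := map_add _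
  commutes' := fun c => by
    obtain ⟨c, rfl⟩ := UProd.mk_surjective c
    rw [Algebra.algebraMap_eq_smul_one, mk_one, smul_mk, op_mk, mk_eq_mk]
    exact Eventually.of_forall fun i => by
      change translate (v i) _ = _
      rw [map_smul, map_one]

theorem trans_bdd (v : ∀ i, Fin (N i) → K i) {f : ∀ i, MvPolynomial (Fin (N i)) (K i)}
    (hf : ∃ B : ℕ, ∀ i, (f i).totalDegree ≤ B) :
    ∃ B : ℕ, ∀ i, (translate (v i) (f i)).totalDegree ≤ B :=
  hf.imp fun _ h i => (totalDegree_translate_le (v i) (f i)).trans (h i)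

theorem trans_mk (v : ∀ i, Fin (N i) → K i) (f : ∀ i, MvPolynomial (Fin (N i)) (K i)) (hf) :
    trans (U := U) v (mk f hf) = mk (fun i => translate (v i) (f i))
      (trans_bdd v hf) := rfl

theorem deriv_bdd (v : ∀ i, Fin (N i) → K i) (B : ℕ) : ∃ B', ∀ i f,
    f.totalDegree ≤ B → ((mkDerivation (K i)
      fun j => (C (v i j) : MvPolynomial (Fin (N i)) (K i))).toLinearMap.toAddMonoidHom
        f).totalDegree ≤ B' :=
  ⟨B, fun i f hf => totalDegree_le_of_low (low_mkDerivation (v i) f) hf⟩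

/-- Directional derivatives of bounded sequences. -/
noncomputable def deriv (v : ∀ i, Fin (N i) → K i) :
    Derivation (UProd U K) (bdd U K N) (bdd U K N) :=
  Derivation.mk'
    { toFun := op _ (deriv_bdd v)
      map_add' := map_add _
      map_smul' := fun c s => by
        obtain ⟨c, rfl⟩ := UProd.mk_surjective c
        obtain ⟨f, hf, rfl⟩ := exists_mk s
        rw [smul_mk, op_mk, op_mk, RingHom.id_apply, smul_mk, mk_eq_mk]
        exact Eventually.of_forall fun i => (mkDerivation (K i)
          fun j => (C (v i j) : MvPolynomial (Fin (N i)) (K i))).map_smul _ _ }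
    fun s t => by
      obtain ⟨f, hf, rfl⟩ := exists_mk s
      obtain ⟨g, hg, rfl⟩ := exists_mk t
      change op _ (deriv_bdd v) _ = _ * op _ (deriv_bdd v) _ + _ * op _ (deriv_bdd v) _
      rw [mk_mul, op_mk, op_mk, op_mk, mk_mul, mk_mul, mk_add, mk_eq_mk]
      exact Eventually.of_forall fun i => (mkDerivation (K i)
          fun j => (C (v i j) : MvPolynomial (Fin (N i)) (K i))).leibniz _ _

theorem deriv_bdd' (v : ∀ i, Fin (N i) → K i) {f : ∀ i, MvPolynomial (Fin (N i)) (K i)}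
    (hf : ∃ B : ℕ, ∀ i, (f i).totalDegree ≤ B) :
    ∃ B : ℕ, ∀ i, (mkDerivation (K i)
      (fun j => (C (v i j) : MvPolynomial (Fin (N i)) (K i))) (f i)).totalDegree ≤ B :=
  hf.imp fun _ h i => totalDegree_le_of_low (low_mkDerivation (v i) (f i)) (h i)

theorem deriv_mk (v : ∀ i, Fin (N i) → K i) (f : ∀ i, MvPolynomial (Fin (N i)) (K i)) (hf) :
    deriv (U := U) v (mk f hf) = mk (fun i => mkDerivation (K i)
      (fun j => (C (v i j) : MvPolynomial (Fin (N i)) (K i))) (f i))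
      (deriv_bdd' v hf) := rfl

theorem sub_eq_mk {f g : ∀ i, MvPolynomial (Fin (N i)) (K i)} (hf hg) :
    ∃ h, (mk f hf - mk g hg : bdd U K N) = mk (fun i => f i - g i) h := by
  obtain ⟨B, hB⟩ := id hf
  obtain ⟨C, hC⟩ := id hg
  exact ⟨⟨max B C, fun i => (totalDegree_sub _ _).trans (max_le_max (hB i) (hC i))⟩, rfl⟩

theorem exists_eq_algebraMap_of_trans_eq [∀ i, Infinite (K i)] (s : bdd U K N)
    (h : ∀ v, trans v s = s) : ∃ c, s = algebraMap (UProd U K) _ c := by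
  obtain ⟨f, hf, rfl⟩ := exists_mk s
  rw [eq_algebraMap_iff]
  by_contra hne
  rw [← Ultrafilter.eventually_not] at hne
  have : ∀ i, ∃ v, (¬ ∃ c, f i = C c) → translate v (f i) ≠ f i := fun i => by
    by_contra! h'
    obtain ⟨c, hc⟩ := eq_C_of_translate_eq fun v => (h' v).2
    exact (h' 0).1 c hc
  choose v hv using this
  have h1 := h v
  rw [trans_mk, mk_eq_mk] at h1
  obtain ⟨i, h2, h3⟩ := (h1.and hne).exists
  exact hv i h3 h2

theorem exists_pow_eq_of_deriv_eq_zero [∀ i, IsAlgClosed (K i)] (p : ℕ) [ExpChar (UProd U K) p]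
    (s : bdd U K N) (h : ∀ v, deriv v s = 0) : ∃ w, w ^ p = s := by
  rcases ‹ExpChar (UProd U K) p› with _ | ⟨hp⟩
  · exact ⟨s, pow_one s⟩
  obtain ⟨f, hf, rfl⟩ := exists_mk s
  have hchar : ∀ᶠ i in U, CharP (K i) p := by
    have h0 : UProd.mk U (fun i => (p : K i)) = 0 := by
      have := CharP.cast_eq_zero (UProd U K) p
      rw [← map_natCast (UProd.mk U)] at this
      exact this
    filter_upwards [UProd.mk_eq_zero.1 h0] with i hi
    obtain ⟨q, hq⟩ := CharP.exists (K i)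
    have : q ∣ p := (CharP.cast_eq_zero_iff (K i) q p).1 hi
    rcases (Nat.dvd_prime hp).1 this with rfl | rfl
    · exact (CharP.char_ne_one (K i) 1 rfl).elim
    · exact hq
  have hpd : ∀ᶠ i in U, ∀ j, pderiv j (f i) = 0 := by
    by_contra hne
    rw [← Ultrafilter.eventually_not] at hne
    have : ∀ i, ∃ v : Fin (N i) → K i, (¬ ∀ j, pderiv j (f i) = 0) →
        mkDerivation (K i) (fun j => (C (v j) : MvPolynomial (Fin (N i)) (K i))) (f i) ≠ 0 := by
      intro i
      by_cases hi : ∀ j, pderiv j (f i) = 0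
      · exact ⟨0, fun h => absurd hi h⟩
      · obtain ⟨j, hj⟩ := not_forall.1 hi
        refine ⟨Pi.single j 1, fun _ => ?_⟩
        have hD : mkDerivation (K i) (fun l => (C ((Pi.single j 1 : Fin (N i) → K i) l) :
            MvPolynomial (Fin (N i)) (K i))) = pderiv j := by
          refine derivation_ext fun l => ?_
          rw [mkDerivation_X, pderiv_X, Pi.single_apply, Pi.single_apply]
          split_ifs <;> simp
        rwa [hD]
    choose v hv using this
    have h1 := h v
    rw [deriv_mk, mk_eq_zero] at h1
    obtain ⟨i, h2, h3⟩ := (h1.and hne).exists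
    exact hv i h3 h2
  have : ∀ i, ∃ w, w.totalDegree ≤ (f i).totalDegree ∧
      (CharP (K i) p ∧ (∀ j, pderiv j (f i) = 0) → w ^ p = f i) := fun i => by
    by_cases hi : CharP (K i) p ∧ ∀ j, pderiv j (f i) = 0
    · have := hi.1
      obtain ⟨w, hw, hw'⟩ := exists_pow_eq_of_pderiv_eq_zero hp hi.2
      exact ⟨w, hw', fun _ => hw⟩
    · exact ⟨0, by simp, fun h => absurd h hi⟩
  choose w hw hw' using this
  obtain ⟨B, hB⟩ := id hf
  have hwB : ∃ B, ∀ i, (w i).totalDegree ≤ B := ⟨B, fun i => (hw i).trans (hB i)⟩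
  refine ⟨mk w hwB, Subtype.ext ?_⟩
  change (UProd.mk U w) ^ p = UProd.mk U f
  rw [← map_pow, UProd.mk_eq_mk]
  filter_upwards [hchar, hpd] with i h1 h2
  exact hw' i ⟨h1, h2⟩

variable (U K N) in
/-- All degree-lowering algebra endomorphisms and derivations of the ring of bounded sequences. -/
noncomputable def motions [∀ i, IsAlgClosed (K i)] (p : ℕ) [ExpChar (UProd U K) p] :
    Motions (grading U K N) p where
  T := {τ | ∀ s, τ s = s ∨ (grading U K N).deg (τ s - s) < (grading U K N).deg s}
  D := {δ | ∀ s, δ s = 0 ∨ (grading U K N).deg (δ s) < (grading U K N).deg s}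
  T_lower := fun _ h => h
  D_lower := fun _ h => h
  inv := fun s h => exists_eq_algebraMap_of_trans_eq s fun v => h _ fun s => by
    obtain ⟨f, hf, rfl⟩ := exists_mk s
    obtain ⟨h', hs⟩ := sub_eq_mk (U := U) (trans_bdd v hf) hf
    rw [← sub_eq_zero, trans_mk, hs]
    exact deg_lt_of_low hf h' fun i => low_translate (v i) (f i)
  pth := fun s h => exists_pow_eq_of_deriv_eq_zero p s fun v => h _ fun s => by
    obtain ⟨f, hf, rfl⟩ := exists_mk s
    rw [deriv_mk]
    exact deg_lt_of_low hf _ fun i => low_mkDerivation (v i) (f i)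

end bdd

end SmallSubalgebra

namespace SmallSubalgebra

section

open MvPolynomial

theorem homogeneousComponent_mem_range {k σ τ : Type*} [Field k] {ℓ : τ → MvPolynomial σ k}
    (hℓ : ∀ j, (ℓ j).IsHomogeneous 1) : ∀ f ∈ (aeval (R := k) ℓ).range,
      ∀ n, homogeneousComponent n f ∈ (aeval (R := k) ℓ).range := by
  intro f hf n
  obtain ⟨q, hq⟩ := (AlgHom.mem_range _).1 hf
  rw [← hq, homogeneousComponent_aeval hℓ]
  exact (AlgHom.mem_range _).2 ⟨_, rfl⟩

theorem finite_of_eq_top {F S : Type*} [CommRing F] [CommRing S] [Algebra F S]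
    {A : Subalgebra F S} (h : A = ⊤) : Module.Finite A S := by
  subst h
  refine ⟨⟨{1}, ?_⟩⟩
  rw [eq_top_iff]
  rintro s -
  rw [← mul_one s]
  exact Submodule.smul_mem _ (⟨s, Algebra.mem_top⟩ : (⊤ : Subalgebra F S))
    (Submodule.subset_span (by simp))

end

namespace bdd

open MvPolynomial Filter

variable {U : Ultrafilter ℕ} {K : ℕ → Type u} [∀ i, Field (K i)] {N : ℕ → ℕ}

theorem sum_pow_mul_mk (n : ℕ) {z : ∀ i, MvPolynomial (Fin (N i)) (K i)} (hz)
    {a : ℕ → ∀ i, MvPolynomial (Fin (N i)) (K i)}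
        (ha : ∀ k, ∃ B : ℕ, ∀ i, (a k i).totalDegree ≤ B) :
    ((∑ k ∈ Finset.range n, (mk z hz : bdd U K N) ^ k * mk (a k) (ha k) : bdd U K N) :
      UProd U fun i => MvPolynomial (Fin (N i)) (K i)) =
    UProd.mk U fun i => ∑ k ∈ Finset.range n, z i ^ k * a k i := by
  rw [AddSubmonoidClass.coe_finsetSum]
  have : (fun i => ∑ k ∈ Finset.range n, z i ^ k * a k i) =
      ∑ k ∈ Finset.range n, z ^ k * a k := by
    funext i
    rw [Finset.sum_apply]
    rfl
  rw [this, map_sum]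
  refine Finset.sum_congr rfl fun k _ => ?_
  rw [map_mul, map_pow]
  rfl

/-- The subalgebra of classes of bounded sequences with terms in given subalgebras. -/
noncomputable def sub (U : Ultrafilter ℕ)
    (A : ∀ i, Subalgebra (K i) (MvPolynomial (Fin (N i)) (K i))) :
    Subalgebra (UProd U K) (bdd U K N) where
  carrier := {s | ∃ f hf, s = mk f hf ∧ ∀ i, f i ∈ A i}
  mul_mem' := by
    rintro _ _ ⟨f, hf, rfl, hfA⟩ ⟨g, hg, rfl, hgA⟩
    exact ⟨_, _, mk_mul f g hf hg, fun i => mul_mem (hfA i) (hgA i)⟩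
  add_mem' := by
    rintro _ _ ⟨f, hf, rfl, hfA⟩ ⟨g, hg, rfl, hgA⟩
    exact ⟨_, _, mk_add f g hf hg, fun i => add_mem (hfA i) (hgA i)⟩
  algebraMap_mem' := by
    intro c
    obtain ⟨c, rfl⟩ := UProd.mk_surjective c
    refine ⟨fun i => C (c i), ⟨0, fun i => by rw [totalDegree_C]⟩, rfl, fun i => ?_⟩
    exact (A i).algebraMap_mem (c i)

theorem mk_mem_sub {A : ∀ i, Subalgebra (K i) (MvPolynomial (Fin (N i)) (K i))}
    {f : ∀ i, MvPolynomial (Fin (N i)) (K i)} (hf) (h : ∀ i, f i ∈ A i) :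
    (mk f hf : bdd U K N) ∈ sub U A := ⟨f, hf, rfl, h⟩

theorem homog_sub {A : ∀ i, Subalgebra (K i) (MvPolynomial (Fin (N i)) (K i))}
    (hA : ∀ i, ∀ f ∈ A i, ∀ n, homogeneousComponent n f ∈ A i) :
    (grading U K N).Homog (sub U A) := by
  rintro _ ⟨f, hf, rfl, hfA⟩ n
  rw [coeff_grading_γ, hc_mk]
  exact mk_mem_sub _ fun i => hA i _ (hfA i) n

theorem finite_adjoin_sub_top (t : Set (bdd U K N)) : Module.Finite
    (Algebra.adjoin (UProd U K) ((sub U (fun i => (aeval (R := K i)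
      (X : Fin (N i) → MvPolynomial (Fin (N i)) (K i))).range) : Set (bdd U K N)) ∪ t))
    (bdd U K N) := by
  refine finite_of_eq_top (eq_top_iff.2 ?_)
  rintro s -
  refine Algebra.subset_adjoin (Or.inl ?_)
  obtain ⟨f, hf, rfl⟩ := exists_mk s
  refine mk_mem_sub hf fun i => ?_
  rw [aeval_X_left]
  exact ⟨f i, rfl⟩

theorem isHom_bdd {n : ℕ} {f : ∀ i, MvPolynomial (Fin (N i)) (K i)}
    (h : ∀ i, (f i).IsHomogeneous n) : ∃ B : ℕ, ∀ i, (f i).totalDegree ≤ B :=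
  ⟨n, fun i => (h i).totalDegree_le⟩

theorem sub_le_adjoin {A A' : ∀ i, Subalgebra (K i) (MvPolynomial (Fin (N i)) (K i))}
    (hA : ∀ i, ∀ f ∈ A i, ∀ n, homogeneousComponent n f ∈ A i)
    {z : ∀ i, MvPolynomial (Fin (N i)) (K i)} (hz)
    (h : ∀ᶠ i in U, ∀ n, ∀ f ∈ A i, f.IsHomogeneous n →
        ∃ a : ℕ → MvPolynomial (Fin (N i)) (K i), (∀ j, a j ∈ A' i) ∧
          (∀ j ≤ n, (a j).IsHomogeneous (n - j)) ∧
          f = ∑ j ∈ Finset.range (n + 1), z i ^ j * a j) :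
    sub U A ≤ Algebra.adjoin (UProd U K) (insert (mk z hz) (sub U A' : Set (bdd U K N))) := by
  rintro _ ⟨f, hf, rfl, hfA⟩
  rw [← (grading U K N).sum_coeff (mk f hf)]
  refine sum_mem fun n _ => ?_
  rw [coeff_grading_γ, hc_mk]
  have : ∀ i, ∃ a : ℕ → MvPolynomial (Fin (N i)) (K i), (∀ j, a j ∈ A' i) ∧
      (∀ j, (a j).IsHomogeneous (n - j)) ∧ ((∀ n, ∀ f ∈ A i, f.IsHomogeneous n →
        ∃ a : ℕ → MvPolynomial (Fin (N i)) (K i), (∀ j, a j ∈ A' i) ∧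
          (∀ j ≤ n, (a j).IsHomogeneous (n - j)) ∧
          f = ∑ j ∈ Finset.range (n + 1), z i ^ j * a j) →
      homogeneousComponent n (f i) = ∑ j ∈ Finset.range (n + 1), z i ^ j * a j) := fun i => by
    by_cases hi : ∀ n, ∀ f ∈ A i, f.IsHomogeneous n →
        ∃ a : ℕ → MvPolynomial (Fin (N i)) (K i), (∀ j, a j ∈ A' i) ∧
          (∀ j ≤ n, (a j).IsHomogeneous (n - j)) ∧
          f = ∑ j ∈ Finset.range (n + 1), z i ^ j * a j
    · obtain ⟨a, h1, h2, h3⟩ := hi n _ (hA i _ (hfA i) n)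
        (homogeneousComponent_isHomogeneous n (f i))
      refine ⟨fun j => if j ≤ n then a j else 0, fun j => ?_, fun j => ?_, fun _ => ?_⟩
      · dsimp only
        split_ifs
        · exact h1 j
        · exact zero_mem _
      · dsimp only
        split_ifs with hj
        · exact h2 j hj
        · exact isHomogeneous_zero _ _ _
      · rw [h3]
        refine Finset.sum_congr rfl fun j hj => ?_
        dsimp only
        rw [if_pos (by simpa [Nat.lt_succ_iff] using hj)]
    · exact ⟨fun _ => 0, fun _ => zero_mem _, fun _ => isHomogeneous_zero _ _ _,
        fun h => absurd h hi⟩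
  choose a ha1 ha2 ha3 using this
  have hb : ∀ k, ∃ B : ℕ, ∀ i, (a i k).totalDegree ≤ B := fun k => isHom_bdd fun i => ha2 i k
  have heq : (mk (fun i => homogeneousComponent n (f i)) (hc_bdd' n f) : bdd U K N) =
      ∑ k ∈ Finset.range (n + 1), mk z hz ^ k * mk (fun i => a i k) (hb k) := by
    refine Subtype.ext ?_
    rw [sum_pow_mul_mk (n + 1) hz (a := fun k i => a i k), coe_mk, UProd.mk_eq_mk]
    filter_upwards [h] with i hi
    exact ha3 i hi
  rw [heq]
  refine sum_mem fun k _ => mul_mem (pow_mem ?_ _) ?_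
  · exact Algebra.subset_adjoin (Set.mem_insert _ _)
  · exact Algebra.subset_adjoin (Set.mem_insert_of_mem _ (mk_mem_sub _ fun i => ha1 i k))

end bdd

end SmallSubalgebra

namespace SmallSubalgebra

theorem exists_monic_relation {F S : Type*} [Field F] [CommRing S] [Algebra F S]
    {A : Subalgebra F S} (h : Module.Finite A S) (z : S) :
    ∃ (n : ℕ) (b : ℕ → S), (∀ k, b k ∈ A) ∧ z ^ n + ∑ k ∈ Finset.range n, b k * z ^ k = 0 := by
  obtain ⟨P, hP, hPz⟩ := Algebra.IsIntegral.isIntegral (R := A) z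
  refine ⟨P.natDegree, fun k => P.coeff k, fun k => (P.coeff k).2, ?_⟩
  rw [Polynomial.eval₂_eq_sum_range, Finset.sum_range_succ, hP.coeff_natDegree, map_one,
    one_mul, add_comm] at hPz
  exact hPz

namespace bdd

open MvPolynomial Filter

variable {U : Ultrafilter ℕ} {K : ℕ → Type u} [∀ i, Field (K i)] {N : ℕ → ℕ}

theorem eventually_monic_relation {A : ∀ i, Subalgebra (K i) (MvPolynomial (Fin (N i)) (K i))}
    {B : Subalgebra (UProd U K) (bdd U K N)} (hB : Module.Finite B (bdd U K N))
    (hBA : B ≤ sub U A) (z : ∀ i, MvPolynomial (Fin (N i)) (K i))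
    (hz : ∃ B : ℕ, ∀ i, (z i).totalDegree ≤ B) :
    ∀ᶠ i in U, ∃ (n : ℕ) (b : ℕ → MvPolynomial (Fin (N i)) (K i)), (∀ k, b k ∈ A i) ∧
      z i ^ n + ∑ k ∈ Finset.range n, b k * z i ^ k = 0 := by
  obtain ⟨n, b, hb, hrel⟩ := exists_monic_relation hB (mk z hz : bdd U K N)
  have : ∀ k, ∃ f hf, b k = mk f hf ∧ ∀ i, f i ∈ A i := fun k => hBA (hb k)
  choose f hf hbf hfA using this
  have h1 : ((mk z hz ^ n + ∑ k ∈ Finset.range n, b k * mk z hz ^ k : bdd U K N) :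
      UProd U fun i => MvPolynomial (Fin (N i)) (K i)) = 0 := by
    rw [hrel]
    rfl
  simp only [hbf] at h1
  simp only [mul_comm (mk (f _) (hf _))] at h1
  have h2 : ((mk z hz ^ n + ∑ k ∈ Finset.range n, mk z hz ^ k * mk (f k) (hf k) : bdd U K N) :
      UProd U fun i => MvPolynomial (Fin (N i)) (K i)) = UProd.mk U (z ^ n) +
        UProd.mk U fun i => ∑ k ∈ Finset.range n, z i ^ k * f k i := by
    rw [← sum_pow_mul_mk n hz hf, map_pow]
    rfl
  rw [h2, ← map_add, UProd.mk_eq_zero] at h1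
  filter_upwards [h1] with i hi
  refine ⟨n, fun k => f k i, fun k => hfA k i, ?_⟩
  simp only [mul_comm (f _ i)]
  exact hi

/-- The equivalence used to append one more element to a family. -/
def sumFinSuccEquiv (σ : Type*) (s : ℕ) : σ ⊕ Fin (s + 1) ≃ Option (σ ⊕ Fin s) where
  toFun := Sum.elim (fun a => some (Sum.inl a)) fun j =>
    Fin.lastCases (motive := fun _ => Option (σ ⊕ Fin s)) none (fun j => some (Sum.inr j)) j
  invFun o := o.elim (Sum.inr (Fin.last s)) (Sum.map id Fin.castSucc)
  left_inv := by
    rintro (a | j)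
    · rfl
    · induction j using Fin.lastCases <;> simp
  right_inv := by
    rintro (_ | a | j) <;> simp

theorem exists_linear_forms [∀ i, IsAlgClosed (K i)] {E : Set (bdd U K N)}
    (hpos : ∀ e ∈ E, ∃ n, 0 < n ∧ (grading U K N).IsHom n e)
    (htop : Algebra.adjoin (UProd U K) E = ⊤)
    (hind : AlgebraicIndependent (UProd U K) ((↑) : E → bdd U K N)) (s : ℕ)
    (g : ∀ i, Fin s → MvPolynomial (Fin (N i)) (K i))
    (hg : ∀ j, ∃ B : ℕ, ∀ i, (g i j).totalDegree ≤ B)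
    (hinj : Function.Injective fun j => (mk (fun i => g i j) (hg j) : bdd U K N))
    (hE : ∀ j, (mk (fun i => g i j) (hg j) : bdd U K N) ∈ E) :
    ∃ (M : ℕ → ℕ) (ℓ : ∀ i, Fin (M i) → MvPolynomial (Fin (N i)) (K i)),
      (∀ i j, (ℓ i j).IsHomogeneous 1) ∧
      (∀ᶠ i in U, FlatFam (k := K i) (Sum.elim (ℓ i) (g i))) ∧
      Module.Finite (Algebra.adjoin (UProd U K)
        ((sub U fun i => (aeval (R := K i) (ℓ i)).range : Set (bdd U K N)) ∪
          Set.range fun j => mk (fun i => g i j) (hg j))) (bdd U K N) := by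
  induction s with
  | zero =>
    refine ⟨N, fun i => X, fun i j => isHomogeneous_X _ j, Eventually.of_forall fun i => ?_,
      finite_adjoin_sub_top _⟩
    have := (flatFam_X (k := K i) (σ := Fin (N i))).reindex (Equiv.sumEmpty (Fin (N i)) (Fin 0))
    convert this using 1
    funext t
    rcases t with t | t
    · rfl
    · exact t.elim0
  | succ s ih =>
    obtain ⟨M, ℓ, hℓ, hflat, hfin⟩ := ih (fun i j => g i j.castSucc) (fun j => hg j.castSucc)
      (hinj.comp (Fin.castSucc_injective s)) (fun j => hE j.castSucc)
    set t : Set (bdd U K N) :=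
      Set.range fun j : Fin s => mk (fun i => g i j.castSucc) (hg j.castSucc) with ht
    set gg : bdd U K N := mk (fun i => g i (Fin.last s)) (hg (Fin.last s)) with hgg
    have hins : insert gg t = Set.range fun j => mk (fun i => g i j) (hg j) := by
      ext x
      simp only [ht, hgg, Set.mem_insert_iff, Set.mem_range]
      constructor
      · rintro (rfl | ⟨j, rfl⟩)
        exacts [⟨_, rfl⟩, ⟨_, rfl⟩]
      · rintro ⟨j, rfl⟩
        induction j using Fin.lastCases with
        | last => exact Or.inl rfl
        | cast j => exact Or.inr ⟨j, rfl⟩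
    have htE : t ⊆ E := by
      rintro _ ⟨j, rfl⟩
      exact hE _
    obtain ⟨hprime, hnot⟩ := isPrime_span_of_algebraicIndependent hind htop htE
    have hgt : gg ∉ Ideal.span t := hnot gg (hE _) (by
      rintro ⟨j, hj⟩
      exact (Fin.castSucc_lt_last j).ne (hinj hj))
    have hP : ∀ b ∈ insert gg t, ∃ n, 0 < n ∧ (grading U K N).IsHom n b := by
      rintro b (rfl | hb)
      exacts [hpos _ (hE _), hpos _ (htE hb)]
    obtain ⟨_, ⟨f, hf, rfl, hfr⟩, D, hD, hfD, hf0, hfspan⟩ :=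
      PolyGrading.exists_homogeneous_mem_span_insert (grading U K N)
        (homog_sub fun i => homogeneousComponent_mem_range (hℓ i)) hfin hprime hgt hP
    rw [isHom_mk_iff] at hfD
    rw [Ne, mk_eq_zero, ← Ultrafilter.eventually_not] at hf0
    have hstep : ∀ i, ∃ (M' : ℕ) (ℓ' : Fin M' → MvPolynomial (Fin (N i)) (K i))
        (z : MvPolynomial (Fin (N i)) (K i)) (c : K i) (a : ℕ → MvPolynomial (Fin (N i)) (K i)),
        (∀ j, (ℓ' j).IsHomogeneous 1) ∧ z.IsHomogeneous 1 ∧ c ≠ 0 ∧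
        (∀ j, a j ∈ (aeval (R := K i) ℓ').range) ∧ (∀ j, (a j).IsHomogeneous (D - j)) ∧
        ((f i).IsHomogeneous D ∧ f i ≠ 0 →
          (∀ n, ∀ p ∈ (aeval (R := K i) (ℓ i)).range, p.IsHomogeneous n →
            ∃ a : ℕ → MvPolynomial (Fin (N i)) (K i), (∀ j, a j ∈ (aeval (R := K i) ℓ').range) ∧
              (∀ j ≤ n, (a j).IsHomogeneous (n - j)) ∧
              p = ∑ j ∈ Finset.range (n + 1), z ^ j * a j) ∧
          f i = C c * z ^ D + ∑ j ∈ Finset.range D, z ^ j * a j ∧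
          ∀ (τ : Type) (v : τ → MvPolynomial (Fin (N i)) (K i)),
            FlatFam (k := K i) (Sum.elim (ℓ i) v) →
            FlatFam (k := K i) (fun o : Option (Fin M' ⊕ τ) => o.elim z (Sum.elim ℓ' v))) := by
      intro i
      by_cases hi : (f i).IsHomogeneous D ∧ f i ≠ 0
      · obtain ⟨M', ℓ', z, h1, h2, h3, ⟨c, hc, a, ha, haD, hfa⟩, h4⟩ :=
          exists_linear_change (hℓ i) hD (hfr i) hi.1 hi.2
        refine ⟨M', ℓ', z, c, fun j => if j < D then a j else 0, h1, h2, hc, fun j => ?_,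
          fun j => ?_, fun _ => ⟨h3, ?_, h4⟩⟩
        · dsimp only
          split_ifs
          exacts [ha j, zero_mem _]
        · dsimp only
          split_ifs with hj
          exacts [haD j hj, isHomogeneous_zero _ _ _]
        · rw [hfa]
          refine congrArg _ (Finset.sum_congr rfl fun j hj => ?_)
          dsimp only
          rw [if_pos (Finset.mem_range.1 hj)]
      · exact ⟨0, Fin.elim0, 0, 1, 0, fun j => j.elim0, isHomogeneous_zero _ _ _, one_ne_zero,
          fun j => zero_mem _, fun j => isHomogeneous_zero _ _ _, fun h => absurd h hi⟩
    choose M' ℓ' z c a hℓ' hz hc ha haD hgood using hstep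
    have hev : ∀ᶠ i in U, (f i).IsHomogeneous D ∧ f i ≠ 0 := hfD.and hf0
    have hzb := isHom_bdd hz
    have hab : ∀ k, ∃ B : ℕ, ∀ i, (a i k).totalDegree ≤ B := fun k => isHom_bdd fun i => haD i k
    have hsub : (sub U fun i => (aeval (R := K i) (ℓ i)).range) ≤ Algebra.adjoin (UProd U K)
        (insert (mk z hzb)
          (sub U fun i => (aeval (R := K i) (ℓ' i)).range : Set (bdd U K N))) := by
      refine sub_le_adjoin (fun i => homogeneousComponent_mem_range (hℓ i)) hzb ?_
      filter_upwards [hev] with i hi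
      exact (hgood i hi).1
    have hc0 : UProd.mk U c ≠ 0 := UProd.mk_ne_zero.2 (Eventually.of_forall hc)
    have hmem : algebraMap (UProd U K) (bdd U K N) (UProd.mk U c) * mk z hzb ^ D +
        ∑ k ∈ Finset.range D, mk z hzb ^ k * mk (fun i => a i k) (hab k) ∈
          Ideal.span (insert gg t) := by
      convert hfspan using 1
      refine Subtype.ext ?_
      have : ((algebraMap (UProd U K) (bdd U K N) (UProd.mk U c) * mk z hzb ^ D : bdd U K N) :
        UProd U fun i => MvPolynomial (Fin (N i)) (K i)) =
          UProd.mk U fun i => C (c i) * z i ^ D := by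
        change _ = UProd.mk U ((fun i => C (c i)) * z ^ D)
        rw [map_mul, map_pow]
        rfl
      rw [AddMemClass.coe_add, this, sum_pow_mul_mk D hzb (a := fun k i => a i k), ← map_add,
        coe_mk, UProd.mk_eq_mk]
      filter_upwards [hev] with i hi
      exact (hgood i hi).2.1.symm
    have hfin' := PolyGrading.finite_adjoin_insert (grading U K N)
      (homog_sub fun i => homogeneousComponent_mem_range (hℓ' i)) hsub hfin hP hc0
      (fun k => mk (fun i => a i k) (hab k)) (fun k _ => mk_mem_sub _ fun i => ha i k)
      (fun k hk => ⟨D - k, Nat.sub_pos_of_lt hk,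
        isHom_mk_iff.2 (Eventually.of_forall fun i => haD i k)⟩) hmem
    rw [hins] at hfin'
    refine ⟨M', ℓ', hℓ', ?_, hfin'⟩
    have hmon := eventually_monic_relation
      (A := fun i => (aeval (R := K i) (fun o : Option (Fin (M' i) ⊕ Fin s) =>
        o.elim (g i (Fin.last s)) (Sum.elim (ℓ' i) fun j => g i j.castSucc))).range)
      hfin' ?_ z hzb
    · filter_upwards [hev, hflat, hmon] with i h1 h2 h3
      obtain ⟨n, b, hb, hrel⟩ := h3
      have h4 := ((hgood i h1).2.2 (Fin s) _ h2).exchange ⟨n, b, hb, hrel⟩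
      have h5 := h4.reindex (sumFinSuccEquiv (Fin (M' i)) s)
      convert h5 using 1
      funext x
      rcases x with x | j
      · rfl
      · induction j using Fin.lastCases <;> simp [sumFinSuccEquiv]
    · rw [Algebra.adjoin_le_iff]
      rintro x (⟨f, hf, rfl, hfA⟩ | ⟨j, rfl⟩)
      · refine mk_mem_sub _ fun i => ?_
        obtain ⟨q, hq⟩ := (AlgHom.mem_range _).1 (hfA i)
        refine (AlgHom.mem_range _).2 ⟨rename (fun j => some (Sum.inl j)) q, ?_⟩
        rw [aeval_rename, ← hq]
        rfl
      · refine mk_mem_sub _ fun i => (AlgHom.mem_range _).2 ?_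
        induction j using Fin.lastCases with
        | last => exact ⟨X none, by simp⟩
        | cast j => exact ⟨X (some (Sum.inr j)), by simp⟩

end bdd

end SmallSubalgebra

namespace SmallSubalgebra

open MvPolynomial Filter

namespace bdd

variable {U : Ultrafilter ℕ} {K : ℕ → Type u} [∀ i, Field (K i)] {N : ℕ → ℕ}

/-- Finitely many polynomials of bounded degree lie, up to passing to the ultraproduct, in a
subalgebra generated by finitely many polynomials of bounded degree over which the polynomial rings
are flat. -/
theorem exists_flatFam [∀ i, IsAlgClosed (K i)] {ι : Type*} [Fintype ι] {d : ℕ}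
    (f : ∀ i, ι → MvPolynomial (Fin (N i)) (K i)) (hf : ∀ i a, (f i a).totalDegree ≤ d) :
    ∃ (s : ℕ) (g : ∀ i, Fin s → MvPolynomial (Fin (N i)) (K i))
      (hg : ∀ j, ∃ B : ℕ, ∀ i, (g i j).totalDegree ≤ B),
      (∀ᶠ i in U, FlatFam (k := K i) (g i)) ∧ ∀ a, mk (fun i => f i a) ⟨d, fun i => hf i a⟩ ∈
        Algebra.adjoin (UProd U K)
            (Set.range fun j => (mk (fun i => g i j) (hg j) : bdd U K N)) := by
  obtain ⟨q, hq⟩ := ExpChar.exists (UProd U K)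
  obtain ⟨E, hpos, htop, hind⟩ := (motions U K N q).exists_coordinates
  have hfin : ∀ x : bdd U K N, ∃ t : Finset (bdd U K N), (t : Set _) ⊆ E ∧
      x ∈ Algebra.adjoin (UProd U K) (t : Set (bdd U K N)) := fun x =>
    exists_finset_of_mem_adjoin (by rw [htop]; exact Algebra.mem_top)
  choose t htE ht using hfin
  classical
  have hfb : ∀ a, ∃ B : ℕ, ∀ i, (f i a).totalDegree ≤ B := fun a => ⟨d, fun i => hf i a⟩
  let F : Finset (bdd U K N) := Finset.univ.biUnion fun a => t (mk (fun i => f i a) (hfb a))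
  have hFE : (F : Set (bdd U K N)) ⊆ E := by
    intro x hx
    obtain ⟨a, -, ha⟩ := Finset.mem_biUnion.1 hx
    exact htE _ ha
  let ε : Fin F.card → bdd U K N := fun j => (F.equivFin.symm j : bdd U K N)
  have hε : ∀ j, ∃ g hg, ε j = mk (U := U) (K := K) (N := N) g hg := fun j => exists_mk _
  choose g hg hεg using hε
  have hrange : Set.range (fun j => (mk (g j) (hg j) : bdd U K N)) = F := by
    ext x
    simp only [Set.mem_range, ← hεg, ε]
    constructor
    · rintro ⟨j, rfl⟩
      exact (F.equivFin.symm j).2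
    · intro hx
      exact ⟨F.equivFin ⟨x, hx⟩, by simp⟩
  have hinj : Function.Injective fun j => (mk (g j) (hg j) : bdd U K N) := by
    intro j j' h
    simp only [← hεg, ε] at h
    exact F.equivFin.symm.injective (Subtype.ext h)
  obtain ⟨M, ℓ, -, hflat, -⟩ := exists_linear_forms hpos htop hind F.card (fun i j => g j i) hg
    hinj fun j => hFE (hrange ▸ Set.mem_range_self j)
  refine ⟨F.card, fun i j => g j i, hg, hflat.mono fun i h => h.of_sumElim, fun a => ?_⟩
  rw [hrange]
  exact Algebra.adjoin_mono (Finset.coe_subset.2 (Finset.subset_biUnion_of_mem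
    (fun a => t (mk (fun i => f i a) (hfb a))) (Finset.mem_univ a))) (ht _)

end bdd

end SmallSubalgebra

namespace SmallSubalgebra

section

open MvPolynomial

variable {k : Type*} [Field k]

/-- Up to a unit, a nonzero polynomial becomes monic in the first variable after a shear. -/
theorem exists_shear_monic [Infinite k] {M : ℕ} {p : MvPolynomial (Fin (M + 1)) k} (hp : p ≠ 0) :
    ∃ w : Fin M → k, ∃ a : k, a ≠ 0 ∧
      (finSuccEquiv k M (shearHom w (C a * p))).Monic := by
  have h0 : homogeneousComponent p.totalDegree p ≠ 0 := by
    intro h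
    obtain ⟨s, hs, hsd⟩ : ∃ s ∈ p.support, s.degree = p.totalDegree := by
      obtain ⟨s, hs, h⟩ := Finset.exists_mem_eq_sup p.support (support_nonempty.2 hp)
        (fun s => s.sum fun _ e => e)
      exact ⟨s, hs, h.symm⟩
    have := coeff_homogeneousComponent p.totalDegree p s
    rw [if_pos hsd, h, coeff_zero] at this
    exact mem_support_iff.1 hs this.symm
  obtain ⟨w, hw⟩ := exists_eval_cons_one_ne_zero
    (homogeneousComponent_isHomogeneous p.totalDegree p) h0
  refine ⟨w, (eval (Fin.cons 1 w : Fin (M + 1) → k) (homogeneousComponent p.totalDegree p))⁻¹,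
    inv_ne_zero hw, Polynomial.monic_of_natDegree_le_of_coeff_eq_one p.totalDegree ?_ ?_⟩
  · have : shearHom w p = ∑ i ∈ Finset.range (p.totalDegree + 1),
        shearHom w (homogeneousComponent i p) := by
      rw [← map_sum, sum_homogeneousComponent]
    rw [natDegree_finSuccEquiv, map_mul, shearHom, algHom_C, ← shearHom, this]
    refine (degreeOf_le_totalDegree _ _).trans ?_
    rw [algebraMap_eq, ← smul_eq_C_mul]
    refine (totalDegree_smul_le _ _).trans (totalDegree_finsetSum_le fun i hi => ?_)
    exact (isHomogeneous_shearHom w (homogeneousComponent_isHomogeneous i p)).totalDegree_le.trans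
      (Nat.lt_succ_iff.1 (Finset.mem_range.1 hi))
  · have : shearHom w p = ∑ i ∈ Finset.range (p.totalDegree + 1),
        shearHom w (homogeneousComponent i p) := by
      rw [← map_sum, sum_homogeneousComponent]
    rw [map_mul, shearHom, algHom_C, ← shearHom, this, algebraMap_eq, ← smul_eq_C_mul, map_smul,
      Polynomial.coeff_smul, map_sum, Polynomial.finsetSum_coeff, Finset.sum_range_succ,
      coeff_finSuccEquiv_shearHom _ (homogeneousComponent_isHomogeneous _ p), Finset.sum_eq_zero]
    · rw [zero_add, smul_eq_C_mul, ← map_mul, inv_mul_cancel₀ hw, map_one]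
    · intro i hi
      refine Polynomial.coeff_eq_zero_of_natDegree_lt ?_
      rw [natDegree_finSuccEquiv]
      exact ((degreeOf_le_totalDegree _ _).trans
        (isHomogeneous_shearHom w (homogeneousComponent_isHomogeneous i p)).totalDegree_le).trans_lt
        (Finset.mem_range.1 hi)

theorem shearHom_shearHom_neg {M : ℕ} (w : Fin M → k) (p : MvPolynomial (Fin (M + 1)) k) :
    shearHom w (shearHom (-w) p) = p := by
  have : (shearHom w).comp (shearHom (-w)) = AlgHom.id k _ := by
    ext1 j
    cases j using Fin.cases <;> simp [shearHom]
  exact DFunLike.congr_fun this p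

end

end SmallSubalgebra

namespace SmallSubalgebra

open Polynomial

theorem eq_sum_range_of_degree_lt {R : Type*} [CommRing R] {p : R[X]} {D : ℕ}
    (h : p.degree < D) : p = ∑ j ∈ Finset.range D, C (p.coeff j) * X ^ j := by
  ext n
  simp only [finsetSum_coeff, coeff_C_mul_X_pow, Finset.sum_ite_eq, Finset.mem_range]
  split_ifs with hn
  · rfl
  · exact coeff_eq_zero_of_degree_lt (h.trans_le (Nat.cast_le.2 (not_lt.1 hn)))

theorem degree_sum_range_lt {R : Type*} [CommRing R] (f : ℕ → R) (D : ℕ) :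
    (∑ j ∈ Finset.range D, C (f j) * X ^ j).degree < (D : WithBot ℕ) := by
  rw [degree_lt_iff_coeff_zero]
  intro m hm
  simp only [finsetSum_coeff, coeff_C_mul_X_pow, Finset.sum_ite_eq, Finset.mem_range]
  rw [if_neg (not_lt.2 hm)]

namespace UProd

variable {U : Ultrafilter ℕ} {R : ℕ → Type*} [∀ i, CommRing (R i)]

/-- The map from polynomials over an ultraproduct to the ultraproduct of polynomial rings. -/
noncomputable def ofPoly (U : Ultrafilter ℕ) (R : ℕ → Type*) [∀ i, CommRing (R i)] :
    (UProd U R)[X] →+* UProd U fun i => (R i)[X] :=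
  eval₂RingHom (map U fun _ => C) (mk U fun _ => X)

theorem ofPoly_sum (f : ℕ → ∀ i, R i) (D : ℕ) :
    ofPoly U R (∑ j ∈ Finset.range D, C (mk U (f j)) * X ^ j) =
      mk U fun i => ∑ j ∈ Finset.range D, C (f j i) * X ^ j := by
  have : (fun i => ∑ j ∈ Finset.range D, C (f j i) * X ^ j) =
      ∑ j ∈ Finset.range D, (fun i => C (f j i)) * (fun i => (X : (R i)[X])) ^ j := by
    funext i
    simp [Finset.sum_apply]
  rw [this, map_sum, map_sum]
  refine Finset.sum_congr rfl fun j _ => ?_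
  rw [map_mul, map_mul, map_pow, map_pow]
  simp [ofPoly, map_mk]

theorem exists_lift {p : (UProd U R)[X]} {D : ℕ} (h : p.degree < D) :
    ∃ f : ∀ i, (R i)[X], (∀ i, (f i).degree < (D : WithBot ℕ)) ∧ ofPoly U R p = mk U f := by
  choose f hf using fun j => mk_surjective (U := U) (p.coeff j)
  refine ⟨fun i => ∑ j ∈ Finset.range D, C (f j i) * X ^ j,
    fun i => degree_sum_range_lt (fun j => f j i) D, ?_⟩
  rw [← ofPoly_sum, eq_sum_range_of_degree_lt h]
  simp only [hf]

theorem exists_preimage {f : ∀ i, (R i)[X]} {D : ℕ} (h : ∀ i, (f i).degree < D) :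
    ∃ p : (UProd U R)[X], p.degree < (D : WithBot ℕ) ∧ ofPoly U R p = mk U f := by
  refine ⟨_, degree_sum_range_lt (fun j => mk U fun i => (f i).coeff j) D, ?_⟩
  rw [ofPoly_sum]
  exact congrArg _ (funext fun i => (eq_sum_range_of_degree_lt (h i)).symm)

theorem ofPoly_injective : Function.Injective (ofPoly U R) := by
  rw [injective_iff_map_eq_zero]
  intro p hp
  have h : p.degree < (p.natDegree + 1 : ℕ) :=
    degree_le_natDegree.trans_lt (Nat.cast_lt.2 (Nat.lt_succ_self _))
  choose f hf using fun j => mk_surjective (U := U) (p.coeff j)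
  rw [eq_sum_range_of_degree_lt h]
  rw [eq_sum_range_of_degree_lt h] at hp
  simp only [← hf] at hp ⊢
  rw [ofPoly_sum, mk_eq_zero] at hp
  refine Finset.sum_eq_zero fun j hj => ?_
  rw [mk_eq_zero.2, C_0, zero_mul]
  filter_upwards [hp] with i hi
  have := congrArg (coeff · j) hi
  simpa only [finsetSum_coeff, coeff_C_mul_X_pow, Finset.sum_ite_eq, if_pos hj,
      coeff_zero] using this

theorem exists_monic_lift [∀ i, Nontrivial (R i)] {F : (UProd U R)[X]} (hF : F.Monic) :
    ∃ f : ∀ i, (R i)[X], (∀ i, (f i).Monic ∧ (f i).degree = F.natDegree) ∧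
      ofPoly U R F = mk U f := by
  have h : (F - X ^ F.natDegree).degree < (F.natDegree : WithBot ℕ) := by
    rw [← degree_eq_natDegree hF.ne_zero]
    refine degree_sub_lt_left ?_ hF.ne_zero ?_
    · rw [degree_X_pow, degree_eq_natDegree hF.ne_zero]
    · rw [hF.leadingCoeff, leadingCoeff_X_pow]
  obtain ⟨f, hf, hff⟩ := exists_lift h
  refine ⟨fun i => X ^ F.natDegree + f i, fun i => ⟨monic_X_pow_add (hf i), ?_⟩, ?_⟩
  · rw [degree_add_eq_left_of_degree_lt (by rw [degree_X_pow]; exact hf i), degree_X_pow]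
  · have : ofPoly U R (X ^ F.natDegree) = mk U fun i => (X : (R i)[X]) ^ F.natDegree := by
      rw [map_pow]
      simp only [ofPoly, coe_eval₂RingHom, eval₂_X, ← map_pow]
      rfl
    rw [← add_sub_cancel (X ^ F.natDegree) F, map_add, hff, this, ← map_add]
    simp
    rfl

theorem exists_division [∀ i, Nontrivial (R i)] {F : (UProd U R)[X]} (hF : F.Monic)
    (t : UProd U fun i => (R i)[X]) : ∃ q r, t = ofPoly U R F * q + ofPoly U R r := by
  obtain ⟨f, hf, hff⟩ := exists_monic_lift hF
  obtain ⟨t, rfl⟩ := mk_surjective t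
  obtain ⟨r, -, hr⟩ := exists_preimage (U := U) (f := fun i => t i %ₘ f i) (D := F.natDegree)
    fun i => (hf i).2 ▸ degree_modByMonic_lt _ (hf i).1
  refine ⟨mk U fun i => t i /ₘ f i, r, ?_⟩
  rw [hr, hff, ← map_mul, ← map_add]
  exact congrArg _ (funext fun i => by
    rw [Pi.add_apply, Pi.mul_apply, add_comm, modByMonic_add_div])

theorem exists_of_ofPoly_mul_eq [∀ i, Nontrivial (R i)] {F p : (UProd U R)[X]} (hF : F.Monic)
    {q : UProd U fun i => (R i)[X]} (h : ofPoly U R F * q = ofPoly U R p) :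
    ∃ q', ofPoly U R q' = q ∧ F * q' = p := by
  have hd : (p %ₘ F).degree < (F.natDegree : WithBot ℕ) := by
    rw [← degree_eq_natDegree hF.ne_zero]
    exact degree_modByMonic_lt _ hF
  obtain ⟨f, hf, hff⟩ := exists_monic_lift hF
  obtain ⟨r, hr, hrr⟩ := exists_lift hd
  obtain ⟨z, hz⟩ := mk_surjective (q - ofPoly U R (p /ₘ F))
  have h1 : mk U f * mk U z = mk U r := by
    rw [← hff, hz, mul_sub, h, ← map_mul, ← map_sub, ← hrr, modByMonic_eq_sub_mul_div]
  have h2 : ∀ᶠ i in U, z i = 0 := by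
    rw [← map_mul, mk_eq_mk] at h1
    filter_upwards [h1] with i hi
    by_contra hzi
    have : (f i * z i).degree < (f i).degree := by
      rw [← Pi.mul_apply, hi, (hf i).2]
      exact hr i
    rw [(hf i).1.degree_mul_comm, (hf i).1.degree_mul] at this
    exact absurd this (not_lt.2 (le_add_of_nonneg_left (zero_le_degree_iff.2 hzi)))
  have h3 : p %ₘ F = 0 := by
    apply ofPoly_injective (U := U)
    rw [hrr, ← h1, mk_eq_zero.2 h2, mul_zero, map_zero]
  refine ⟨p /ₘ F, (sub_eq_zero.1 ?_).symm, ?_⟩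
  · rw [← hz, mk_eq_zero.2 h2]
  · rw [← zero_add (F * _), ← h3, modByMonic_add_div]

end UProd

end SmallSubalgebra

namespace SmallSubalgebra

/-- Relations over `T` with a coefficient `c i₀` by which one can divide with remainder in `B'`
are trivialised as soon as `B'` is flat. -/
theorem exists_trivial_of_division {B B' T ι : Type*} [CommRing B] [CommRing B'] [CommRing T]
    [Fintype ι] {θ : B →+* B'} (hθ : θ.Flat) (ψ : B' →+* T) (c : ι → B) (i₀ : ι)
    (hdiv : ∀ t, ∃ q r, t = ψ (θ (c i₀)) * q + ψ r)
    (huniq : ∀ p q, ψ (θ (c i₀)) * q = ψ p → ∃ q', ψ q' = q ∧ θ (c i₀) * q' = p)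
    (u : ι → T) (hu : ∑ i, ψ (θ (c i)) * u i = 0) :
    ∃ m, ∃ (b : ι → Fin m → B) (y : Fin m → T),
      (∀ i, u i = ∑ j, ψ (θ (b i j)) * y j) ∧ ∀ j, ∑ i, c i * b i j = 0 := by
  classical
  choose q r hqr using fun i => hdiv (u i)
  obtain ⟨p, hp, hp'⟩ := huniq (-∑ i, θ (c i) * r i) (∑ i, ψ (θ (c i)) * q i) (by
    rw [map_neg, map_sum, ← add_eq_zero_iff_eq_neg, ← hu, Finset.mul_sum, ← Finset.sum_add_distrib]
    refine Finset.sum_congr rfl fun i _ => ?_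
    rw [hqr i, map_mul]
    ring)
  obtain ⟨m, b, y, hb, hc⟩ := exists_trivial_of_flat hθ c
      (fun i => r i + if i = i₀ then p else 0) (by
    simp only [mul_add, mul_ite, mul_zero, Finset.sum_add_distrib, Finset.sum_ite_eq',
      Finset.mem_univ, if_true, hp', add_neg_cancel])
  let b' : ι → Fin m ⊕ ι → B := fun i => Sum.elim (b i) fun k =>
    (if i = k then c i₀ else 0) - if i = i₀ then c k else 0
  let y' : Fin m ⊕ ι → T := Sum.elim (ψ ∘ y) q
  have h1 : ∀ i, u i = ∑ j, ψ (θ (b' i j)) * y' j := by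
    intro i
    have h2 : ∑ j, ψ (θ (b i j)) * ψ (y j) = ψ (r i) + if i = i₀ then ψ p else 0 := by
      simp only [← map_mul, ← map_sum, ← hb, map_add]
      split_ifs <;> simp
    have h3 : ∑ k, ψ (θ ((if i = k then c i₀ else 0) - if i = i₀ then c k else 0)) * q k =
        ψ (θ (c i₀)) * q i - if i = i₀ then ∑ k, ψ (θ (c k)) * q k else 0 := by
      simp only [map_sub, sub_mul, Finset.sum_sub_distrib]
      congr 1
      · simp [apply_ite θ, apply_ite ψ]
      · split_ifs <;> simp
    rw [Fintype.sum_sum_type]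
    simp only [b', y', Sum.elim_inl, Sum.elim_inr, Function.comp_apply, h2, h3, ← hp]
    rw [hqr i]
    ring
  have h4 : ∀ j, ∑ i, c i * b' i j = 0 := by
    rintro (j | k)
    · exact hc j
    · simp [b', mul_sub, Finset.sum_sub_distrib, mul_comm]
  let e := Fintype.equivFin (Fin m ⊕ ι)
  refine ⟨_, fun i j => b' i (e.symm j), fun j => y' (e.symm j), fun i => ?_, fun j => h4 _⟩
  rw [h1, ← e.symm.sum_comp]

open MvPolynomial Filter

namespace UProd

variable {U : Ultrafilter ℕ}

/-- An isomorphism of factors induces an isomorphism of ultraproducts. -/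
noncomputable def mapEquiv {R R' : ℕ → Type*} [∀ i, CommRing (R i)] [∀ i, CommRing (R' i)]
    (U : Ultrafilter ℕ) (e : ∀ i, R i ≃+* R' i) : UProd U R ≃+* UProd U R' :=
  RingEquiv.ofRingHom (map U fun i => (e i).toRingHom) (map U fun i => (e i).symm.toRingHom)
    (RingHom.ext fun x => by
      obtain ⟨f, rfl⟩ := mk_surjective x
      simp [map_mk])
    (RingHom.ext fun x => by
      obtain ⟨f, rfl⟩ := mk_surjective x
      simp [map_mk])

theorem mapEquiv_mk {R R' : ℕ → Type*} [∀ i, CommRing (R i)] [∀ i, CommRing (R' i)]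
    (e : ∀ i, R i ≃+* R' i) (f : ∀ i, R i) : mapEquiv U e (mk U f) = mk U fun i => e i (f i) := rfl

variable (U) (K : ℕ → Type u) [∀ i, Field (K i)]

/-- The comparison map from polynomials over an ultraproduct of fields to the ultraproduct of the
polynomial rings. -/
noncomputable def ofMvPoly (s : ℕ) :
    MvPolynomial (Fin s) (UProd U K) →+* UProd U fun i => MvPolynomial (Fin s) (K i) :=
  (aeval (R := UProd U K) fun j => mk U fun i => (X j : MvPolynomial (Fin s) (K i))).toRingHom

variable {U K}

theorem ofMvPoly_C {s : ℕ} (a : ∀ i, K i) :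
    ofMvPoly U K s (C (mk U a)) = mk U fun i => C (a i) := by
  simp [ofMvPoly, algebraMap_mk, algebraMap_eq]

theorem ofMvPoly_X {s : ℕ} (j : Fin s) : ofMvPoly U K s (X j) = mk U fun _ => X j := by
  simp [ofMvPoly]

theorem ofMvPoly_finSuccEquiv_symm (s : ℕ) (p : Polynomial (MvPolynomial (Fin s) (UProd U K))) :
    ofMvPoly U K (s + 1) ((MvPolynomial.finSuccEquiv (UProd U K) s).symm p) =
      mapEquiv U (fun i => (MvPolynomial.finSuccEquiv (K i) s).symm.toRingEquiv)
        (ofPoly U _ (Polynomial.mapRingHom (ofMvPoly U K s) p)) := by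
  obtain ⟨p, rfl⟩ := (MvPolynomial.finSuccEquiv (UProd U K) s).surjective p
  rw [AlgEquiv.symm_apply_apply, ← RingEquiv.symm_apply_eq]
  have : (mapEquiv U
      (fun i => (MvPolynomial.finSuccEquiv (K i) s).symm.toRingEquiv)).symm.toRingHom.comp
      (ofMvPoly U K (s + 1)) = ((ofPoly U _).comp (Polynomial.mapRingHom (ofMvPoly U K s))).comp
        (MvPolynomial.finSuccEquiv (UProd U K) s).toAlgHom.toRingHom := by
    refine MvPolynomial.ringHom_ext (fun a => ?_) fun j => ?_
    · obtain ⟨a, rfl⟩ := mk_surjective a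
      have h1 : finSuccEquiv (UProd U K) s (C (mk U a)) = Polynomial.C (C (mk U a)) := by
        simp [finSuccEquiv_apply]
      have h0 : (finSuccEquiv (UProd U K) s).toAlgHom.toRingHom (C (mk U a)) =
        Polynomial.C (C (mk U a)) := h1
      simp only [RingHom.comp_apply, h0, RingEquiv.toRingHom_eq_coe, RingHom.coe_coe,
        Polynomial.coe_mapRingHom, Polynomial.map_C, ofMvPoly_C, ofPoly,
        Polynomial.coe_eval₂RingHom, Polynomial.eval₂_C, map_mk]
      rw [RingEquiv.symm_apply_eq, mapEquiv_mk]
      exact congrArg _ (funext fun i => by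
        simp [AlgEquiv.eq_symm_apply, finSuccEquiv_apply])
    · have h0 : (finSuccEquiv (UProd U K) s).toAlgHom.toRingHom (X j) =
        finSuccEquiv (UProd U K) s (X j) := rfl
      simp only [RingHom.comp_apply, h0, RingEquiv.toRingHom_eq_coe, RingHom.coe_coe]
      rw [RingEquiv.symm_apply_eq, ofMvPoly_X]
      cases j using Fin.cases
      · rw [finSuccEquiv_X_zero, Polynomial.coe_mapRingHom, Polynomial.map_X, ofPoly,
          Polynomial.coe_eval₂RingHom, Polynomial.eval₂_X, mapEquiv_mk]
        exact congrArg _ (funext fun i => by simp [AlgEquiv.eq_symm_apply, finSuccEquiv_X_zero])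
      · rw [finSuccEquiv_X_succ, Polynomial.coe_mapRingHom, Polynomial.map_C, ofPoly, ofMvPoly_X,
          Polynomial.coe_eval₂RingHom, Polynomial.eval₂_C, map_mk, mapEquiv_mk]
        exact congrArg _ (funext fun i => by simp [AlgEquiv.eq_symm_apply, finSuccEquiv_X_succ])
  exact RingHom.congr_fun this p

theorem ofMvPoly_shearHom {s : ℕ} (w : Fin s → ∀ i, K i)
    (p : MvPolynomial (Fin (s + 1)) (UProd U K)) :
    ofMvPoly U K (s + 1) (shearHom (fun j => mk U (w j)) p) =
      map U (fun i => (shearHom fun j => w j i).toRingHom) (ofMvPoly U K (s + 1) p) := by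
  have : (ofMvPoly U K (s + 1)).comp (shearHom fun j => mk U (w j)).toRingHom =
      (map U (fun i => (shearHom fun j => w j i).toRingHom)).comp (ofMvPoly U K (s + 1)) := by
    refine MvPolynomial.ringHom_ext (fun a => ?_) fun j => ?_
    · obtain ⟨a, rfl⟩ := mk_surjective a
      have h1 : (shearHom fun j => mk U (w j)).toRingHom (C (mk U a)) = C (mk U a) := by
        simp [shearHom, algebraMap_eq]
      rw [RingHom.comp_apply, RingHom.comp_apply, h1, ofMvPoly_C, map_mk]
      exact congrArg _ (funext fun i => by simp [shearHom, algebraMap_eq])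
    · rw [RingHom.comp_apply, RingHom.comp_apply, ofMvPoly_X, map_mk]
      cases j using Fin.cases
      · have h1 : (shearHom fun j => mk U (w j)).toRingHom (X 0) = X 0 := by simp [shearHom]
        rw [h1, ofMvPoly_X]
        exact congrArg _ (funext fun i => by simp [shearHom])
      · rename_i j
        have h1 : (shearHom fun j => mk U (w j)).toRingHom (X j.succ) =
            X j.succ + C (mk U (w j)) * X 0 := by simp [shearHom]
        rw [h1, map_add, map_mul, ofMvPoly_X, ofMvPoly_X, ofMvPoly_C, ← map_mul, ← map_add]
        exact congrArg _ (funext fun i => by simp [shearHom])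
  exact RingHom.congr_fun this p

theorem flat_ofMvPoly [Infinite (UProd U K)] (s : ℕ) : (ofMvPoly U K s).Flat := by
  induction s with
  | zero =>
    refine flat_of_exists_trivial fun l c u h => ?_
    by_cases hc : ∀ i, c i = 0
    · refine ⟨l, fun i j => if i = j then 1 else 0, u, fun i => ?_, fun j => ?_⟩
      · simp [apply_ite (ofMvPoly U K 0)]
      · simp [hc]
    · push Not at hc
      obtain ⟨i₀, hi₀⟩ := hc
      obtain ⟨a, ha⟩ : ∃ a, c i₀ = C a := ⟨_, eq_C_of_isEmpty _⟩
      have ha0 : a ≠ 0 := fun h => hi₀ (by rw [ha, h, map_zero])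
      have hinv : c i₀ * C a⁻¹ = 1 := by rw [ha, ← map_mul, mul_inv_cancel₀ ha0, map_one]
      have hinv' : ofMvPoly U K 0 (c i₀) * ofMvPoly U K 0 (C a⁻¹) = 1 := by
        rw [← map_mul, hinv, map_one]
      refine exists_trivial_of_division (RingHom.Flat.id _) (ofMvPoly U K 0) c i₀ (fun t => ?_)
        (fun p q hpq => ?_) u h
      · refine ⟨ofMvPoly U K 0 (C a⁻¹) * t, 0, ?_⟩
        rw [RingHom.id_apply, ← mul_assoc, hinv', one_mul, map_zero, add_zero]
      · refine ⟨C a⁻¹ * p, ?_, ?_⟩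
        · rw [map_mul, ← hpq, RingHom.id_apply, ← mul_assoc, mul_comm (ofMvPoly U K 0 (C a⁻¹)),
            hinv', one_mul]
        · rw [RingHom.id_apply, ← mul_assoc, hinv, one_mul]
  | succ s ih =>
    have hθ := flat_mapRingHom ih
    refine flat_of_exists_trivial fun l c u h => ?_
    by_cases hc : ∀ i, c i = 0
    · refine ⟨l, fun i j => if i = j then 1 else 0, u, fun i => ?_, fun j => ?_⟩
      · simp [apply_ite (ofMvPoly U K (s + 1))]
      · simp [hc]
    · push Not at hc
      obtain ⟨i₀, hi₀⟩ := hc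
      obtain ⟨w₀, a, ha, hmon⟩ := exists_shear_monic hi₀
      choose w hw using fun j => mk_surjective (U := U) (w₀ j)
      obtain rfl : (fun j => mk U (w j)) = w₀ := funext hw
      let F := finSuccEquiv (UProd U K) s
      let e := mapEquiv U fun i => (finSuccEquiv (K i) s).symm.toRingEquiv
      let Φ := map U (fun i => (shearHom fun j => w j i).toRingHom)
      let Φ' := map U (fun i => (shearHom fun j => (-w) j i).toRingHom)
      have hΦ : ∀ t, Φ' (Φ t) = t := by
        intro t
        obtain ⟨t, rfl⟩ := mk_surjective t
        refine congrArg (mk U) (funext fun i => ?_)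
        have := shearHom_shearHom_neg (fun j => (-w) j i) (t i)
        simpa [Pi.neg_def] using this
      have hneg : (fun j => mk U ((-w) j)) = -fun j => mk U (w j) := funext fun j => map_neg _ _
      have he : ∀ p, (e.toRingHom.comp (ofPoly U _)) (Polynomial.mapRingHom (ofMvPoly U K s) p) =
          ofMvPoly U K (s + 1) (F.symm p) := fun p => (ofMvPoly_finSuccEquiv_symm s p).symm
      have hmon' := hmon.map (ofMvPoly U K s)
      obtain ⟨m, b, y, hb, hc⟩ := exists_trivial_of_division hθ (e.toRingHom.comp (ofPoly U _))
        (fun i => F (shearHom (fun j => mk U (w j)) (C a * c i))) i₀ (fun t => by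
          obtain ⟨q, r, h⟩ := exists_division hmon' (e.symm t)
          refine ⟨e q, r, ?_⟩
          rw [RingEquiv.symm_apply_eq, map_add, map_mul] at h
          exact h) (fun p q hpq => by
          obtain ⟨q', h1, h2⟩ := exists_of_ofPoly_mul_eq (q := e.symm q) (p := p) hmon' (by
            apply e.injective
            rw [map_mul, RingEquiv.apply_symm_apply]
            exact hpq)
          refine ⟨q', ?_, h2⟩
          rw [RingEquiv.eq_symm_apply] at h1
          exact h1) (fun i => Φ (u i)) (by
          simp only [he]
          simp only [F, AlgEquiv.symm_apply_apply, ofMvPoly_shearHom]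
          rw [show map U (fun i => (shearHom fun j => w j i).toRingHom) = Φ from rfl]
          simp only [map_mul, mul_assoc, ← Finset.mul_sum]
          simp only [← map_mul, ← map_sum, h, map_zero, mul_zero])
      refine ⟨m, fun i j => shearHom (-fun j => mk U (w j)) (F.symm (b i j)), fun j => Φ' (y j),
        fun i => ?_, fun j => ?_⟩
      · rw [← hΦ (u i), hb, map_sum]
        refine Finset.sum_congr rfl fun j _ => ?_
        rw [he, map_mul, ← hneg, ofMvPoly_shearHom]
      · have h1 := congrArg (fun p => shearHom (-fun j => mk U (w j)) (F.symm p)) (hc j)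
        simp only [map_sum, map_mul, map_zero, F, AlgEquiv.symm_apply_apply] at h1
        have h2 : ∀ p, shearHom (-fun j => mk U (w j)) (shearHom (fun j => mk U (w j)) p) = p := by
          intro p
          simpa using shearHom_shearHom_neg (-fun j => mk U (w j)) p
        simp only [h2, mul_assoc, ← Finset.mul_sum] at h1
        exact (mul_eq_zero.1 h1).resolve_left (by simpa using ha)

end UProd
end SmallSubalgebra

namespace SmallSubalgebra

/-- Over a flat extension, relations are combinations of generators of the syzygies. -/
theorem exists_of_flat_of_syzygies {R S ι κ : Type*} [CommRing R] [CommRing S] {f : R →+* S}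
    (hf : f.Flat) [Fintype ι] [Fintype κ] (c : ι → R) (v : κ → ι → R)
    (hv : ∀ b : ι → R, ∑ i, c i * b i = 0 → b ∈ Submodule.span R (Set.range v))
    (u : ι → S) (h : ∑ i, f (c i) * u i = 0) : ∃ z : κ → S, ∀ i, u i = ∑ l, f (v l i) * z l := by
  obtain ⟨m, b, y, hb, hc⟩ := exists_trivial_of_flat hf c u h
  choose w hw using fun j => (Submodule.mem_span_range_iff_exists_fun R).1
      (hv (fun i => b i j) (hc j))
  refine ⟨fun l => ∑ j, f (w j l) * y j, fun i => ?_⟩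
  have h1 : ∀ j, b i j = ∑ l, w j l * v l i := fun j => by
    have := congrFun (hw j) i
    simpa [Finset.sum_apply] using this.symm
  simp only [hb, h1, map_sum, map_mul, Finset.mul_sum, Finset.sum_mul]
  rw [Finset.sum_comm]
  exact Finset.sum_congr rfl fun l _ => Finset.sum_congr rfl fun j _ => by ring

/-- The equational criterion for flatness for systems of relations. -/
theorem exists_trivial_of_flat_of_system {R S ι κ : Type*} [CommRing R] [CommRing S] {f : R →+* S}
    (hf : f.Flat) [Fintype ι] (c : κ → ι → R) (u : ι → S) (s : Finset κ)
    (h : ∀ k ∈ s, ∑ i, f (c k i) * u i = 0) : ∃ m, ∃ (b : ι → Fin m → R) (y : Fin m → S),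
      (∀ i, u i = ∑ j, f (b i j) * y j) ∧ ∀ k ∈ s, ∀ j, ∑ i, c k i * b i j = 0 := by
  classical
  induction s using Finset.induction_on with
  | empty =>
    let e := Fintype.equivFin ι
    refine ⟨_, fun i j => if j = e i then 1 else 0, fun j => u (e.symm j), fun i => ?_, by simp⟩
    simp [apply_ite f]
  | insert k s hk ih =>
    obtain ⟨m, b, y, hb, hc⟩ := ih fun k' hk' => h k' (Finset.mem_insert_of_mem hk')
    have h1 : ∑ j, f (∑ i, c k i * b i j) * y j = 0 := by
      rw [← h k (Finset.mem_insert_self _ _)]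
      simp only [hb, map_sum, map_mul, Finset.mul_sum, Finset.sum_mul]
      rw [Finset.sum_comm]
      simp only [mul_assoc]
    obtain ⟨m', b', y', hb', hc'⟩ := exists_trivial_of_flat hf _ y h1
    have key : ∀ k' l, ∑ i, c k' i * ∑ j, b i j * b' j l = ∑ j, (∑ i, c k' i * b i j) * b' j l := by
      intro k' l
      simp only [Finset.mul_sum, Finset.sum_mul]
      rw [Finset.sum_comm]
      simp only [mul_assoc]
    refine ⟨m', fun i l => ∑ j, b i j * b' j l, y', fun i => ?_, fun k' hk' l => ?_⟩
    · rw [hb]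
      simp only [hb', map_sum, map_mul, Finset.mul_sum, Finset.sum_mul]
      rw [Finset.sum_comm]
      simp only [mul_assoc]
    · rw [key]
      obtain rfl | hk' := Finset.mem_insert.1 hk'
      · exact hc' l
      · simp [hc k' hk']

open MvPolynomial Filter

namespace UProd

variable {U : Ultrafilter ℕ}

instance {R : ℕ → Type*} [∀ i, CommRing (R i)] [∀ i, Infinite (R i)] : Infinite (UProd U R) := by
  refine Infinite.of_injective (fun n : ℕ => mk U fun i => Infinite.natEmbedding (R i) n) ?_
  intro m n h
  obtain ⟨i, hi⟩ := (mk_eq_mk.1 h).exists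
  exact (Infinite.natEmbedding (R i)).injective hi

theorem mk_sum {R : ℕ → Type*} [∀ i, CommRing (R i)] {ι : Type*} (s : Finset ι) (f : ι → ∀ i, R i) :
    ∑ a ∈ s, mk U (f a) = mk U fun i => ∑ a ∈ s, f a i := by
  rw [← map_sum]
  exact congrArg _ (funext fun i => Finset.sum_apply _ _ _)

theorem mk_sum_mul {R : ℕ → Type*} [∀ i, CommRing (R i)] {ι : Type*} (s : Finset ι)
    (f g : ι → ∀ i, R i) :
    ∑ a ∈ s, mk U (f a) * mk U (g a) = mk U fun i => ∑ a ∈ s, f a i * g a i := by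
  simp only [← map_mul, mk_sum]
  rfl

variable {K : ℕ → Type u} [∀ i, Field (K i)] {N : ℕ → ℕ}

theorem aeval_mk_eq {s : ℕ} (g : ∀ i, Fin s → MvPolynomial (Fin (N i)) (K i))
    (p : MvPolynomial (Fin s) (UProd U K)) :
    (aeval (R := UProd U K) fun j => mk U fun i => g i j).toRingHom p =
      map U (fun i => (aeval (R := K i) (g i)).toRingHom) (ofMvPoly U K s p) := by
  have : (aeval (R := UProd U K) fun j => mk U fun i => g i j).toRingHom =
      (map U (fun i => (aeval (R := K i) (g i)).toRingHom)).comp (ofMvPoly U K s) := by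
    refine MvPolynomial.ringHom_ext (fun a => ?_) fun j => ?_
    · obtain ⟨a, rfl⟩ := mk_surjective a
      rw [RingHom.comp_apply, ofMvPoly_C, map_mk]
      simp [algebraMap_mk]
    · rw [RingHom.comp_apply, ofMvPoly_X, map_mk]
      simp
  exact RingHom.congr_fun this p

/-- Flat families of polynomials pass to the ultraproduct. -/
theorem flatFam_mk [Infinite (UProd U K)] {s : ℕ}
    {g : ∀ i, Fin s → MvPolynomial (Fin (N i)) (K i)} (hg : ∀ᶠ i in U, FlatFam (k := K i) (g i)) :
    FlatFam (k := UProd U K) fun j => mk U fun i => g i j := by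
  refine flat_of_exists_trivial fun l c u h => ?_
  obtain ⟨t, v, hv⟩ := Submodule.fg_iff_exists_fin_generating_family.1
    (IsNoetherian.noetherian (LinearMap.ker (Fintype.linearCombination
      (MvPolynomial (Fin s) (UProd U K)) c)))
  have hv1 : ∀ b : Fin l → MvPolynomial (Fin s) (UProd U K), ∑ i, c i * b i = 0 →
      b ∈ Submodule.span _ (Set.range v) := fun b hb => by
    rw [hv, LinearMap.mem_ker, Fintype.linearCombination_apply, ← hb]
    exact Finset.sum_congr rfl fun i _ => mul_comm _ _
  have hv2 : ∀ j, ∑ i, c i * v j i = 0 := fun j => by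
    have : v j ∈ LinearMap.ker (Fintype.linearCombination (MvPolynomial (Fin s) (UProd U K)) c) :=
      hv ▸ Submodule.subset_span (Set.mem_range_self j)
    rw [LinearMap.mem_ker, Fintype.linearCombination_apply] at this
    rw [← this]
    exact Finset.sum_congr rfl fun i _ => mul_comm _ _
  choose c' hc' using fun j => mk_surjective (ofMvPoly U K s (c j))
  choose v' hv' using fun j k => mk_surjective (ofMvPoly U K s (v j k))
  choose u' hu' using fun j => mk_surjective (u j)
  have hsyz : ∀ᶠ i in U, ∀ b : Fin l → MvPolynomial (Fin s) (K i), ∑ j, c' j i * b j = 0 →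
      b ∈ Submodule.span (MvPolynomial (Fin s) (K i)) (Set.range fun j k => v' j k i) := by
    by_contra hne
    rw [← Ultrafilter.eventually_not] at hne
    have : ∀ i, ∃ b : Fin l → MvPolynomial (Fin s) (K i),
        (¬ ∀ b : Fin l → MvPolynomial (Fin s) (K i), ∑ j, c' j i * b j = 0 →
          b ∈ Submodule.span (MvPolynomial (Fin s) (K i)) (Set.range fun j k => v' j k i)) →
              ∑ j, c' j i * b j = 0 ∧
          b ∉ Submodule.span (MvPolynomial (Fin s) (K i)) (Set.range fun j k => v' j k i) := by
      intro i
      by_cases h : ∀ b : Fin l → MvPolynomial (Fin s) (K i), ∑ j, c' j i * b j = 0 →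
          b ∈ Submodule.span (MvPolynomial (Fin s) (K i)) (Set.range fun j k => v' j k i)
      · exact ⟨0, fun h' => absurd h h'⟩
      · push Not at h
        obtain ⟨b, hb⟩ := h
        exact ⟨b, fun _ => hb⟩
    choose b hb using this
    obtain ⟨z, hz⟩ := exists_of_flat_of_syzygies (flat_ofMvPoly s) c v hv1
      (fun j => mk U fun i => b i j) (by
        simp only [← hc', mk_sum_mul]
        rw [mk_eq_zero]
        exact hne.mono fun i hi => (hb i hi).1)
    choose z' hz' using fun j => mk_surjective (z j)
    simp only [← hz', ← hv', mk_sum_mul, mk_eq_mk] at hz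
    obtain ⟨i, h1, h2⟩ := (hne.and (eventually_all.2 hz)).exists
    refine (hb i h1).2 ((Submodule.mem_span_range_iff_exists_fun _).2 ⟨fun j => z' j i, ?_⟩)
    funext k
    rw [h2 k, Finset.sum_apply]
    exact Finset.sum_congr rfl fun j _ => mul_comm _ _
  simp only [aeval_mk_eq, ← hc', ← hu', map_mk, mk_sum_mul, mk_eq_zero] at h
  have hz : ∀ i, ∃ z : Fin t → MvPolynomial (Fin (N i)) (K i),
      (FlatFam (k := K i) (g i) ∧ (∀ b : Fin l → MvPolynomial (Fin s) (K i),
        ∑ j, c' j i * b j = 0 →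
            b ∈ Submodule.span (MvPolynomial (Fin s) (K i)) (Set.range fun j k => v' j k i)) ∧
      ∑ j, (aeval (R := K i) (g i)).toRingHom (c' j i) * u' j i = 0) →
      ∀ k, u' k i = ∑ j, (aeval (R := K i) (g i)).toRingHom (v' j k i) * z j := by
    intro i
    by_cases hi : FlatFam (k := K i) (g i) ∧ (∀ b : Fin l → MvPolynomial (Fin s) (K i),
        ∑ j, c' j i * b j = 0 →
            b ∈ Submodule.span (MvPolynomial (Fin s) (K i)) (Set.range fun j k => v' j k i)) ∧
      ∑ j, (aeval (R := K i) (g i)).toRingHom (c' j i) * u' j i = 0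
    · obtain ⟨z, hz⟩ := exists_of_flat_of_syzygies hi.1 _ _ hi.2.1 _ hi.2.2
      exact ⟨z, fun _ => hz⟩
    · exact ⟨0, fun h => absurd h hi⟩
  choose z hz using hz
  refine ⟨t, fun i j => v j i, fun j => mk U fun i => z i j, fun k => ?_, hv2⟩
  simp only [aeval_mk_eq, ← hv', ← hu', map_mk, mk_sum_mul, mk_eq_mk]
  filter_upwards [hg, hsyz, h] with i h1 h2 h3
  exact hz i ⟨h1, h2, h3⟩ k

/-- Finitely many polynomials of bounded degree come from a noetherian ring over which the
ultraproduct is flat. -/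
theorem exists_flat_model [∀ i, IsAlgClosed (K i)] {ι : Type*} [Fintype ι] {d : ℕ}
    (f : ∀ i, ι → MvPolynomial (Fin (N i)) (K i)) (hf : ∀ i a, (f i a).totalDegree ≤ d) :
    ∃ (s : ℕ) (φ : MvPolynomial (Fin s) (UProd U K) →+*
        UProd U fun i => MvPolynomial (Fin (N i)) (K i)), φ.Flat ∧
      (∀ p, ∃ (q : ∀ i, MvPolynomial (Fin (N i)) (K i)) (B : ℕ),
        (∀ i, (q i).totalDegree ≤ B) ∧ mk U q = φ p) ∧
      ∀ a, ∃ p, φ p = mk U fun i => f i a := by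
  obtain ⟨s, g, hg, hflat, hf'⟩ := bdd.exists_flatFam (U := U) f hf
  have hval : ∀ p, (bdd U K N).val (aeval (R := UProd U K)
      (fun j => (bdd.mk (fun i => g i j) (hg j) : bdd U K N)) p) =
        (aeval (R := UProd U K) fun j => mk U fun i => g i j) p := by
    intro p
    rw [comp_aeval_apply]
    rfl
  refine ⟨s, _, flatFam_mk hflat, fun p => ?_, fun a => ?_⟩
  · have := (aeval (R := UProd U K) (fun j => (bdd.mk (fun i => g i j) (hg j) : bdd U K N)) p).2
    obtain ⟨q, B, hB, hq⟩ := this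
    exact ⟨q, B, hB, hq.trans (hval p)⟩
  · have := hf' a
    rw [Algebra.adjoin_range_eq_range_aeval] at this
    obtain ⟨p, hp⟩ := (AlgHom.mem_range _).1 this
    exact ⟨p, (hval p).symm.trans (congrArg _ hp)⟩

end UProd
end SmallSubalgebra

namespace SmallSubalgebra

section

variable {R : Type*} [CommRing R] {β μ π ν : Type*} [Fintype π]

/-- The vectors which finitely many linear maps, given by their matrices, send into the span of
given vectors. -/
def transporter (L : β → μ → π → R) (P : ν → μ → R) : Submodule R (π → R) where
  carrier := {x | ∀ b, (fun j => ∑ p, L b j p * x p) ∈ Submodule.span R (Set.range P)}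
  add_mem' := by
    intro x y hx hy b
    convert add_mem (hx b) (hy b) using 1
    funext j
    simp [mul_add, Finset.sum_add_distrib]
  zero_mem' := by
    intro b
    convert zero_mem (Submodule.span R (Set.range P)) using 1
    funext j
    simp
  smul_mem' := by
    intro r x hx b
    convert Submodule.smul_mem _ r (hx b) using 1
    funext j
    simp [Finset.mul_sum, mul_left_comm]

theorem mem_transporter {L : β → μ → π → R} {P : ν → μ → R} {x : π → R} :
    x ∈ transporter L P ↔
      ∀ b, (fun j => ∑ p, L b j p * x p) ∈ Submodule.span R (Set.range P) := Iff.rfl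

theorem mem_transporter_iff_exists [Fintype ν] {L : β → μ → π → R} {P : ν → μ → R} {x : π → R} :
    x ∈ transporter L P ↔ ∃ w : β → ν → R, ∀ b j, ∑ p, L b j p * x p = ∑ a, P a j * w b a := by
  rw [mem_transporter, ← Classical.skolem (p := fun b (w : ν → R) =>
    ∀ j, ∑ p, L b j p * x p = ∑ a, P a j * w a)]
  refine forall_congr' fun b => ?_
  rw [Submodule.mem_span_range_iff_exists_fun]
  refine exists_congr fun w => ?_
  rw [funext_iff]
  refine forall_congr' fun j => ?_
  simp only [Finset.sum_apply, Pi.smul_apply, smul_eq_mul]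
  rw [eq_comm]
  simp only [mul_comm]

theorem exists_of_mem_transporter_map [Fintype β] [Fintype μ] [Fintype ν] {κ : Type*} [Fintype κ]
    {S : Type*} [CommRing S] {f : R →+* S} (hf : f.Flat) {L : β → μ → π → R} {P : ν → μ → R}
    {h : κ → π → R} (hh : transporter L P ≤ Submodule.span R (Set.range h)) {x : π → S}
    (hx : x ∈ transporter (fun b j p => f (L b j p)) fun a j => f (P a j)) :
    ∃ z : κ → S, ∀ p, x p = ∑ l, f (h l p) * z l := by
  classical
  obtain ⟨w, hw⟩ := mem_transporter_iff_exists.1 hx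
  obtain ⟨m, b, y, hb, hc⟩ := exists_trivial_of_flat_of_system hf
    (fun (k : β × μ) => Sum.elim (fun p => L k.1 k.2 p)
      fun t : β × ν => if k.1 = t.1 then -P t.2 k.2 else 0)
    (Sum.elim x fun t : β × ν => w t.1 t.2) Finset.univ (by
      rintro ⟨b, j⟩ -
      simp [Fintype.sum_sum_type, Fintype.sum_prod_type, hw, apply_ite f, Finset.sum_ite_irrel])
  have hmem : ∀ l, (fun p => b (Sum.inl p) l) ∈ transporter L P := by
    intro l
    refine mem_transporter_iff_exists.2 ⟨fun b' a => b (Sum.inr (b', a)) l, fun b' j => ?_⟩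
    have := hc (b', j) (Finset.mem_univ _) l
    simpa [Fintype.sum_sum_type, Fintype.sum_prod_type, Finset.sum_ite_irrel,
      ← sub_eq_add_neg, sub_eq_zero] using this
  choose e he using fun l => (Submodule.mem_span_range_iff_exists_fun R).1 (hh (hmem l))
  refine ⟨fun t => ∑ l, f (e l t) * y l, fun p => ?_⟩
  have h1 : ∀ l, b (Sum.inl p) l = ∑ t, e l t * h t p := fun l => by
    have := congrFun (he l) p
    simpa [Finset.sum_apply] using this.symm
  have := hb (Sum.inl p)
  rw [Sum.elim_inl] at this
  rw [this]
  simp only [h1, map_sum, map_mul, Finset.mul_sum, Finset.sum_mul]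
  rw [Finset.sum_comm]
  exact Finset.sum_congr rfl fun l _ => Finset.sum_congr rfl fun j _ => by ring

end

open Filter

theorem UProd.eventually_span_eq_transporter {U : Ultrafilter ℕ} {R : ℕ → Type*}
    [∀ i, CommRing (R i)] {β μ π ν κ : Type*} [Fintype β] [Fintype μ] [Fintype π] [Fintype ν]
    [Fintype κ] {A : Type*} [CommRing A] {φ : A →+* UProd U R} (hφ : φ.Flat)
    {L : β → μ → π → A} {P : ν → μ → A} {h : κ → π → A}
    (hh : Submodule.span A (Set.range h) = transporter L P)
    {L' : ∀ i, β → μ → π → R i} {P' : ∀ i, ν → μ → R i} {h' : ∀ i, κ → π → R i}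
    (hL : ∀ b j p, φ (L b j p) = mk U fun i => L' i b j p)
    (hP : ∀ a j, φ (P a j) = mk U fun i => P' i a j)
    (hh' : ∀ l p, φ (h l p) = mk U fun i => h' i l p) :
    ∀ᶠ i in U, Submodule.span (R i) (Set.range (h' i)) = transporter (L' i) (P' i) := by
  have h1 : ∀ᶠ i in U, ∀ l, h' i l ∈ transporter (L' i) (P' i) := by
    refine eventually_all.2 fun l => ?_
    have hl : h l ∈ transporter L P := hh ▸ Submodule.subset_span (Set.mem_range_self l)
    obtain ⟨w, hw⟩ := mem_transporter_iff_exists.1 hl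
    choose w' hw' using fun b a => mk_surjective (φ (w b a))
    have : ∀ b j, ∀ᶠ i in U, ∑ p, L' i b j p * h' i l p = ∑ a, P' i a j * w' b a i := by
      intro b j
      have := congrArg φ (hw b j)
      simp only [map_sum, map_mul, hL, hP, hh', ← hw', mk_sum_mul, mk_eq_mk] at this
      exact this
    filter_upwards [eventually_all.2 fun b => eventually_all.2 (this b)] with i hi
    exact mem_transporter_iff_exists.2 ⟨fun b a => w' b a i, hi⟩
  have h2 : ∀ᶠ i in U, transporter (L' i) (P' i) ≤ Submodule.span (R i) (Set.range (h' i)) := by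
    by_contra hne
    rw [← Ultrafilter.eventually_not] at hne
    have : ∀ i, ∃ x : π → R i,
        (¬ transporter (L' i) (P' i) ≤ Submodule.span (R i) (Set.range (h' i))) →
          x ∈ transporter (L' i) (P' i) ∧ x ∉ Submodule.span (R i) (Set.range (h' i)) := by
      intro i
      by_cases hi : transporter (L' i) (P' i) ≤ Submodule.span (R i) (Set.range (h' i))
      · exact ⟨0, fun h => absurd hi h⟩
      · obtain ⟨x, hx⟩ := Set.not_subset.1 hi
        exact ⟨x, fun _ => hx⟩
    choose x hx using this
    have : ∀ i, ∃ w : β → ν → R i, x i ∈ transporter (L' i) (P' i) →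
        ∀ b j, ∑ p, L' i b j p * x i p = ∑ a, P' i a j * w b a := by
      intro i
      by_cases hi : x i ∈ transporter (L' i) (P' i)
      · exact (mem_transporter_iff_exists.1 hi).imp fun _ h _ => h
      · exact ⟨0, fun h => absurd h hi⟩
    choose w hw using this
    obtain ⟨z, hz⟩ := exists_of_mem_transporter_map hφ hh.ge (x := fun p => mk U fun i => x i p)
      (mem_transporter_iff_exists.2 ⟨fun b a => mk U fun i => w i b a, fun b j => by
        simp only [hL, hP, mk_sum_mul, mk_eq_mk]
        exact hne.mono fun i hi => hw i (hx i hi).1 b j⟩)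
    choose z' hz' using fun j => mk_surjective (z j)
    simp only [← hz', hh', mk_sum_mul, mk_eq_mk] at hz
    obtain ⟨i, h1, h2⟩ := (hne.and (eventually_all.2 hz)).exists
    refine (hx i h1).2 ((Submodule.mem_span_range_iff_exists_fun _).2 ⟨fun j => z' j i, ?_⟩)
    funext k
    rw [h2 k, Finset.sum_apply]
    exact Finset.sum_congr rfl fun j _ => mul_comm _ _
  filter_upwards [h1, h2] with i h3 h4
  exact le_antisymm (Submodule.span_le.2 (Set.range_subset_iff.2 h3)) h4

end SmallSubalgebra

namespace SmallSubalgebra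

section

variable {R : Type*} [CommRing R] {μ ν ν' : Type*}

open scoped Classical in
/-- The matrices of the multiplications by the products of `k` members of a family. -/
noncomputable def powMatrix (g : ν → R) (k : ℕ) (b : Fin k → ν) (j p : μ) : R :=
  if j = p then ∏ t, g (b t) else 0

theorem span_range_pow_eq (g : ν → R) (k : ℕ) :
    Ideal.span (Set.range g) ^ k = Ideal.span (Set.range fun b : Fin k → ν => ∏ t, g (b t)) := by
  rw [Ideal.span, Ideal.span, Submodule.span_pow]
  congr 1
  ext a
  rw [Set.mem_pow]
  constructor
  · rintro ⟨f, rfl⟩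
    choose b hb using fun t => (f t).2
    exact ⟨b, by simp [hb, List.prod_ofFn]⟩
  · rintro ⟨b, rfl⟩
    exact ⟨fun t => ⟨g (b t), Set.mem_range_self _⟩, by simp [List.prod_ofFn]⟩

theorem forall_mem_span_range_smul_mem_iff {V : Type*} [AddCommGroup V] [Module R V] (g : ν → R)
    (M : Submodule R V) (u : V) :
    (∀ r ∈ Ideal.span (Set.range g), r • u ∈ M) ↔ ∀ b, g b • u ∈ M := by
  have : (∀ r ∈ Ideal.span (Set.range g), r • u ∈ M) ↔
      Ideal.span (Set.range g) ≤ M.comap (LinearMap.toSpanSingleton R V u) := Iff.rfl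
  rw [this, Ideal.span, Submodule.span_le, Set.range_subset_iff]
  rfl

theorem mem_transporter_powMatrix [Fintype μ] {g : ν → R} {k : ℕ} {P : ν' → μ → R} {u : μ → R} :
    u ∈ transporter (powMatrix g k) P ↔
      ∀ r ∈ Ideal.span (Set.range g) ^ k, r • u ∈ Submodule.span R (Set.range P) := by
  rw [span_range_pow_eq, forall_mem_span_range_smul_mem_iff, mem_transporter]
  refine forall_congr' fun b => ?_
  have : (fun j => ∑ p, powMatrix g k b j p * u p) = (∏ t, g (b t)) • u := by
    funext j
    rw [Finset.sum_eq_single j (fun p _ hp => by rw [powMatrix, if_neg hp.symm, zero_mul])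
        (by simp),
      powMatrix, if_pos rfl]
    rfl
  rw [this]

/-- A saturation which is stationary at one step is stationary forever. -/
theorem smul_mem_of_stationary {V : Type*} [AddCommGroup V] [Module R V] {M : Submodule R V}
    {I : Ideal R} {k : ℕ}
    (h : ∀ u, (∀ r ∈ I ^ (k + 1), r • u ∈ M) → ∀ r ∈ I ^ k, r • u ∈ M) (l : ℕ) :
    ∀ u, (∀ r ∈ I ^ (k + l), r • u ∈ M) → ∀ r ∈ I ^ k, r • u ∈ M := by
  induction l with
  | zero => exact fun u hu => hu
  | succ l ih =>
    refine fun u hu => ih u fun r hr => ?_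
    rw [pow_add, mul_comm] at hr
    induction hr using Submodule.mul_induction_on' with
    | mem_mul_mem a ha b hb =>
      rw [mul_comm, mul_smul]
      refine h (a • u) (fun r hr => ?_) b hb
      rw [smul_smul]
      refine hu _ ?_
      rw [show k + (l + 1) = (k + 1) + l by ring, pow_add]
      exact Ideal.mul_mem_mul hr ha
    | add a _ b _ ha hb =>
      rw [add_smul]
      exact add_mem ha hb

theorem exists_padding {V : Type*} [AddCommGroup V] [Module R V] {t E : ℕ} (h : Fin t → V)
    (hE : t ≤ E) : ∃ g : Fin E → V,
        Submodule.span R (Set.range g) = Submodule.span R (Set.range h) ∧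
      ∀ l, g l = 0 ∨ ∃ l', g l = h l' := by
  refine ⟨fun l => if hl : l.1 < t then h ⟨l, hl⟩ else 0, le_antisymm ?_ ?_, fun l => ?_⟩
  · refine Submodule.span_le.2 (Set.range_subset_iff.2 fun l => ?_)
    split_ifs
    · exact Submodule.subset_span (Set.mem_range_self _)
    · exact zero_mem _
  · refine Submodule.span_mono (Set.range_subset_iff.2 fun l => ⟨Fin.castLE hE l, ?_⟩)
    simp
  · dsimp only
    split_ifs
    · exact Or.inr ⟨_, rfl⟩
    · exact Or.inl rfl

end

open MvPolynomial Filter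

/-- Transporters have generating sets bounded in terms of the sizes and degrees of the data. -/
theorem exists_bounded_transporter (β μ π ν : Type) [Fintype β] [Fintype μ] [Fintype π] [Fintype ν]
    (d : ℕ) : ∃ E : ℕ, ∀ Γ ≥ E, ∀ (K : Type u) [Field K] [IsAlgClosed K] (N : ℕ)
      (L : β → μ → π → MvPolynomial (Fin N) K) (P : ν → μ → MvPolynomial (Fin N) K),
      (∀ b j p, (L b j p).totalDegree ≤ d) → (∀ a j, (P a j).totalDegree ≤ d) →
      ∃ h : Fin Γ → π → MvPolynomial (Fin N) K, (∀ l p, (h l p).totalDegree ≤ Γ) ∧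
        Submodule.span (MvPolynomial (Fin N) K) (Set.range h) = transporter L P := by
  by_contra hne
  rw [not_exists] at hne
  simp only [not_forall] at hne
  choose Γ hΓ K hF hA N L P hL hP hno using hne
  obtain ⟨s, φ, hφ, hbdd, hlift⟩ := UProd.exists_flat_model (U := hyperfilter ℕ)
    (ι := (β × μ × π) ⊕ (ν × μ)) (d := d)
    (fun i => Sum.elim (fun x => L i x.1 x.2.1 x.2.2) fun x => P i x.1 x.2) (by
      rintro i (x | x)
      · exact hL i _ _ _
      · exact hP i _ _)
  choose l hl using hlift
  obtain ⟨t, h, hh⟩ := Submodule.fg_iff_exists_fin_generating_family.1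
    (IsNoetherian.noetherian (transporter (fun b j p => l (Sum.inl (b, j, p)))
      fun a j => l (Sum.inr (a, j))))
  choose h' B hB hh' using fun c p => hbdd (h c p)
  have h1 := UProd.eventually_span_eq_transporter hφ hh (L' := L) (P' := P)
    (h' := fun i c p => h' c p i) (fun b j p => hl _) (fun a j => hl _) fun c p => (hh' c p).symm
  have h2 : ∀ᶠ i in (hyperfilter ℕ : Filter ℕ), max t (∑ c, ∑ p, B c p) ≤ i :=
    Nat.hyperfilter_le_atTop (eventually_ge_atTop _)
  obtain ⟨i, h3, h4⟩ := (h1.and h2).exists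
  replace h4 := h4.trans (hΓ i)
  obtain ⟨g, hg, hg'⟩ := exists_padding (R := MvPolynomial (Fin (N i)) (K i))
    (fun c p => h' c p i) ((le_max_left _ _).trans h4)
  refine hno i ⟨g, fun c p => ?_, hg.trans h3⟩
  obtain h5 | ⟨c₀, h5⟩ := hg' c
  · simp [h5]
  · rw [h5]
    refine (hB _ _ _).trans (le_trans ?_ ((le_max_right _ _).trans h4))
    exact (Finset.single_le_sum (f := fun p => B c₀ p) (fun _ _ => Nat.zero_le _)
      (Finset.mem_univ p)).trans (Finset.single_le_sum (f := fun c => ∑ p, B c p)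
        (fun _ _ => Nat.zero_le _) (Finset.mem_univ c₀))

/-- The exponent needed for a saturation is bounded in terms of the sizes and degrees of the
data. -/
theorem exists_bounded_saturation_exponent (μ ν ν' : Type) [Fintype μ] [Fintype ν] [Fintype ν']
    (d : ℕ) : ∃ k : ℕ, ∀ (K : Type u) [Field K] [IsAlgClosed K] (N : ℕ)
      (g : ν → MvPolynomial (Fin N) K) (P : ν' → μ → MvPolynomial (Fin N) K),
      (∀ a, (g a).totalDegree ≤ d) → (∀ a j, (P a j).totalDegree ≤ d) →
      ∀ l u, u ∈ transporter (powMatrix g l) P → u ∈ transporter (powMatrix g k) P := by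
  by_contra hne
  rw [not_exists] at hne
  simp only [not_forall] at hne
  choose K hF hA N g P hg hP l u hu hno using hne
  obtain ⟨s, φ, hφ, -, hlift⟩ := UProd.exists_flat_model (U := hyperfilter ℕ)
    (ι := ν ⊕ (ν' × μ)) (d := d)
    (fun i => Sum.elim (g i) fun x => P i x.1 x.2) (by
      rintro i (x | x)
      · exact hg i _
      · exact hP i _ _)
  choose q hq using hlift
  let G := fun a => q (Sum.inl a)
  let Q := fun a j => q (Sum.inr (a, j))
  obtain ⟨k, hk⟩ := monotone_stabilizes_iff_noetherian.2 inferInstance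
    (⟨fun k => transporter (powMatrix G k) Q, monotone_nat_of_le_succ fun k u hu =>
      mem_transporter_powMatrix.2 fun r hr => mem_transporter_powMatrix.1 hu r
        (Ideal.pow_le_pow_right (Nat.le_succ k) hr)⟩ :
      ℕ →o Submodule (MvPolynomial (Fin s) (UProd (hyperfilter ℕ) K))
        (μ → MvPolynomial (Fin s) (UProd (hyperfilter ℕ) K)))
  obtain ⟨t, h, hh⟩ := Submodule.fg_iff_exists_fin_generating_family.1
    (IsNoetherian.noetherian (transporter (powMatrix G k) Q))
  choose h' hh' using fun c p => UProd.mk_surjective (φ (h c p))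
  have hL : ∀ k b (j p : μ), φ (powMatrix G k b j p) =
      UProd.mk _ fun i => powMatrix (g i) k b j p := by
    intro k b j p
    unfold powMatrix
    split_ifs
    · rw [map_prod]
      simp only [G, hq, ← map_prod]
      exact congrArg _ (funext fun i => Finset.prod_apply _ _ _)
    · rw [map_zero]
      exact (map_zero _).symm
  have h1 := UProd.eventually_span_eq_transporter hφ hh (L' := fun i => powMatrix (g i) k) (P' := P)
    (h' := fun i c p => h' c p i) (hL k) (fun a j => hq _) fun c p => (hh' c p).symm
  have h2 := UProd.eventually_span_eq_transporter hφ (hh.trans (hk (k + 1) (Nat.le_succ k)))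
    (L' := fun i => powMatrix (g i) (k + 1)) (P' := P)
    (h' := fun i c p => h' c p i) (hL (k + 1)) (fun a j => hq _) fun c p => (hh' c p).symm
  have h3 : ∀ᶠ i in (hyperfilter ℕ : Filter ℕ), k ≤ i :=
    Nat.hyperfilter_le_atTop (eventually_ge_atTop _)
  obtain ⟨i, h4, h5, h6⟩ := (h1.and (h2.and h3)).exists
  refine hno i (mem_transporter_powMatrix.2 fun r hr => ?_)
  refine smul_mem_of_stationary (k := k) (fun v hv => ?_) (l i) (u i) (fun r hr => ?_) r
    (Ideal.pow_le_pow_right h6 hr)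
  · rw [← mem_transporter_powMatrix, ← h4, h5]
    exact mem_transporter_powMatrix.2 hv
  · exact mem_transporter_powMatrix.1 (hu i) r (Ideal.pow_le_pow_right (Nat.le_add_left _ _) hr)

theorem totalDegree_powMatrix_le {K : Type*} [Field K] {N d : ℕ} {μ ν : Type*}
    {g : ν → MvPolynomial (Fin N) K} (hg : ∀ a, (g a).totalDegree ≤ d) (k : ℕ) (b : Fin k → ν)
    (j p : μ) : (powMatrix g k b j p).totalDegree ≤ k * d := by
  unfold powMatrix
  split_ifs
  · refine (totalDegree_finsetProd _ _).trans ((Finset.sum_le_sum fun t _ => hg (b t)).trans ?_)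
    simp
  · simp

/-- The ideals and submodules obtained from data of bounded size and degree by forming quotients
and saturations have bounded generating sets. -/
theorem exists_bound (m n d : ℕ) : ∃ Γ : ℕ, ∀ (K : Type u) [Field K] [IsAlgClosed K] (N : ℕ)
    (P Q : Fin n → Fin m → MvPolynomial (Fin N) K) (g : Fin n → MvPolynomial (Fin N) K),
    (∀ a j, (P a j).totalDegree ≤ d) → (∀ a j, (Q a j).totalDegree ≤ d) →
    (∀ a, (g a).totalDegree ≤ d) →
    (∃ h : Fin Γ → Unit → MvPolynomial (Fin N) K, (∀ l p, (h l p).totalDegree ≤ Γ) ∧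
      Submodule.span (MvPolynomial (Fin N) K) (Set.range h) =
        transporter (fun b j _ => Q b j) P) ∧
    (∃ h : Fin Γ → Fin m → MvPolynomial (Fin N) K, (∀ l p, (h l p).totalDegree ≤ Γ) ∧
      Submodule.span (MvPolynomial (Fin N) K) (Set.range h) = transporter (powMatrix g 1) P) ∧
    ∃ h : Fin Γ → Fin m → MvPolynomial (Fin N) K, (∀ l p, (h l p).totalDegree ≤ Γ) ∧
      ∃ k, Submodule.span (MvPolynomial (Fin N) K) (Set.range h) = transporter (powMatrix g k) P ∧
        ∀ l u, u ∈ transporter (powMatrix g l) P → u ∈ transporter (powMatrix g k) P := by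
  obtain ⟨k, hk⟩ := exists_bounded_saturation_exponent.{u} (Fin m) (Fin n) (Fin n) d
  obtain ⟨E₁, h₁⟩ := exists_bounded_transporter.{u} (Fin n) (Fin m) Unit (Fin n) d
  obtain ⟨E₂, h₂⟩ := exists_bounded_transporter.{u} (Fin 1 → Fin n) (Fin m) (Fin m) (Fin n) (1 * d)
  obtain ⟨E₃, h₃⟩ := exists_bounded_transporter.{u} (Fin k → Fin n) (Fin m) (Fin m) (Fin n)
    (max (k * d) d)
  refine ⟨max E₁ (max E₂ E₃), fun K _ _ N P Q g hP hQ hg => ⟨?_, ?_, ?_⟩⟩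
  · exact h₁ _ (le_max_left _ _) K N _ _ (fun b j _ => hQ b j) hP
  · exact h₂ _ ((le_max_left _ _).trans (le_max_right _ _)) K N _ _ (totalDegree_powMatrix_le hg 1)
      fun a j => (hP a j).trans (one_mul d).ge
  · obtain ⟨h, hd, hh⟩ := h₃ _ ((le_max_right _ _).trans (le_max_right _ _)) K N _ _
      (fun b j p => (totalDegree_powMatrix_le hg k b j p).trans (le_max_left _ _))
      fun a j => (hP a j).trans (le_max_right _ _)
    exact ⟨h, hd, k, hh, hk K N g P hg hP⟩

theorem mem_colon_iff_mem_transporter {R : Type*} [CommRing R] {μ ν ν' : Type*}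
    {P : ν → μ → R} {Q : ν' → μ → R} {r : R} :
    r ∈ Submodule.colon (Submodule.span R (Set.range P)) (Submodule.span R (Set.range Q)) ↔
      (fun _ : Unit => r) ∈ transporter (fun b j _ => Q b j) P := by
  rw [Submodule.mem_colon, mem_transporter]
  have : (∀ p ∈ (Submodule.span R (Set.range Q) : Set (μ → R)),
      r • p ∈ Submodule.span R (Set.range P)) ↔
      Submodule.span R (Set.range Q) ≤
        (Submodule.span R (Set.range P)).comap (LinearMap.lsmul R (μ → R) r) := Iff.rfl
  rw [this, Submodule.span_le, Set.range_subset_iff]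
  refine forall_congr' fun b => ?_
  have : (fun j => ∑ _p : Unit, Q b j * r) = LinearMap.lsmul R (μ → R) r (Q b) := by
    funext j
    simp [mul_comm]
  rw [this]
  rfl

theorem mem_ideal_span_range_iff {R : Type*} [CommRing R] {κ : Type*} [Fintype κ]
    {h : κ → Unit → R} {r : R} :
    r ∈ Ideal.span (Set.range fun l => h l ()) ↔
      (fun _ : Unit => r) ∈ Submodule.span R (Set.range h) := by
  rw [Ideal.mem_span_range_iff_exists_fun, Submodule.mem_span_range_iff_exists_fun]
  refine exists_congr fun c => ?_
  rw [funext_iff]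
  simp only [smul_eq_mul, Finset.sum_apply, Pi.smul_apply]
  exact ⟨fun h _ => h, fun h => h ()⟩

end SmallSubalgebra

/-- There is a function `Γ`, independent of `N` and `K`, such that for every
algebraically closed field `K`, submodules `M`, `Q` of `G = R^m` (`R = K[x_1, …, x_N]`) and an
ideal `I` of `R`, all generated by at most `n` elements of degree at most `d`, each of the
ideal `M :_R Q`, the submodule `M :_G I`, and the saturation `M :_G I^∞` is generated by at
most `Γ m n d` elements of degree at most `Γ m n d`. -/
theorem statement13 :
    ∃ Γ : ℕ → ℕ → ℕ → ℕ,
      ∀ (K : Type u) [Field K] [IsAlgClosed K] (N m n d : ℕ)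
        (M Q : Submodule (MvPolynomial (Fin N) K) (Fin m → MvPolynomial (Fin N) K))
        (I : Ideal (MvPolynomial (Fin N) K)),
        (∃ g : Fin n → (Fin m → MvPolynomial (Fin N) K),
          (∀ a j, (g a j).totalDegree ≤ d) ∧
          Submodule.span (MvPolynomial (Fin N) K) (Set.range g) = M) →
        (∃ g : Fin n → (Fin m → MvPolynomial (Fin N) K),
          (∀ a j, (g a j).totalDegree ≤ d) ∧
          Submodule.span (MvPolynomial (Fin N) K) (Set.range g) = Q) →
        (∃ g : Fin n → MvPolynomial (Fin N) K,
          (∀ a, (g a).totalDegree ≤ d) ∧ Ideal.span (Set.range g) = I) →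
        (∃ g : Fin (Γ m n d) → MvPolynomial (Fin N) K,
          (∀ a, (g a).totalDegree ≤ Γ m n d) ∧
          Ideal.span (Set.range g) = Submodule.colon M Q) ∧
        (∃ g : Fin (Γ m n d) → (Fin m → MvPolynomial (Fin N) K),
          (∀ a j, (g a j).totalDegree ≤ Γ m n d) ∧
          (Submodule.span (MvPolynomial (Fin N) K) (Set.range g) :
              Set (Fin m → MvPolynomial (Fin N) K)) =
            {u | ∀ r ∈ I, r • u ∈ M}) ∧
        (∃ g : Fin (Γ m n d) → (Fin m → MvPolynomial (Fin N) K),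
          (∀ a j, (g a j).totalDegree ≤ Γ m n d) ∧
          (Submodule.span (MvPolynomial (Fin N) K) (Set.range g) :
              Set (Fin m → MvPolynomial (Fin N) K)) =
            {u | ∃ k : ℕ, ∀ r ∈ I ^ k, r • u ∈ M}) := by
  choose Γ hΓ using SmallSubalgebra.exists_bound.{u}
  refine ⟨Γ, ?_⟩
  rintro K _ _ N m n d _ _ _ ⟨P, hP, rfl⟩ ⟨Q, hQ, rfl⟩ ⟨g, hg, rfl⟩
  obtain ⟨⟨h₁, hd₁, hh₁⟩, ⟨h₂, hd₂, hh₂⟩, h₃, hd₃, k, hh₃, hk⟩ := hΓ m n d K N P Q g hP hQ hg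
  refine ⟨⟨fun l => h₁ l (), fun l => hd₁ l (), ?_⟩, ⟨h₂, hd₂, ?_⟩, h₃, hd₃, ?_⟩
  · ext r
    rw [SmallSubalgebra.mem_ideal_span_range_iff, hh₁,
      SmallSubalgebra.mem_colon_iff_mem_transporter]
  · ext u
    rw [SetLike.mem_coe, hh₂, SmallSubalgebra.mem_transporter_powMatrix, pow_one]
    rfl
  · ext u
    rw [SetLike.mem_coe, hh₃]
    constructor
    · exact fun hu => ⟨k, SmallSubalgebra.mem_transporter_powMatrix.1 hu⟩
    · rintro ⟨l, hl⟩
      exact hk l u (SmallSubalgebra.mem_transporter_powMatrix.2 hl)
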